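/- arXiv:2002.01654 — 2 statements merged into one kernel-verified Lean document; each statement's English description precedes it below -/
import Mathlib

section
/- For every integer k ≥ 0 the set {α > 0 : a(α) = −kπ} is nonempty and bounded above and attains its maximum e_k; setting C_k = |I(e_k)|, the sequence (C_k)_{k≥0} is monotone: either C_{k+1} ≤ C_k for all k ≥ 0, or C_{k+1} ≥ C_k for all k ≥ 0. -/
open Set Filter

/-- `u` is a solution of the ODE `u'' + h u' + λ(|u|^{q-1} u - u) = 0`,
being C¹ on the closed set `S` (with derivative `u'`) and C² on `Sint`
(with second derivative `u''`), where the equation holds on `Sint`. -/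
def SolOn (h : ℝ → ℝ) (lam q : ℝ) (S Sint : Set ℝ) (u u' u'' : ℝ → ℝ) : Prop :=
  (∀ t ∈ S, HasDerivWithinAt u (u' t) S t) ∧
  ContinuousOn u' S ∧
  (∀ t ∈ Sint, HasDerivWithinAt u' (u'' t) Sint t) ∧
  ContinuousOn u'' Sint ∧
  (∀ t ∈ Sint, u'' t + h t * u' t + lam * (|u t| ^ (q - 1) * u t - u t) = 0)

/-- The Euclidean norm on ℝ². -/
noncomputable def enorm2 (p : ℝ × ℝ) : ℝ := Real.sqrt (p.1 ^ 2 + p.2 ^ 2)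

/-- A continuous nowhere vanishing planar field on the plane has a continuous polar angle. -/
theorem exists_continuous_angle (f g : ℝ × ℝ → ℝ) (hf : Continuous f) (hg : Continuous g)
    (hne : ∀ x, f x = 0 → g x ≠ 0) :
    ∃ θ : ℝ × ℝ → ℝ, Continuous θ ∧
      ∀ x, ∃ r, 0 < r ∧ f x = r * Real.cos (θ x) ∧ g x = r * Real.sin (θ x) := by
  let F : C(ℝ × ℝ, ℂ) := ⟨fun x => (f x : ℂ) + (g x : ℂ) * Complex.I, by fun_prop⟩
  have hF : ∀ x, F x ∈ ({0}ᶜ : Set ℂ) := by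
    intro x hx
    have h0 : (f x : ℂ) + (g x : ℂ) * Complex.I = 0 := hx
    have h1 := congrArg Complex.re h0
    have h2 := congrArg Complex.im h0
    simp at h1 h2
    exact hne x h1 h2
  obtain ⟨L, ⟨-, hL⟩, -⟩ := Complex.isCoveringMapOn_exp.existsUnique_continuousMap_lifts F
    (a₀ := (0, 0)) (e₀ := Complex.log (F (0, 0))) (Complex.exp_log (hF _)) hF
  refine ⟨fun x => (L x).im, by fun_prop, fun x => ⟨Real.exp (L x).re, Real.exp_pos _, ?_⟩⟩
  have h0 : Complex.exp (L x) = (f x : ℂ) + (g x : ℂ) * Complex.I := congrFun hL x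
  have h1 := congrArg Complex.re h0
  have h2 := congrArg Complex.im h0
  simp [Complex.exp_re, Complex.exp_im] at h1 h2
  exact ⟨h1.symm, h2.symm⟩

theorem angle_mem_of_cos_nonpos {X : Type*} [TopologicalSpace X] {S : Set X}
    (hS : IsPreconnected S) {θ : X → ℝ} (hθ : ContinuousOn θ S)
    (hcos : ∀ x ∈ S, Real.cos (θ x) ≤ 0) {x y : X} (hx : x ∈ S) (hy : y ∈ S)
    (hxm : θ x ∈ Icc (Real.pi / 2) (3 * Real.pi / 2)) :
    θ y ∈ Icc (Real.pi / 2) (3 * Real.pi / 2) := by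
  have hpi := Real.pi_pos
  have key : ∀ v ∈ uIcc (θ x) (θ y), Real.cos v ≤ 0 := by
    intro v hv
    obtain ⟨z, hz, rfl⟩ := (hS.image θ hθ).ordConnected.uIcc_subset
      (mem_image_of_mem θ hx) (mem_image_of_mem θ hy) hv
    exact hcos z hz
  obtain ⟨h1, h2⟩ := hxm
  refine ⟨?_, ?_⟩
  · by_contra! hlt
    have := key (max (θ y) 0) (by
      rw [uIcc_of_ge (by linarith)]
      exact ⟨le_max_left _ _, max_le (by linarith) (by linarith)⟩)
    have h3 : 0 < Real.cos (max (θ y) 0) := Real.cos_pos_of_mem_Ioo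
      ⟨lt_of_lt_of_le (by linarith) (le_max_right _ _), max_lt hlt (by linarith)⟩
    linarith
  · by_contra! hlt
    have := key (min (θ y) (2 * Real.pi)) (by
      rw [uIcc_of_le (by linarith)]
      exact ⟨le_min (by linarith) (by linarith), min_le_left _ _⟩)
    have h3 : 0 < Real.cos (min (θ y) (2 * Real.pi) - 2 * Real.pi) := Real.cos_pos_of_mem_Ioo
      ⟨by have : 3 * Real.pi / 2 < min (θ y) (2 * Real.pi) := lt_min hlt (by linarith)
          linarith, by have := min_le_right (θ y) (2 * Real.pi); linarith⟩
    rw [Real.cos_sub_two_pi] at h3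
    linarith

theorem angle_mem_of_cos_nonneg {X : Type*} [TopologicalSpace X] {S : Set X}
    (hS : IsPreconnected S) {θ : X → ℝ} (hθ : ContinuousOn θ S)
    (hcos : ∀ x ∈ S, 0 ≤ Real.cos (θ x)) {x y : X} (hx : x ∈ S) (hy : y ∈ S)
    (hxm : θ x ∈ Icc (-(Real.pi / 2)) (Real.pi / 2)) :
    θ y ∈ Icc (-(Real.pi / 2)) (Real.pi / 2) := by
  have h := angle_mem_of_cos_nonpos hS (θ := fun x => θ x + Real.pi) (by fun_prop)
    (fun x hx => by rw [Real.cos_add_pi]; linarith [hcos x hx]) hx hy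
    ⟨by linarith [hxm.1], by linarith [hxm.2]⟩
  exact ⟨by linarith [h.1], by linarith [h.2]⟩

/-- A curve `(a, ρ)` in the strip cover of the punctured plane that is disjoint from its half-turn
translate keeps the order of its heights at successive last crossings. -/
theorem height_lt_of_last_crossings {a ρ : ℝ → ℝ} {s₀ s₁ s₂ : ℝ} (h01 : s₀ ≤ s₁) (h12 : s₁ ≤ s₂)
    (ha : ContinuousOn a (Ici s₀)) (hρ : ContinuousOn ρ (Ici s₀))
    (ha1 : a s₁ = a s₀ - Real.pi) (ha2 : a s₂ = a s₁ - Real.pi)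
    (hlast0 : ∀ s, s₀ ≤ s → a s ≤ a s₀) (hlast1 : ∀ s, s₁ ≤ s → a s ≤ a s₁)
    (hlast2 : ∀ s, s₂ ≤ s → a s ≤ a s₂) (hbot : Tendsto a atTop atBot)
    (hdisj : ∀ s t, s₀ ≤ s → s₀ ≤ t → a t = a s - Real.pi → ρ t ≠ ρ s)
    (hlt : ρ s₀ < ρ s₁) : ρ s₁ < ρ s₂ := by
  have hpi := Real.pi_pos
  have hmax : Continuous fun s : ℝ => max s₀ s := by fun_prop
  have hac : Continuous fun s => a (max s₀ s) :=
    ha.comp_continuous hmax fun s => mem_Ici.2 (le_max_left s₀ s)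
  have hρc : Continuous fun s => ρ (max s₀ s) :=
    hρ.comp_continuous hmax fun s => mem_Ici.2 (le_max_left s₀ s)
  obtain ⟨θ, hθ, hpol⟩ := exists_continuous_angle
    (fun x => a (max s₀ x.2) - a (max s₀ x.1) + Real.pi)
    (fun x => ρ (max s₀ x.2) - ρ (max s₀ x.1))
    (((hac.comp continuous_snd).sub (hac.comp continuous_fst)).add continuous_const)
    ((hρc.comp continuous_snd).sub (hρc.comp continuous_fst))
    (fun x hx h0 => hdisj (max s₀ x.1) (max s₀ x.2) (le_max_left _ _) (le_max_left _ _)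
      (by linarith) (by linarith))
  have hpol' : ∀ s t, s₀ ≤ s → s₀ ≤ t → ∃ r, 0 < r ∧ a t - a s + Real.pi = r * Real.cos (θ (s, t)) ∧
      ρ t - ρ s = r * Real.sin (θ (s, t)) := by
    intro s t hs ht
    simpa [max_eq_right hs, max_eq_right ht] using hpol (s, t)
  have hcosneg : ∀ s t, s₀ ≤ s → s₀ ≤ t → a t ≤ a s - Real.pi → Real.cos (θ (s, t)) ≤ 0 := by
    intro s t hs ht hst
    obtain ⟨r, hr, h1, -⟩ := hpol' s t hs ht
    by_contra! hc
    nlinarith [mul_pos hr hc]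
  have hcospos : ∀ s t, s₀ ≤ s → s₀ ≤ t → a s - Real.pi ≤ a t → 0 ≤ Real.cos (θ (s, t)) := by
    intro s t hs ht hst
    obtain ⟨r, hr, h1, -⟩ := hpol' s t hs ht
    by_contra! hc
    nlinarith [mul_pos hr (neg_pos.2 hc)]
  obtain ⟨n, hn⟩ : ∃ n : ℤ, θ (s₀, s₁) = Real.pi / 2 + n * (2 * Real.pi) := by
    obtain ⟨r, hr, h1, h2⟩ := hpol' s₀ s₁ le_rfl h01
    have hc : Real.cos (θ (s₀, s₁)) = 0 := by
      have : r * Real.cos (θ (s₀, s₁)) = 0 := by linarith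
      exact (mul_eq_zero.1 this).resolve_left hr.ne'
    have hsn : 0 < Real.sin (θ (s₀, s₁)) := by
      by_contra! h
      nlinarith [mul_nonneg hr.le (neg_nonneg.2 h)]
    have hs1 : Real.sin (θ (s₀, s₁)) = 1 := by
      nlinarith [Real.sin_sq_add_cos_sq (θ (s₀, s₁))]
    obtain ⟨n, hn⟩ := Real.sin_eq_one_iff.1 hs1
    exact ⟨n, by linarith⟩
  set φ : ℝ × ℝ → ℝ := fun x => θ x - n * (2 * Real.pi) with hφdef
  have hφ : Continuous φ := by fun_prop
  have hφcos : ∀ x, Real.cos (φ x) = Real.cos (θ x) := fun x => Real.cos_sub_int_mul_two_pi _ _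
  have hφsin : ∀ x, Real.sin (φ x) = Real.sin (θ x) := fun x => Real.sin_sub_int_mul_two_pi _ _
  have hstart : φ (s₀, s₁) = Real.pi / 2 := by simp [hφdef, hn]
  have hsplit : ∀ {a b c d : ℝ}, IsPreconnected (Icc a b ×ˢ Icc c d) :=
    isPreconnected_Icc.prod isPreconnected_Icc
  have hleft : φ (s₁, s₂) ∈ Icc (Real.pi / 2) (3 * Real.pi / 2) := by
    obtain ⟨m, hm⟩ : ∃ m, ∀ s ∈ Icc s₀ s₁, m ≤ a s := by
      obtain ⟨x, hx, hmin⟩ := isCompact_Icc.exists_isMinOn (nonempty_Icc.2 h01)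
        (ha.mono Icc_subset_Ici_self)
      exact ⟨a x, fun s hs => hmin hs⟩
    obtain ⟨τ, hτ, hτ2⟩ := ((hbot.eventually_le_atBot (m - Real.pi)).and
      (eventually_ge_atTop s₂)).exists
    have h1 : φ (s₀, τ) ∈ Icc (Real.pi / 2) (3 * Real.pi / 2) := by
      refine angle_mem_of_cos_nonpos (hsplit (a := s₀) (b := s₀) (c := s₁) (d := τ))
        hφ.continuousOn ?_ (x := (s₀, s₁)) ?_ ?_ ?_
      · rintro ⟨s, t⟩ ⟨hs, ht⟩
        simp at hs ht
        subst hs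
        rw [hφcos]
        exact hcosneg _ _ le_rfl (by linarith) (by linarith [hlast1 t ht.1])
      · simp; linarith
      · simp; linarith
      · rw [hstart]; constructor <;> linarith
    have h2 : φ (s₁, τ) ∈ Icc (Real.pi / 2) (3 * Real.pi / 2) := by
      refine angle_mem_of_cos_nonpos (hsplit (a := s₀) (b := s₁) (c := τ) (d := τ))
        hφ.continuousOn ?_ (x := (s₀, τ)) ?_ ?_ h1
      · rintro ⟨s, t⟩ ⟨hs, ht⟩
        simp at hs ht
        subst ht
        rw [hφcos]
        exact hcosneg _ _ hs.1 (by linarith) (by linarith [hm s hs])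
      · simp; linarith
      · simp; linarith
    refine angle_mem_of_cos_nonpos (hsplit (a := s₁) (b := s₁) (c := s₂) (d := τ))
      hφ.continuousOn ?_ (x := (s₁, τ)) ?_ ?_ h2
    · rintro ⟨s, t⟩ ⟨hs, ht⟩
      simp at hs ht
      subst hs
      rw [hφcos]
      exact hcosneg _ _ h01 (by linarith) (by linarith [hlast2 t ht.1])
    · simp; linarith
    · simp; linarith
  have hright : φ (s₁, s₂) ∈ Icc (-(Real.pi / 2)) (Real.pi / 2) := by
    obtain ⟨m, hm⟩ : ∃ m, ∀ s ∈ Icc s₁ s₂, m ≤ a s := by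
      obtain ⟨x, hx, hmin⟩ := isCompact_Icc.exists_isMinOn (nonempty_Icc.2 h12)
        (ha.mono fun x hx => h01.trans hx.1)
      exact ⟨a x, fun s hs => hmin hs⟩
    obtain ⟨σ, hσ, hσ2⟩ := ((hbot.eventually_le_atBot (m + Real.pi)).and
      (eventually_ge_atTop s₂)).exists
    have h1 : φ (σ, s₁) ∈ Icc (-(Real.pi / 2)) (Real.pi / 2) := by
      refine angle_mem_of_cos_nonneg (hsplit (a := s₀) (b := σ) (c := s₁) (d := s₁))
        hφ.continuousOn ?_ (x := (s₀, s₁)) ?_ ?_ ?_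
      · rintro ⟨s, t⟩ ⟨hs, ht⟩
        simp at hs ht
        subst ht
        rw [hφcos]
        exact hcospos _ _ hs.1 (by linarith) (by linarith [hlast0 s hs.1])
      · simp; linarith
      · simp; linarith
      · rw [hstart]; constructor <;> linarith
    have h2 : φ (σ, s₂) ∈ Icc (-(Real.pi / 2)) (Real.pi / 2) := by
      refine angle_mem_of_cos_nonneg (hsplit (a := σ) (b := σ) (c := s₁) (d := s₂))
        hφ.continuousOn ?_ (x := (σ, s₁)) ?_ ?_ h1
      · rintro ⟨s, t⟩ ⟨hs, ht⟩
        simp at hs ht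
        subst hs
        rw [hφcos]
        exact hcospos _ _ (by linarith) (by linarith) (by linarith [hm t ht])
      · simp; linarith
      · simp; linarith
    refine angle_mem_of_cos_nonneg (hsplit (a := s₁) (b := σ) (c := s₂) (d := s₂))
      hφ.continuousOn ?_ (x := (σ, s₂)) ?_ ?_ h2
    · rintro ⟨s, t⟩ ⟨hs, ht⟩
      simp at hs ht
      subst ht
      rw [hφcos]
      exact hcospos _ _ (by linarith) (by linarith) (by linarith [hlast1 s hs.1])
    · simp; linarith
    · simp; linarith
  have hend : φ (s₁, s₂) = Real.pi / 2 := le_antisymm hright.2 hleft.1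
  obtain ⟨r, hr, -, h2⟩ := hpol' s₁ s₂ h01 (h01.trans h12)
  rw [← hφsin, hend, Real.sin_pi_div_two] at h2
  linarith

theorem monotoneOn_Icc_of_hasDerivAt_nonneg {f f' : ℝ → ℝ} {a b : ℝ}
    (hf : ContinuousOn f (Icc a b)) (hf' : ∀ t ∈ Ioo a b, HasDerivAt f (f' t) t)
    (hnn : ∀ t ∈ Ioo a b, 0 ≤ f' t) : MonotoneOn f (Icc a b) := by
  refine monotoneOn_of_hasDerivWithinAt_nonneg (f' := f') (convex_Icc a b) hf ?_ ?_
  · rw [interior_Icc]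
    exact fun t ht => (hf' t ht).hasDerivWithinAt
  · rwa [interior_Icc]

theorem antitoneOn_Icc_of_hasDerivAt_nonpos {f f' : ℝ → ℝ} {a b : ℝ}
    (hf : ContinuousOn f (Icc a b)) (hf' : ∀ t ∈ Ioo a b, HasDerivAt f (f' t) t)
    (hnp : ∀ t ∈ Ioo a b, f' t ≤ 0) : AntitoneOn f (Icc a b) := by
  have h := monotoneOn_Icc_of_hasDerivAt_nonneg hf.neg (fun t ht => (hf' t ht).neg)
    (fun t ht => neg_nonneg.2 (hnp t ht))
  exact fun x hx y hy hxy => neg_le_neg_iff.1 (h hx hy hxy)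

theorem hasDerivAt_abs_rpow_mul_self {q : ℝ} (hq : 1 < q) (x : ℝ) :
    HasDerivAt (fun x : ℝ => |x| ^ (q - 1) * x) (q * |x| ^ (q - 1)) x := by
  rcases lt_trichotomy x 0 with hx | rfl | hx
  · have h1 := ((hasDerivAt_id x).neg.rpow_const (p := q - 1)
      (Or.inl (by simpa using hx.ne))).mul (hasDerivAt_id x)
    have h2 : (fun x : ℝ => |x| ^ (q - 1) * x) =ᶠ[nhds x]
        ((fun y : ℝ => (-id) y ^ (q - 1)) * id) := by
      filter_upwards [gt_mem_nhds hx] with y hy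
      simp [abs_of_neg hy]
    refine (h1.congr_of_eventuallyEq h2).congr_deriv ?_
    have hx' : 0 < -x := neg_pos.2 hx
    have hx0 : x ≠ 0 := hx.ne
    simp only [Pi.neg_apply, id, abs_of_neg hx]
    rw [Real.rpow_sub_one hx'.ne' (q - 1)]
    field_simp
    ring
  · rw [hasDerivAt_iff_tendsto_slope]
    have h1 : Tendsto (fun x : ℝ => |x| ^ (q - 1)) (nhdsWithin 0 {0}ᶜ) (nhds (|0| ^ (q - 1))) :=
      ((continuous_abs.rpow_const fun _ => Or.inr (by linarith)).tendsto 0).mono_left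
        nhdsWithin_le_nhds
    rw [abs_zero, Real.zero_rpow (by linarith)] at h1
    rw [abs_zero, Real.zero_rpow (by linarith), mul_zero]
    refine h1.congr' ?_
    filter_upwards [self_mem_nhdsWithin] with y hy
    have hy : y ≠ 0 := hy
    simp [slope_def_field, hy]
  · have h1 := ((hasDerivAt_id x).rpow_const (p := q - 1)
      (Or.inl (by simpa using hx.ne'))).mul (hasDerivAt_id x)
    have h2 : (fun x : ℝ => |x| ^ (q - 1) * x) =ᶠ[nhds x]
        ((fun y : ℝ => id y ^ (q - 1)) * id) := by
      filter_upwards [lt_mem_nhds hx] with y hy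
      simp [abs_of_pos hy]
    refine (h1.congr_of_eventuallyEq h2).congr_deriv ?_
    simp only [id, abs_of_pos hx]
    rw [Real.rpow_sub_one hx.ne' (q - 1)]
    field_simp
    ring

theorem exists_lipschitz_abs_rpow_mul_self {q : ℝ} (hq : 1 < q) {M : ℝ} (hM : 0 ≤ M) :
    ∃ L, 0 ≤ L ∧ ∀ x y : ℝ, |x| ≤ M → |y| ≤ M →
      |(|x| ^ (q - 1) * x - |y| ^ (q - 1) * y)| ≤ L * |x - y| := by
  refine ⟨q * M ^ (q - 1), by positivity, fun x y hx hy => ?_⟩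
  refine (convex_Icc (-M) M).norm_image_sub_le_of_norm_hasDerivWithin_le
    (fun z _ => (hasDerivAt_abs_rpow_mul_self hq z).hasDerivWithinAt) (fun z hz => ?_)
    (abs_le.1 hy) (abs_le.1 hx)
  rw [Real.norm_eq_abs, abs_of_nonneg (by positivity)]
  have : |z| ≤ M := abs_le.2 hz
  gcongr

theorem abs_rpow_sub_one_mul_sq {q : ℝ} (hq : 1 < q) (x : ℝ) :
    |x| ^ (q - 1) * x ^ 2 = |x| ^ (q + 1) := by
  rw [show q + 1 = (q - 1) + (2 : ℕ) by push_cast; ring,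
    Real.rpow_add_natCast' (abs_nonneg x) (by push_cast; linarith), sq_abs]

theorem exists_mul_sq_le_abs_rpow {q : ℝ} (hq : 1 < q) {c C : ℝ} (hc : 0 < c) (hC : 0 ≤ C) :
    ∃ K, 0 ≤ K ∧ ∀ x : ℝ, C * x ^ 2 ≤ c * |x| ^ (q + 1) + K := by
  set R := (C / c) ^ (1 / (q - 1)) with hR
  have hR0 : 0 ≤ R := by positivity
  refine ⟨C * R ^ 2, by positivity, fun x => ?_⟩
  rcases le_total R |x| with hx | hx
  · have h1 : C / c ≤ |x| ^ (q - 1) := by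
      calc C / c = R ^ (q - 1) := by
            rw [hR, ← Real.rpow_mul (by positivity), one_div_mul_cancel (by linarith),
              Real.rpow_one]
        _ ≤ |x| ^ (q - 1) := Real.rpow_le_rpow hR0 hx (by linarith)
    rw [div_le_iff₀ hc] at h1
    rw [← abs_rpow_sub_one_mul_sq hq]
    have := mul_le_mul_of_nonneg_right h1 (sq_nonneg x)
    have : 0 ≤ C * R ^ 2 := by positivity
    linarith
  · have h1 : x ^ 2 ≤ R ^ 2 := by
      rw [← sq_abs]
      gcongr
    have h2 : 0 ≤ c * |x| ^ (q + 1) := by positivity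
    nlinarith

/-- `(u, v)` solves `u' = v`, `v' = -h v - λ (|u|^{q-1} u - u)` on `(0, T)`, continuously up to
the end points. -/
structure PhaseSol (h : ℝ → ℝ) (lam q T : ℝ) (u v : ℝ → ℝ) : Prop where
  contU : ContinuousOn u (Icc 0 T)
  contV : ContinuousOn v (Icc 0 T)
  derivU : ∀ t ∈ Ioo 0 T, HasDerivAt u (v t) t
  derivV : ∀ t ∈ Ioo 0 T,
    HasDerivAt v (-(h t * v t) - lam * (|u t| ^ (q - 1) * u t - u t)) t

theorem SolOn.phaseSol {h : ℝ → ℝ} {lam q T : ℝ} {u u' u'' : ℝ → ℝ}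
    (hs : SolOn h lam q (Icc 0 T) (Ioc 0 T) u u' u'') : PhaseSol h lam q T u u' := by
  obtain ⟨h1, h2, h3, -, h5⟩ := hs
  refine ⟨fun t ht => (h1 t ht).continuousWithinAt, h2, fun t ht => ?_, fun t ht => ?_⟩
  · exact (h1 t (Ioo_subset_Icc_self ht)).hasDerivAt (Icc_mem_nhds ht.1 ht.2)
  · have h6 := (h3 t (Ioo_subset_Ioc_self ht)).hasDerivAt (Ioc_mem_nhds ht.1 ht.2)
    have h7 := h5 t (Ioo_subset_Ioc_self ht)
    exact h6.congr_deriv (by linarith)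

/-- The mechanical energy of a point of the phase plane. -/
noncomputable def phaseEnergy (lam q x y : ℝ) : ℝ :=
  y ^ 2 / 2 + lam * (|x| ^ (q + 1) / (q + 1) - x ^ 2 / 2)

theorem continuous_phaseEnergy {lam q : ℝ} (hq : 1 < q) :
    Continuous fun p : ℝ × ℝ => phaseEnergy lam q p.1 p.2 := by
  unfold phaseEnergy
  have : Continuous fun p : ℝ × ℝ => |p.1| ^ (q + 1) :=
    (continuous_abs.comp continuous_fst).rpow_const fun _ => Or.inr (by linarith)
  fun_prop

namespace PhaseSol

variable {h : ℝ → ℝ} {lam q T : ℝ} {u v u₁ v₁ u₂ v₂ : ℝ → ℝ}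

theorem mono (hs : PhaseSol h lam q T u v) {S : ℝ} (hST : S ≤ T) : PhaseSol h lam q S u v :=
  ⟨hs.contU.mono (Icc_subset_Icc_right hST), hs.contV.mono (Icc_subset_Icc_right hST),
    fun t ht => hs.derivU t ⟨ht.1, ht.2.trans_le hST⟩,
    fun t ht => hs.derivV t ⟨ht.1, ht.2.trans_le hST⟩⟩

theorem neg (hs : PhaseSol h lam q T u v) :
    PhaseSol h lam q T (fun t => -u t) (fun t => -v t) := by
  refine ⟨hs.contU.neg, hs.contV.neg, fun t ht => (hs.derivU t ht).neg, fun t ht => ?_⟩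
  refine (hs.derivV t ht).neg.congr_deriv ?_
  rw [abs_neg]
  ring

theorem zero : PhaseSol h lam q T (fun _ => 0) (fun _ => 0) :=
  ⟨continuousOn_const, continuousOn_const, fun t _ => hasDerivAt_const t 0,
    fun t _ => (hasDerivAt_const t 0).congr_deriv (by simp)⟩

theorem one : PhaseSol h lam q T (fun _ => 1) (fun _ => 0) :=
  ⟨continuousOn_const, continuousOn_const, fun t _ => hasDerivAt_const t 1,
    fun t _ => (hasDerivAt_const t 0).congr_deriv (by simp)⟩

theorem hasDerivAt_phaseEnergy (hq : 1 < q) (hs : PhaseSol h lam q T u v) {t : ℝ}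
    (ht : t ∈ Ioo 0 T) :
    HasDerivAt (fun t => phaseEnergy lam q (u t) (v t)) (-(h t * v t ^ 2)) t := by
  have hu := hs.derivU t ht
  have hv := hs.derivV t ht
  have h1 : HasDerivAt (fun t => |u t| ^ (q + 1)) ((q + 1) * |u t| ^ (q + 1 - 2) * u t * v t) t :=
    (hasDerivAt_abs_rpow (u t) (by linarith)).comp t hu
  refine (((hv.pow 2).div_const 2).add
    (((h1.div_const (q + 1)).sub ((hu.pow 2).div_const 2)).const_mul lam)).congr_deriv ?_
  have : q + 1 ≠ 0 := by linarith
  rw [show q + 1 - 2 = q - 1 by ring]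
  field_simp
  push_cast
  ring

theorem continuousOn_phaseEnergy (hq : 1 < q) (hs : PhaseSol h lam q T u v) :
    ContinuousOn (fun t => phaseEnergy lam q (u t) (v t)) (Icc 0 T) :=
  (continuous_phaseEnergy hq).comp_continuousOn (hs.contU.prodMk hs.contV)

theorem antitoneOn_phaseEnergy (hq : 1 < q) (hs : PhaseSol h lam q T u v)
    (hh : ∀ t ∈ Ioo 0 T, 0 < h t) :
    AntitoneOn (fun t => phaseEnergy lam q (u t) (v t)) (Icc 0 T) :=
  antitoneOn_Icc_of_hasDerivAt_nonpos (hs.continuousOn_phaseEnergy hq)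
    (fun _ ht => hs.hasDerivAt_phaseEnergy hq ht)
    (fun t ht => neg_nonpos.2 (mul_nonneg (hh t ht).le (sq_nonneg _)))

/-- Solutions issuing from a bounded set of initial heights are uniformly bounded. -/
theorem exists_abs_le (hq : 1 < q) (hlam : 0 < lam) (hh : ∀ t ∈ Ioo 0 T, 0 < h t) (A : ℝ) :
    ∃ M, 0 ≤ M ∧ ∀ u v, PhaseSol h lam q T u v → |u 0| ≤ A → v 0 = 0 →
      ∀ t ∈ Icc 0 T, |u t| ≤ M := by
  obtain ⟨K, hK, hcoer⟩ := exists_mul_sq_le_abs_rpow hq (c := lam / (q + 1)) (C := lam / 2 + 1)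
    (by positivity) (by positivity)
  refine ⟨lam * |A| ^ (q + 1) / (q + 1) + K + 1, by positivity, fun u v hs hu0 hv0 t ht => ?_⟩
  have h1 := hs.antitoneOn_phaseEnergy hq hh (left_mem_Icc.2 (ht.1.trans ht.2)) ht ht.1
  simp only [phaseEnergy, hv0] at h1
  have h2 : |u 0| ^ (q + 1) ≤ |A| ^ (q + 1) :=
    Real.rpow_le_rpow (abs_nonneg _) (hu0.trans (le_abs_self A)) (by linarith)
  have h3 : lam * (|u 0| ^ (q + 1) / (q + 1)) ≤ lam * (|A| ^ (q + 1) / (q + 1)) := by gcongr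
  have h4 := hcoer (u t)
  have h5 : u t ^ 2 ≤ lam * |A| ^ (q + 1) / (q + 1) + K := by
    have e1 : lam / (q + 1) * |u t| ^ (q + 1) = lam * (|u t| ^ (q + 1) / (q + 1)) := by ring
    have e2 : lam * |A| ^ (q + 1) / (q + 1) = lam * (|A| ^ (q + 1) / (q + 1)) := by ring
    rw [e1] at h4
    rw [e2]
    nlinarith [sq_nonneg (v t), mul_nonneg hlam.le (sq_nonneg (u 0))]
  rw [← sq_abs] at h5
  nlinarith [sq_nonneg (|u t| - 1), abs_nonneg (u t)]

theorem hasDerivAt_dist_sq (hs₁ : PhaseSol h lam q T u₁ v₁) (hs₂ : PhaseSol h lam q T u₂ v₂)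
    {t : ℝ} (ht : t ∈ Ioo 0 T) :
    HasDerivAt (fun t => (u₁ t - u₂ t) ^ 2 + (v₁ t - v₂ t) ^ 2)
      (2 * (u₁ t - u₂ t) * (v₁ t - v₂ t) + 2 * (v₁ t - v₂ t) * (-(h t * (v₁ t - v₂ t)) -
        lam * ((|u₁ t| ^ (q - 1) * u₁ t - |u₂ t| ^ (q - 1) * u₂ t) - (u₁ t - u₂ t)))) t := by
  refine ((((hs₁.derivU t ht).sub (hs₂.derivU t ht)).pow 2).add
    (((hs₁.derivV t ht).sub (hs₂.derivV t ht)).pow 2)).congr_deriv ?_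
  simp only [Pi.sub_apply]
  push_cast
  ring

theorem continuousOn_dist_sq (hs₁ : PhaseSol h lam q T u₁ v₁) (hs₂ : PhaseSol h lam q T u₂ v₂) :
    ContinuousOn (fun t => (u₁ t - u₂ t) ^ 2 + (v₁ t - v₂ t) ^ 2) (Icc 0 T) :=
  ((hs₁.contU.sub hs₂.contU).pow 2).add ((hs₁.contV.sub hs₂.contV).pow 2)

theorem cross_term_bound {lam L w z F : ℝ} (hlam : 0 < lam) (hL : 0 ≤ L) (hF : |F| ≤ L * |w|) :
    |2 * w * z - 2 * z * (lam * (F - w))| ≤ (1 + lam * (L + 1)) * (w ^ 2 + z ^ 2) := by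
  have h1 : |w - lam * (F - w)| ≤ (1 + lam * (L + 1)) * |w| := by
    calc |w - lam * (F - w)| ≤ |w| + |lam * (F - w)| := abs_sub _ _
      _ ≤ |w| + lam * (|F| + |w|) := by
        rw [abs_mul, abs_of_pos hlam]
        gcongr
        exact abs_sub _ _
      _ ≤ |w| + lam * (L * |w| + |w|) := by gcongr
      _ = _ := by ring
  have h3 : 2 * w * z - 2 * z * (lam * (F - w)) = 2 * z * (w - lam * (F - w)) := by ring
  rw [h3, abs_mul, abs_mul, abs_two]
  calc 2 * |z| * |w - lam * (F - w)| ≤ 2 * |z| * ((1 + lam * (L + 1)) * |w|) := by gcongr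
    _ = (1 + lam * (L + 1)) * (2 * |w| * |z|) := by ring
    _ ≤ (1 + lam * (L + 1)) * (w ^ 2 + z ^ 2) := by
      gcongr
      rw [← sq_abs w, ← sq_abs z]
      nlinarith [sq_nonneg (|w| - |z|)]

/-- Continuous dependence on the initial height, up to the singular end point. -/
theorem exists_dist_sq_le (hq : 1 < q) (hlam : 0 < lam) (hh : ∀ t ∈ Ioo 0 T, 0 < h t) (A : ℝ) :
    ∃ K, ∀ u₁ v₁ u₂ v₂, PhaseSol h lam q T u₁ v₁ → PhaseSol h lam q T u₂ v₂ →
      |u₁ 0| ≤ A → |u₂ 0| ≤ A → v₁ 0 = 0 → v₂ 0 = 0 → ∀ t ∈ Icc 0 T,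
      (u₁ t - u₂ t) ^ 2 + (v₁ t - v₂ t) ^ 2 ≤ K * (u₁ 0 - u₂ 0) ^ 2 := by
  obtain ⟨M, hM, hbd⟩ := exists_abs_le hq hlam hh A
  obtain ⟨L, hL, hLip⟩ := exists_lipschitz_abs_rpow_mul_self hq hM
  set K := 1 + lam * (L + 1) with hK
  have hK0 : 0 ≤ K := by positivity
  refine ⟨Real.exp (K * T), fun u₁ v₁ u₂ v₂ hs₁ hs₂ h1 h2 h3 h4 t ht => ?_⟩
  have hanti : AntitoneOn (fun t => ((u₁ t - u₂ t) ^ 2 + (v₁ t - v₂ t) ^ 2) *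
      Real.exp (-(K * t))) (Icc 0 T) := by
    refine antitoneOn_Icc_of_hasDerivAt_nonpos
      ((continuousOn_dist_sq hs₁ hs₂).mul (by fun_prop))
      (fun s hs => (hasDerivAt_dist_sq hs₁ hs₂ hs).mul
        (((hasDerivAt_id s).const_mul K).neg.exp)) (fun s hs => ?_)
    have hs' := Ioo_subset_Icc_self hs
    have hb := le_of_abs_le (cross_term_bound (z := v₁ s - v₂ s) hlam hL
      (hLip _ _ (hbd u₁ v₁ hs₁ h1 h3 s hs') (hbd u₂ v₂ hs₂ h2 h4 s hs')))
    have hhs := mul_nonneg (hh s hs).le (sq_nonneg (v₁ s - v₂ s))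
    simp only [id, mul_one, Pi.neg_apply]
    have he := Real.exp_pos (-(K * s))
    rw [← hK] at hb
    have : ∀ X Y : ℝ, X ≤ K * Y → X * Real.exp (-(K * s)) + Y * (Real.exp (-(K * s)) * -K) ≤ 0 :=
      fun X Y hXY => by nlinarith
    exact this _ _ (by nlinarith)
  have hT : 0 ≤ T := ht.1.trans ht.2
  have h5 := hanti (left_mem_Icc.2 hT) ht ht.1
  simp only [h3, h4, mul_zero, neg_zero, Real.exp_zero, sub_self] at h5
  have h6 : Real.exp (K * t) ≤ Real.exp (K * T) :=
    Real.exp_le_exp.2 (mul_le_mul_of_nonneg_left ht.2 hK0)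
  calc (u₁ t - u₂ t) ^ 2 + (v₁ t - v₂ t) ^ 2
      = ((u₁ t - u₂ t) ^ 2 + (v₁ t - v₂ t) ^ 2) * Real.exp (-(K * t)) * Real.exp (K * t) := by
        rw [mul_assoc, ← Real.exp_add]; simp
    _ ≤ (u₁ 0 - u₂ 0) ^ 2 * Real.exp (K * T) := by
        gcongr
        simpa using h5
    _ = _ := mul_comm _ _

/-- Backward uniqueness. -/
theorem initial_eq_of_end_eq (hq : 1 < q) (hlam : 0 < lam) (hT : 0 < T)
    (hc : ContinuousOn h (Ioc 0 T)) (hs₁ : PhaseSol h lam q T u₁ v₁)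
    (hs₂ : PhaseSol h lam q T u₂ v₂) (hu : u₁ T = u₂ T) (hv : v₁ T = v₂ T) : u₁ 0 = u₂ 0 := by
  obtain ⟨M₁, hM₁⟩ := isCompact_Icc.exists_bound_of_continuousOn hs₁.contU
  obtain ⟨M₂, hM₂⟩ := isCompact_Icc.exists_bound_of_continuousOn hs₂.contU
  have hM0 : 0 ≤ max M₁ M₂ :=
    ((norm_nonneg _).trans (hM₁ 0 (left_mem_Icc.2 hT.le))).trans (le_max_left _ _)
  obtain ⟨L, hL, hLip⟩ := exists_lipschitz_abs_rpow_mul_self hq hM0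
  have hEq : ∀ ε ∈ Ioo 0 T, u₁ ε = u₂ ε := by
    intro ε hε
    obtain ⟨H, hH⟩ := isCompact_Icc.exists_bound_of_continuousOn
      (hc.mono (fun t ht => ⟨hε.1.trans_le ht.1, ht.2⟩ : Icc ε T ⊆ Ioc 0 T))
    have hH0 : 0 ≤ H := (norm_nonneg _).trans (hH ε (left_mem_Icc.2 hε.2.le))
    set K := 1 + lam * (L + 1) + 2 * H with hK
    have hmono : MonotoneOn (fun t => ((u₁ t - u₂ t) ^ 2 + (v₁ t - v₂ t) ^ 2) *
        Real.exp (K * t)) (Icc ε T) := by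
      refine monotoneOn_Icc_of_hasDerivAt_nonneg
        (((continuousOn_dist_sq hs₁ hs₂).mono (Icc_subset_Icc_left hε.1.le)).mul (by fun_prop))
        (fun s hs => (hasDerivAt_dist_sq hs₁ hs₂ ⟨hε.1.trans hs.1, hs.2⟩).mul
          (((hasDerivAt_id s).const_mul K).exp)) (fun s hs => ?_)
      have hs' : s ∈ Icc 0 T := ⟨(hε.1.trans hs.1).le, hs.2.le⟩
      have hb := neg_le_of_abs_le (cross_term_bound (z := v₁ s - v₂ s) hlam hL
        (hLip _ _ ((hM₁ s hs').trans (le_max_left _ _)) ((hM₂ s hs').trans (le_max_right _ _))))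
      have hhs := mul_le_mul_of_nonneg_right (le_of_abs_le (hH s (Ioo_subset_Icc_self hs)))
        (sq_nonneg (v₁ s - v₂ s))
      have hhu := mul_nonneg hH0 (sq_nonneg (u₁ s - u₂ s))
      simp only [id, mul_one]
      have he := Real.exp_pos (K * s)
      have : ∀ X Y : ℝ, -(K * Y) ≤ X → 0 ≤ X * Real.exp (K * s) + Y * (Real.exp (K * s) * K) :=
        fun X Y hXY => by nlinarith
      refine this _ _ ?_
      rw [hK]
      nlinarith
    have h1 := hmono (left_mem_Icc.2 hε.2.le) (right_mem_Icc.2 hε.2.le) hε.2.le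
    simp only [hu, hv, sub_self] at h1
    have h2 : (u₁ ε - u₂ ε) ^ 2 + (v₁ ε - v₂ ε) ^ 2 ≤ 0 := by
      refine nonpos_of_mul_nonpos_left ?_ (Real.exp_pos (K * ε))
      simpa using h1
    nlinarith [sq_nonneg (u₁ ε - u₂ ε), sq_nonneg (v₁ ε - v₂ ε)]
  have h0 : (0 : ℝ) ∈ Icc 0 T := left_mem_Icc.2 hT.le
  have := left_nhdsWithin_Ioo_neBot hT
  refine tendsto_nhds_unique_of_eventuallyEq
    ((hs₁.contU 0 h0).mono Ioo_subset_Icc_self) ((hs₂.contU 0 h0).mono Ioo_subset_Icc_self) ?_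
  filter_upwards [self_mem_nhdsWithin] with t ht using hEq t ht

theorem ne_zero_of_initial_ne_zero (hq : 1 < q) (hlam : 0 < lam) (hc : ContinuousOn h (Ioc 0 T))
    (hs : PhaseSol h lam q T u v) (h0 : u 0 ≠ 0) {t : ℝ} (ht : t ∈ Icc 0 T) (hu : u t = 0) :
    v t ≠ 0 := by
  intro hv
  rcases ht.1.eq_or_lt with rfl | htpos
  · exact h0 hu
  · exact h0 (initial_eq_of_end_eq hq hlam htpos (hc.mono (Ioc_subset_Ioc_right ht.2))
      (hs.mono ht.2) zero hu hv)

end PhaseSol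

theorem sq_div_two_le_abs_rpow {q : ℝ} (hq : 1 < q) (x : ℝ) :
    x ^ 2 / 2 ≤ |x| ^ (q + 1) / (q + 1) + 1 / 2 := by
  have h1 := one_add_mul_self_le_rpow_one_add (s := x ^ 2 - 1) (p := (q + 1) / 2)
    (by nlinarith [sq_nonneg x]) (by linarith)
  have h2 : (1 + (x ^ 2 - 1)) ^ ((q + 1) / 2) = |x| ^ (q + 1) := by
    rw [add_sub_cancel, ← sq_abs, ← Real.rpow_natCast_mul (abs_nonneg x)]
    congr 1
    push_cast
    ring
  rw [h2] at h1
  have hq1 : 0 < q + 1 := by linarith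
  rw [← sub_nonneg]
  have h3 : |x| ^ (q + 1) / (q + 1) + 1 / 2 - x ^ 2 / 2 =
      (|x| ^ (q + 1) - (1 + (q + 1) / 2 * (x ^ 2 - 1)) + 1) / (q + 1) := by
    field_simp
    ring
  rw [h3]
  exact div_nonneg (by linarith) hq1.le

/-- An integrating factor for `h`, with a power lower bound near the singularity. -/
theorem exists_integrating_factor {h : ℝ → ℝ} {T δ B : ℝ} (hδ : δ ∈ Ioo 0 T)
    (hh : ∀ t ∈ Ioo 0 T, 0 < h t) (hc : ContinuousOn h (Ioc 0 T))
    (hB : ∀ t ∈ Ioo 0 δ, t * h t ≤ B) :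
    ∃ p : ℝ → ℝ, (∀ t ∈ Ioc 0 δ, HasDerivAt p (h t * p t) t) ∧
      (∀ t ∈ Ioc 0 δ, 0 < p t ∧ p t ≤ 1) ∧ p δ = 1 ∧
      ∃ c₀, 0 < c₀ ∧ ∀ t ∈ Ioc 0 δ, c₀ * t ^ B ≤ p t := by
  set H : ℝ → ℝ := fun t => ∫ x in δ..t, h x with hH
  have hcIoo : ContinuousOn h (Ioo 0 T) := hc.mono Ioo_subset_Ioc_self
  have hder : ∀ t ∈ Ioc 0 δ, HasDerivAt H (h t) t := by
    intro t ht
    have htT : t ∈ Ioo 0 T := ⟨ht.1, ht.2.trans_lt hδ.2⟩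
    refine intervalIntegral.integral_hasDerivAt_right ?_ ?_
      (hcIoo.continuousAt (Ioo_mem_nhds htT.1 htT.2))
    · refine (hcIoo.mono ?_).intervalIntegrable
      exact ordConnected_Ioo.uIcc_subset hδ htT
    · exact hcIoo.stronglyMeasurableAtFilter isOpen_Ioo t htT
  have hHδ : H δ = 0 := by simp [hH]
  have hupper : ∀ t ∈ Ioc 0 δ, H t ≤ 0 := by
    intro t ht
    have hm : MonotoneOn H (Icc t δ) := monotoneOn_Icc_of_hasDerivAt_nonneg
      (fun s hs => (hder s ⟨ht.1.trans_le hs.1, hs.2⟩).continuousAt.continuousWithinAt)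
      (fun s hs => hder s ⟨ht.1.trans hs.1, hs.2.le⟩)
      (fun s hs => (hh s ⟨ht.1.trans hs.1, hs.2.trans hδ.2⟩).le)
    simpa [hHδ] using hm (left_mem_Icc.2 ht.2) (right_mem_Icc.2 ht.2) ht.2
  have hlower : ∀ t ∈ Ioc 0 δ, B * Real.log t - B * Real.log δ ≤ H t := by
    intro t ht
    have hd : ∀ s ∈ Icc t δ, HasDerivAt (fun s => H s - B * Real.log s) (h s - B * s⁻¹) s :=
      fun s hs => (hder s ⟨ht.1.trans_le hs.1, hs.2⟩).sub
        ((Real.hasDerivAt_log (ht.1.trans_le hs.1).ne').const_mul B)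
    have hm := antitoneOn_Icc_of_hasDerivAt_nonpos
      (fun s hs => (hd s hs).continuousAt.continuousWithinAt)
      (fun s hs => hd s (Ioo_subset_Icc_self hs)) (fun s hs => by
        have hs0 : 0 < s := ht.1.trans hs.1
        have := hB s ⟨hs0, hs.2⟩
        rw [sub_nonpos, ← div_eq_mul_inv, le_div_iff₀ hs0]
        linarith)
    have := hm (left_mem_Icc.2 ht.2) (right_mem_Icc.2 ht.2) ht.2
    simp only [hHδ] at this
    linarith
  refine ⟨fun t => Real.exp (H t), fun t ht => ?_, fun t ht => ⟨Real.exp_pos _, ?_⟩, ?_,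
    Real.exp (-(B * Real.log δ)), Real.exp_pos _, fun t ht => ?_⟩
  · exact (hder t ht).exp.congr_deriv (mul_comm _ _)
  · exact Real.exp_le_one_iff.2 (hupper t ht)
  · simp [hHδ]
  · rw [Real.rpow_def_of_pos ht.1, ← Real.exp_add]
    exact Real.exp_le_exp.2 (by linarith [hlower t ht])

namespace PhaseSol

variable {h : ℝ → ℝ} {lam q T : ℝ} {u v : ℝ → ℝ}

/-- A solution of large initial height `α` stays above `α / 2` on a time scale
`α ^ ((1 - q) / 2)`. -/
theorem half_le (hq : 1 < q) (hlam : 0 < lam) (hh : ∀ t ∈ Ioo 0 T, 0 < h t)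
    (hs : PhaseSol h lam q T u v) (hu0 : 1 ≤ u 0) (hv0 : v 0 = 0) {t : ℝ} (ht : t ∈ Icc 0 T)
    (htα : t ≤ (2 * √(2 * lam))⁻¹ * u 0 ^ ((1 - q) / 2)) : u 0 / 2 ≤ u t := by
  have hα : 0 < u 0 := by linarith
  set C := √(2 * lam) * u 0 ^ ((q + 1) / 2) with hC
  have hC0 : 0 ≤ C := by positivity
  have hC2 : C ^ 2 = 2 * lam * u 0 ^ (q + 1) := by
    rw [hC, mul_pow, Real.sq_sqrt (by positivity), ← Real.rpow_mul_natCast hα.le]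
    congr 2
    push_cast
    ring
  have hv : ∀ s ∈ Icc 0 T, -C ≤ v s := by
    intro s hs'
    refine neg_le_of_abs_le (abs_le_of_sq_le_sq ?_ hC0)
    have h1 := hs.antitoneOn_phaseEnergy hq hh (left_mem_Icc.2 (ht.1.trans ht.2)) hs' hs'.1
    simp only [phaseEnergy, hv0] at h1
    rw [abs_of_pos hα] at h1
    have h2 := mul_le_mul_of_nonneg_left (sq_div_two_le_abs_rpow hq (u s)) hlam.le
    have h3 : u 0 ^ (q + 1) / (q + 1) ≤ u 0 ^ (q + 1) :=
      div_le_self (by positivity) (by linarith)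
    have h4 := mul_le_mul_of_nonneg_left h3 hlam.le
    have h5 : lam * 1 ≤ lam * u 0 ^ 2 := by gcongr; nlinarith
    rw [hC2]
    nlinarith
  have hm : MonotoneOn (fun s => u s + C * s) (Icc 0 T) :=
    monotoneOn_Icc_of_hasDerivAt_nonneg (hs.contU.add (by fun_prop))
      (fun s hs' => (hs.derivU s hs').add ((hasDerivAt_id s).const_mul C))
      (fun s hs' => by linarith [hv s (Ioo_subset_Icc_self hs')])
  have h1 := hm (left_mem_Icc.2 (ht.1.trans ht.2)) ht ht.1
  simp only [mul_zero, add_zero] at h1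
  have h2 : C * t ≤ u 0 / 2 := by
    calc C * t ≤ C * ((2 * √(2 * lam))⁻¹ * u 0 ^ ((1 - q) / 2)) := by gcongr
      _ = (√(2 * lam) / √(2 * lam)) * (u 0 ^ ((q + 1) / 2) * u 0 ^ ((1 - q) / 2)) / 2 := by
        rw [hC, mul_inv]; ring
      _ = u 0 / 2 := by
        rw [div_self (by positivity), ← Real.rpow_add hα,
          show (q + 1) / 2 + (1 - q) / 2 = 1 by ring, Real.rpow_one, one_mul]
  linarith

/-- The Pohozaev-type quantity and its derivative. -/
theorem hasDerivAt_pohozaev (hq : 1 < q) (hs : PhaseSol h lam q T u v) {p : ℝ → ℝ} {c t : ℝ}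
    (ht : t ∈ Ioo 0 T) (hp : HasDerivAt p (h t * p t) t) :
    HasDerivAt (fun t => t * p t * phaseEnergy lam q (u t) (v t) + c * (p t * (u t * v t)))
      (p t * ((c - (t * h t - 1) / 2) * v t ^ 2 +
        lam * (((1 + t * h t) / (q + 1) - c) * |u t| ^ (q + 1) -
          ((1 + t * h t) / 2 - c) * u t ^ 2))) t := by
  refine ((((hasDerivAt_id t).mul hp).mul (hs.hasDerivAt_phaseEnergy hq ht)).add
    ((hp.mul ((hs.derivU t ht).mul (hs.derivV t ht))).const_mul c)).congr_deriv ?_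
  have hq1 : q + 1 ≠ 0 := by linarith
  rw [← abs_rpow_sub_one_mul_sq hq]
  simp only [phaseEnergy, id, Pi.mul_apply]
  rw [← abs_rpow_sub_one_mul_sq hq]
  field_simp
  ring

end PhaseSol

namespace PhaseSol

variable {h : ℝ → ℝ} {lam q T : ℝ}

theorem half_sum_sq_le_phaseEnergy (hq : 1 < q) (hlam : 0 < lam) :
    ∃ K, 0 ≤ K ∧ ∀ x y : ℝ, (x ^ 2 + y ^ 2) / 2 ≤ phaseEnergy lam q x y + K := by
  obtain ⟨K, hK, hcoer⟩ := exists_mul_sq_le_abs_rpow hq (c := lam / (q + 1))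
    (C := lam / 2 + 1 / 2) (by positivity) (by positivity)
  refine ⟨K, hK, fun x y => ?_⟩
  have h1 := hcoer x
  have e1 : lam / (q + 1) * |x| ^ (q + 1) = lam * (|x| ^ (q + 1) / (q + 1)) := by ring
  rw [e1] at h1
  unfold phaseEnergy
  linarith

/-- Subcriticality makes the energy at a fixed small time grow with a power of the initial
height. -/
theorem exists_energy_lower_bound (hq : 1 < q) (hlam : 0 < lam) (hT : 0 < T)
    (hh : ∀ t ∈ Ioo 0 T, 0 < h t) (hc : ContinuousOn h (Ioc 0 T)) {ν : ℝ} (hν : 1 ≤ ν)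
    (hlim : Tendsto (fun t => t * h t) (nhdsWithin 0 (Ioi 0)) (nhds ν))
    (hsub : (ν - 1) * q < ν + 3) :
    ∃ δ ∈ Ioo 0 T, ∃ c₁ : ℝ, 0 < c₁ ∧ ∃ μ : ℝ, 0 < μ ∧ ∃ C : ℝ, ∀ᶠ α : ℝ in atTop, ∀ u v,
      PhaseSol h lam q T u v → u 0 = α → v 0 = 0 →
      c₁ * α ^ μ - C ≤ phaseEnergy lam q (u δ) (v δ) := by
  have hq1 : 0 < q + 1 := by linarith
  obtain ⟨c, hc1, hc2⟩ : ∃ c, (ν - 1) / 2 < c ∧ c < (ν + 1) / (q + 1) := by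
    apply exists_between
    rw [div_lt_div_iff₀ two_pos hq1]
    linarith
  have hc0 : 0 < c := by linarith
  set η := ((ν + 1) / (q + 1) - c) / 2 with hη
  have hη0 : 0 < η := by rw [hη]; linarith
  obtain ⟨ε, hε0, hε1, hε2, hε3⟩ : ∃ ε, 0 < ε ∧ ε ≤ 2 * c - (ν - 1) ∧ ε ≤ η * (q + 1) ∧
      (ν + ε + 1) * (q - 1) < 2 * (q + 1) := by
    set σ := (2 * (q + 1) - (ν + 1) * (q - 1)) / (2 * (q - 1)) with hσ
    have hσ0 : 0 < σ := div_pos (by nlinarith) (by linarith)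
    refine ⟨min (2 * c - (ν - 1)) (min (η * (q + 1)) σ),
      lt_min (by linarith) (lt_min (by positivity) hσ0), min_le_left _ _,
      (min_le_right _ _).trans (min_le_left _ _), ?_⟩
    have h1 : min (2 * c - (ν - 1)) (min (η * (q + 1)) σ) ≤ σ :=
      (min_le_right _ _).trans (min_le_right _ _)
    have h2 : σ * (q - 1) = (2 * (q + 1) - (ν + 1) * (q - 1)) / 2 := by
      have : q - 1 ≠ 0 := by linarith
      rw [hσ]; field_simp
    have h3 := mul_le_mul_of_nonneg_right h1 (by linarith : 0 ≤ q - 1)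
    nlinarith
  obtain ⟨δ, hδ, hδlim⟩ : ∃ δ ∈ Ioo 0 T, ∀ t ∈ Ioo 0 δ, ν - ε < t * h t ∧ t * h t < ν + ε := by
    have h1 : ∀ᶠ t in nhdsWithin (0 : ℝ) (Ioi 0), ν - ε < t * h t ∧ t * h t < ν + ε :=
      hlim.eventually (Ioo_mem_nhds (by linarith) (by linarith))
    obtain ⟨δ', hδ'0, hδ'⟩ := mem_nhdsGT_iff_exists_Ioo_subset.1 h1
    have hδ'0 : 0 < δ' := hδ'0
    refine ⟨min δ' (T / 2), ⟨lt_min hδ'0 (by linarith), (min_le_right _ _).trans_lt (by linarith)⟩,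
      fun t ht => hδ' ⟨ht.1, ht.2.trans_le (min_le_left _ _)⟩⟩
  set B := ν + ε with hB
  have hB0 : 0 < B := by linarith
  obtain ⟨p, hpd, hp1, hpδ, c₀, hc₀, hplow⟩ := exists_integrating_factor hδ hh hc
    (fun t ht => (hδlim t ht).2.le)
  obtain ⟨K₁, hK₁, hcoer⟩ := exists_mul_sq_le_abs_rpow hq (c := η / 2) (C := 1 + B)
    (by positivity) (by positivity)
  obtain ⟨K₃, hK₃, hE⟩ := half_sum_sq_le_phaseEnergy hq hlam
  set κ := (2 * √(2 * lam))⁻¹ with hκ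
  have hκ0 : 0 < κ := by positivity
  set μ := q + 1 + (1 - q) / 2 * (B + 1) with hμ
  set g₀ := lam * (η / 2) * (1 / 2) ^ (q + 1) * c₀ with hg₀
  have hg₀0 : 0 < g₀ := by positivity
  refine ⟨δ, hδ, g₀ / (B + 1) * κ ^ (B + 1) / (δ + c), ?_, μ, ?_,
    (c * K₃ + lam * K₁ * δ) / (δ + c), ?_⟩
  · have := hδ.1
    positivity
  · rw [hμ]
    nlinarith
  have hsmall : ∀ᶠ α : ℝ in atTop, κ * α ^ ((1 - q) / 2) ≤ δ := by
    have h1 := (tendsto_rpow_neg_atTop (y := (q - 1) / 2) (by linarith)).const_mul κ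
    rw [mul_zero] at h1
    filter_upwards [h1.eventually_le_const hδ.1] with α hα
    rwa [show (1 - q) / 2 = -((q - 1) / 2) by ring]
  filter_upwards [hsmall, eventually_ge_atTop 1] with α hα hα1 u v hs hu0 hv0
  have hα0 : 0 < α := by linarith
  set E := fun t => phaseEnergy lam q (u t) (v t) with hEdef
  set t₁ := κ * α ^ ((1 - q) / 2) with ht₁
  have ht₁0 : 0 < t₁ := by positivity
  set g := g₀ * α ^ (q + 1) with hg
  have hg0 : 0 < g := by positivity
  set R := fun t => t * p t * E t + c * (p t * (u t * v t)) + lam * K₁ * t with hR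
  have hRd : ∀ t ∈ Ioo 0 δ, ∃ R', HasDerivAt R R' t ∧
      lam * (η / 2) * (p t * |u t| ^ (q + 1)) ≤ R' := by
    intro t ht
    refine ⟨_, (hs.hasDerivAt_pohozaev hq ⟨ht.1, ht.2.trans hδ.2⟩
      (hpd t (Ioo_subset_Ioc_self ht))).add ((hasDerivAt_id t).const_mul (lam * K₁)), ?_⟩
    obtain ⟨hp0, hple⟩ := hp1 t (Ioo_subset_Ioc_self ht)
    obtain ⟨hl, hr⟩ := hδlim t ht
    have h1 : 0 ≤ (c - (t * h t - 1) / 2) * v t ^ 2 :=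
      mul_nonneg (by linarith) (sq_nonneg _)
    have h2 : η ≤ (1 + t * h t) / (q + 1) - c := by
      have h3 : (ν + 1) / (q + 1) - η ≤ (1 + t * h t) / (q + 1) := by
        rw [le_div_iff₀ hq1, sub_mul, div_mul_cancel₀ _ hq1.ne']
        linarith
      linarith
    have h4 : η * |u t| ^ (q + 1) ≤ ((1 + t * h t) / (q + 1) - c) * |u t| ^ (q + 1) := by
      gcongr
    have h5 : ((1 + t * h t) / 2 - c) * u t ^ 2 ≤ (1 + B) * u t ^ 2 := by
      gcongr
      linarith
    have h6 := hcoer (u t)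
    have h7 : η / 2 * |u t| ^ (q + 1) - K₁ ≤ ((1 + t * h t) / (q + 1) - c) * |u t| ^ (q + 1) -
        ((1 + t * h t) / 2 - c) * u t ^ 2 := by linarith
    have h8 := mul_le_mul_of_nonneg_left h7 hlam.le
    have h9 := mul_le_mul_of_nonneg_left (add_le_add h1 h8) hp0.le
    have h10 : lam * K₁ * p t ≤ lam * K₁ * 1 := by gcongr
    linarith
  have hRc : ∀ t ∈ Ioc 0 δ, ContinuousWithinAt R (Ioc 0 δ) t := by
    have hsubset : Ioc 0 δ ⊆ Icc 0 T := fun t ht => ⟨ht.1.le, ht.2.trans hδ.2.le⟩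
    have hpc : ContinuousOn p (Ioc 0 δ) := fun t ht => (hpd t ht).continuousAt.continuousWithinAt
    have hEc : ContinuousOn E (Ioc 0 δ) := (hs.continuousOn_phaseEnergy hq).mono hsubset
    have huc := hs.contU.mono hsubset
    have hvc := hs.contV.mono hsubset
    have : ContinuousOn R (Ioc 0 δ) := by fun_prop
    exact this
  choose! R' hR' hR'le using hRd
  have hstep1 : g / (B + 1) * t₁ ^ (B + 1) ≤ R t₁ := by
    set L := fun s => -(s * |E s| + c * |u s * v s|) - g / (B + 1) * s ^ (B + 1) with hL
    have hlim0 : Tendsto L (nhdsWithin 0 (Ioo 0 t₁)) (nhds 0) := by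
      have hEc := hs.continuousOn_phaseEnergy hq
      have huc := hs.contU
      have hvc := hs.contV
      have hpow : ContinuousOn (fun s : ℝ => s ^ (B + 1)) (Icc 0 T) :=
        continuousOn_id.rpow_const fun _ _ => Or.inr (by positivity)
      have hLc : ContinuousOn L (Icc 0 T) := by fun_prop
      have h0 : L 0 = 0 := by
        simp [hL, hv0, Real.zero_rpow (by positivity : B + 1 ≠ 0)]
      have h1 := hLc 0 (left_mem_Icc.2 hT.le)
      rw [ContinuousWithinAt, h0] at h1
      exact h1.mono_left (nhdsWithin_mono _ fun s hs' =>
        ⟨hs'.1.le, (hs'.2.le.trans hα).trans hδ.2.le⟩)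
    have := left_nhdsWithin_Ioo_neBot ht₁0
    rw [← sub_nonneg]
    refine le_of_tendsto hlim0 ?_
    filter_upwards [self_mem_nhdsWithin] with s hs'
    have hmono : MonotoneOn (fun t => R t - g / (B + 1) * t ^ (B + 1)) (Icc s t₁) := by
      refine monotoneOn_Icc_of_hasDerivAt_nonneg (f' := fun t => R' t - g * t ^ B) ?_ ?_ ?_
      · have hR1 : ContinuousOn R (Icc s t₁) := fun t ht =>
          (hRc t ⟨hs'.1.trans_le ht.1, ht.2.trans hα⟩).mono
            fun r hr => ⟨hs'.1.trans_le hr.1, hr.2.trans hα⟩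
        have hpow : ContinuousOn (fun s : ℝ => s ^ (B + 1)) (Icc s t₁) :=
          continuousOn_id.rpow_const fun _ _ => Or.inr (by positivity)
        fun_prop
      · intro t ht
        have ht0 : 0 < t := hs'.1.trans ht.1
        refine ((hR' t ⟨ht0, ht.2.trans_le hα⟩).sub ((Real.hasDerivAt_rpow_const
          (p := B + 1) (Or.inl ht0.ne')).const_mul (g / (B + 1)))).congr_deriv ?_
        rw [add_sub_cancel_right]
        field_simp
      · intro t ht
        have ht0 : 0 < t := hs'.1.trans ht.1
        have htδ : t ∈ Ioo 0 δ := ⟨ht0, ht.2.trans_le hα⟩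
        have hut : u 0 / 2 ≤ u t := hs.half_le hq hlam hh (hu0 ▸ hα1) hv0
          ⟨ht0.le, htδ.2.le.trans hδ.2.le⟩ (hu0 ▸ ht.2.le)
        rw [hu0] at hut
        have h1 := hR'le t htδ
        have h2 : (1 / 2) ^ (q + 1) * α ^ (q + 1) ≤ |u t| ^ (q + 1) := by
          rw [← Real.mul_rpow (by norm_num) hα0.le]
          refine Real.rpow_le_rpow (by positivity) ?_ hq1.le
          exact le_trans (by linarith) (le_abs_self _)
        have h3 := hplow t (Ioo_subset_Ioc_self htδ)
        have h4 : c₀ * t ^ B * ((1 / 2) ^ (q + 1) * α ^ (q + 1)) ≤ p t * |u t| ^ (q + 1) := by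
          gcongr
          exact (hp1 t (Ioo_subset_Ioc_self htδ)).1.le
        have h5 := mul_le_mul_of_nonneg_left h4 (by positivity : 0 ≤ lam * (η / 2))
        rw [hg, hg₀]
        linarith
    have h1 := hmono (left_mem_Icc.2 hs'.2.le) (right_mem_Icc.2 hs'.2.le) hs'.2.le
    refine le_trans ?_ h1
    obtain ⟨hp0, hple⟩ := hp1 s ⟨hs'.1, hs'.2.le.trans hα⟩
    have h2 : -(s * |E s|) ≤ s * p s * E s := by
      have : |s * p s * E s| ≤ s * |E s| := by
        rw [abs_mul, abs_of_pos (mul_pos hs'.1 hp0)]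
        have := hs'.1
        gcongr
        exact mul_le_of_le_one_right this.le hple
      exact neg_le_of_abs_le this
    have h3 : -(c * |u s * v s|) ≤ c * (p s * (u s * v s)) := by
      have : |c * (p s * (u s * v s))| ≤ c * |u s * v s| := by
        rw [abs_mul, abs_of_pos hc0, abs_mul (p s), abs_of_pos hp0]
        gcongr
        exact mul_le_of_le_one_left (abs_nonneg _) hple
      exact neg_le_of_abs_le this
    have h4 : 0 ≤ lam * K₁ * s := by
      have := hs'.1
      positivity
    simp only [hL, hR]
    linarith
  have hstep2 : R t₁ ≤ R δ := by
    refine (monotoneOn_Icc_of_hasDerivAt_nonneg (f := R) (f' := R') (a := t₁) (b := δ)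
      (fun t ht => (hRc t ⟨ht₁0.trans_le ht.1, ht.2⟩).mono
        fun r hr => ⟨ht₁0.trans_le hr.1, hr.2⟩)
      (fun t ht => hR' t ⟨ht₁0.trans ht.1, ht.2⟩) (fun t ht => ?_))
      (left_mem_Icc.2 hα) (right_mem_Icc.2 hα) hα
    refine le_trans ?_ (hR'le t ⟨ht₁0.trans ht.1, ht.2⟩)
    have := (hp1 t ⟨ht₁0.trans ht.1, ht.2.le⟩).1
    positivity
  have hgt : g / (B + 1) * t₁ ^ (B + 1) = g₀ / (B + 1) * κ ^ (B + 1) * α ^ μ := by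
    rw [ht₁, Real.mul_rpow hκ0.le (by positivity), ← Real.rpow_mul hα0.le, hg, hμ,
      Real.rpow_add hα0 (q + 1)]
    ring
  rw [hgt] at hstep1
  have huv : c * (u δ * v δ) ≤ c * (E δ + K₃) := by
    gcongr
    refine le_trans ?_ (hE (u δ) (v δ))
    nlinarith [sq_nonneg (u δ - v δ)]
  have hfin : g₀ / (B + 1) * κ ^ (B + 1) * α ^ μ ≤ δ * E δ + c * (E δ + K₃) + lam * K₁ * δ := by
    refine (hstep1.trans hstep2).trans ?_
    simp only [hR, hpδ]
    linarith
  have hδc : 0 < δ + c := by linarith [hδ.1]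
  rw [div_mul_eq_mul_div, ← sub_div, div_le_iff₀ hδc]
  linarith

/-- The energy at the end of the interval tends to infinity with the initial height. -/
theorem eventually_le_phaseEnergy (hq : 1 < q) (hlam : 0 < lam) (hT : 0 < T)
    (hh : ∀ t ∈ Ioo 0 T, 0 < h t) (hc : ContinuousOn h (Ioc 0 T)) {ν : ℝ} (hν : 1 ≤ ν)
    (hlim : Tendsto (fun t => t * h t) (nhdsWithin 0 (Ioi 0)) (nhds ν))
    (hsub : (ν - 1) * q < ν + 3) (K : ℝ) :
    ∀ᶠ α in atTop, ∀ u v, PhaseSol h lam q T u v → u 0 = α → v 0 = 0 →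
      K ≤ phaseEnergy lam q (u T) (v T) := by
  obtain ⟨δ, hδ, c₁, hc₁, μ, hμ, C, hev⟩ :=
    exists_energy_lower_bound hq hlam hT hh hc hν hlim hsub
  obtain ⟨H, hH⟩ := isCompact_Icc.exists_bound_of_continuousOn
    (hc.mono (fun t ht => ⟨hδ.1.trans_le ht.1, ht.2⟩ : Icc δ T ⊆ Ioc 0 T))
  have htop : Tendsto (fun α : ℝ => (c₁ * α ^ μ - C + lam / 2) * Real.exp (2 * H * (δ - T)))
      atTop atTop :=
    (tendsto_atTop_add_const_right _ _ (tendsto_atTop_add_const_right _ _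
      ((tendsto_rpow_atTop hμ).const_mul_atTop hc₁))).atTop_mul_const (Real.exp_pos _)
  filter_upwards [hev, htop.eventually_ge_atTop (K + lam / 2)] with α hα hα2 u v hs hu0 hv0
  have hm : MonotoneOn (fun t => (phaseEnergy lam q (u t) (v t) + lam / 2) *
      Real.exp (2 * H * t)) (Icc δ T) := by
    refine monotoneOn_Icc_of_hasDerivAt_nonneg
      ((((hs.continuousOn_phaseEnergy hq).mono (Icc_subset_Icc_left hδ.1.le)).add
        continuousOn_const).mul (by fun_prop))
      (fun t ht => ((hs.hasDerivAt_phaseEnergy hq ⟨hδ.1.trans ht.1, ht.2⟩).add_const _).mul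
        ((hasDerivAt_id t).const_mul (2 * H)).exp) (fun t ht => ?_)
    have h1 : h t ≤ H := le_of_abs_le (hH t (Ioo_subset_Icc_self ht))
    have h0 := hh t ⟨hδ.1.trans ht.1, ht.2⟩
    have h2 : v t ^ 2 / 2 ≤ phaseEnergy lam q (u t) (v t) + lam / 2 := by
      have := mul_le_mul_of_nonneg_left (sq_div_two_le_abs_rpow hq (u t)) hlam.le
      unfold phaseEnergy
      linarith
    have h3 : h t * v t ^ 2 ≤ 2 * H * (phaseEnergy lam q (u t) (v t) + lam / 2) := by
      have := mul_le_mul h1 h2 (by positivity) (by linarith)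
      linarith
    have he := Real.exp_pos (2 * H * t)
    simp only [id, mul_one]
    have : ∀ X Y : ℝ, X ≤ 2 * H * Y →
        0 ≤ -X * Real.exp (2 * H * t) + Y * (Real.exp (2 * H * t) * (2 * H)) :=
      fun X Y hXY => by nlinarith
    exact this _ _ h3
  have h1 := hm (left_mem_Icc.2 hδ.2.le) (right_mem_Icc.2 hδ.2.le) hδ.2.le
  have h2 := hα u v hs hu0 hv0
  have h3 : (c₁ * α ^ μ - C + lam / 2) * Real.exp (2 * H * (δ - T)) ≤
      phaseEnergy lam q (u T) (v T) + lam / 2 := by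
    rw [mul_sub, Real.exp_sub, ← mul_div_assoc, div_le_iff₀ (Real.exp_pos _)]
    exact le_trans (mul_le_mul_of_nonneg_right (by linarith) (Real.exp_pos _).le) h1
  linarith

end PhaseSol

/-- A continuous polar angle of a differentiable plane curve is differentiable. -/
theorem hasDerivAt_angle {X Y φ : ℝ → ℝ} {X' Y' t : ℝ}
    (hpol : ∀ᶠ s in nhds t, ∃ r, 0 < r ∧ X s = r * Real.cos (φ s) ∧ Y s = r * Real.sin (φ s))
    (hφ : ContinuousAt φ t) (hX : HasDerivAt X X' t) (hY : HasDerivAt Y Y' t) :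
    HasDerivAt φ ((X t * Y' - Y t * X') / (X t ^ 2 + Y t ^ 2)) t := by
  set c := Real.cos (φ t) with hc
  set s := Real.sin (φ t) with hs
  have hcs : s ^ 2 + c ^ 2 = 1 := Real.sin_sq_add_cos_sq _
  obtain ⟨r, hr, hXr, hYr⟩ := hpol.self_of_nhds
  rw [← hc] at hXr
  rw [← hs] at hYr
  have hnum : HasDerivAt (fun x => Y x * c - X x * s) (Y' * c - X' * s) t :=
    (hY.mul_const c).sub (hX.mul_const s)
  have hden : HasDerivAt (fun x => X x * c + Y x * s) (X' * c + Y' * s) t :=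
    (hX.mul_const c).add (hY.mul_const s)
  have hdent : X t * c + Y t * s = r := by
    rw [hXr, hYr]
    linear_combination r * hcs
  have hnumt : Y t * c - X t * s = 0 := by
    rw [hXr, hYr]
    ring
  have hquot := hnum.div hden (by rw [hdent]; exact hr.ne')
  have harc := (hquot.arctan).const_add (φ t)
  have hev : φ =ᶠ[nhds t] fun x => φ t + Real.arctan
      (((fun x => Y x * c - X x * s) / fun x => X x * c + Y x * s) x) := by
    have hnear : ∀ᶠ x in nhds t, |φ x - φ t| < Real.pi / 2 := by
      have h1 : ContinuousAt (fun x => |φ x - φ t|) t := (hφ.sub continuousAt_const).abs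
      exact h1.eventually_lt_const (by simpa using Real.pi_div_two_pos)
    filter_upwards [hpol, hnear] with x ⟨ρ, hρ, hXx, hYx⟩ hx
    have h1 : Y x * c - X x * s = ρ * Real.sin (φ x - φ t) := by
      rw [Real.sin_sub, hXx, hYx]
      ring
    have h2 : X x * c + Y x * s = ρ * Real.cos (φ x - φ t) := by
      rw [Real.cos_sub, hXx, hYx]
      ring
    rw [Pi.div_apply, h1, h2, mul_div_mul_left _ _ hρ.ne', ← Real.tan_eq_sin_div_cos,
      Real.arctan_tan (abs_lt.1 hx).1 (abs_lt.1 hx).2]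
    ring
  refine (harc.congr_of_eventuallyEq hev).congr_deriv ?_
  rw [Pi.div_apply, hnumt, hdent, hXr, hYr]
  have : (r * c) ^ 2 + (r * s) ^ 2 = r ^ 2 := by linear_combination r ^ 2 * hcs
  rw [this]
  field_simp
  ring

namespace PhaseSol

variable {h : ℝ → ℝ} {lam q T : ℝ} {u v : ℝ → ℝ}

theorem exists_rotation_threshold (hq : 1 < q) (hlam : 0 < lam) (κ H : ℝ) :
    ∃ K, ∀ x y η : ℝ, |η| ≤ H → K ≤ phaseEnergy lam q x y →
      x * (-(η * y) - lam * (|x| ^ (q - 1) * x - x)) - y ^ 2 ≤ -((κ * x) ^ 2 + y ^ 2) / 2 := by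
  obtain ⟨K, hK, hcoer⟩ := exists_mul_sq_le_abs_rpow hq (c := lam / 2)
    (C := H ^ 2 + lam + κ ^ 2 / 2) (by positivity) (by positivity)
  refine ⟨2 * K, fun x y η hη hE => ?_⟩
  have h1 := hcoer x
  rw [phaseEnergy] at hE
  have hP := abs_rpow_sub_one_mul_sq hq x
  set P := |x| ^ (q + 1) with hPdef
  have hP0 : 0 ≤ P := by positivity
  have h2 : -(η * x * y) ≤ H ^ 2 * x ^ 2 + y ^ 2 / 4 := by
    have h3 : η ^ 2 * x ^ 2 ≤ H ^ 2 * x ^ 2 := by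
      have : η ^ 2 ≤ H ^ 2 := sq_le_sq' (abs_le.1 hη).1 (abs_le.1 hη).2
      gcongr
    nlinarith [sq_nonneg (η * x + y / 2)]
  have h4 : lam * (P / (q + 1)) ≤ lam * P := by
    gcongr
    exact div_le_self hP0 (by linarith)
  have h5 : 0 ≤ lam * x ^ 2 := by positivity
  have h6 : x * (-(η * y) - lam * (|x| ^ (q - 1) * x - x)) =
      -(η * x * y) - lam * P + lam * x ^ 2 := by
    rw [← hP]
    ring
  rw [h6]
  linarith

/-- Fast clockwise rotation on the second half of the interval bounds the final angle. -/
theorem angle_le (hT : 0 < T) (hs : PhaseSol h lam q T u v) {κ : ℝ} (hκ : 0 < κ) {φ : ℝ → ℝ}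
    (hφ : ContinuousOn φ (Icc 0 T)) (hφ0 : φ 0 = 0)
    (hpol : ∀ t ∈ Icc 0 T, ∃ r, 0 < r ∧ κ * u t = r * Real.cos (φ t) ∧ v t = r * Real.sin (φ t))
    (hrot : ∀ t ∈ Ioo (T / 2) T,
      u t * (-(h t * v t) - lam * (|u t| ^ (q - 1) * u t - u t)) - v t ^ 2 ≤
        -((κ * u t) ^ 2 + v t ^ 2) / 2) :
    φ T ≤ Real.pi / 2 - κ * T / 4 := by
  have hder : ∀ t ∈ Ioo 0 T, HasDerivAt φ (κ * (u t * (-(h t * v t) -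
      lam * (|u t| ^ (q - 1) * u t - u t)) - v t ^ 2) / ((κ * u t) ^ 2 + v t ^ 2)) t := by
    intro t ht
    refine (hasDerivAt_angle ?_ (hφ.continuousAt (Icc_mem_nhds ht.1 ht.2))
      ((hs.derivU t ht).const_mul κ) (hs.derivV t ht)).congr_deriv (by ring)
    filter_upwards [Icc_mem_nhds ht.1 ht.2] with x hx using hpol x hx
  have hpos : ∀ t ∈ Icc 0 T, 0 < (κ * u t) ^ 2 + v t ^ 2 := by
    intro t ht
    obtain ⟨r, hr, h1, h2⟩ := hpol t ht
    have : (κ * u t) ^ 2 + v t ^ 2 = r ^ 2 := by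
      rw [h1, h2]
      linear_combination r ^ 2 * Real.sin_sq_add_cos_sq (φ t)
    rw [this]
    positivity
  have hhalf : φ (T / 2) ≤ Real.pi / 2 := by
    obtain ⟨ε, hε0, hε⟩ : ∃ ε ∈ Ioo 0 (T / 2), φ ε ≤ Real.pi / 2 := by
      have h1 : Tendsto φ (nhdsWithin 0 (Ioo 0 (T / 2))) (nhds 0) := by
        have := hφ 0 (left_mem_Icc.2 hT.le)
        rw [ContinuousWithinAt, hφ0] at this
        exact this.mono_left (nhdsWithin_mono _ fun x hx => ⟨hx.1.le, by linarith [hx.2]⟩)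
      have := left_nhdsWithin_Ioo_neBot (half_pos hT)
      have h2 : ∀ᶠ x in nhdsWithin 0 (Ioo 0 (T / 2)), x ∈ Ioo 0 (T / 2) := self_mem_nhdsWithin
      exact (h2.and (h1.eventually_le_const Real.pi_div_two_pos)).exists
    refine image_le_of_deriv_right_lt_deriv_boundary (a := ε) (b := T / 2)
      (B := fun _ => Real.pi / 2) (B' := fun _ => 0)
      (hφ.mono (Icc_subset_Icc hε0.1.le (by linarith)))
      (fun x hx => (hder x ⟨hε0.1.trans_le hx.1, by linarith [hx.2]⟩).hasDerivWithinAt) hε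
      (fun x => hasDerivAt_const x _) (fun x hx hxπ => ?_) (right_mem_Icc.2 hε0.2.le)
    have hxT : x ∈ Icc 0 T := ⟨hε0.1.le.trans hx.1, by linarith [hx.2]⟩
    obtain ⟨r, hr, h1, h2⟩ := hpol x hxT
    rw [hxπ, Real.cos_pi_div_two, mul_zero] at h1
    have hu : u x = 0 := (mul_eq_zero.1 h1).resolve_left hκ.ne'
    have hp := hpos x hxT
    refine div_neg_of_neg_of_pos ?_ hp
    rw [hu] at hp ⊢
    nlinarith
  have hanti : AntitoneOn (fun t => φ t + κ / 2 * t) (Icc (T / 2) T) := by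
    refine antitoneOn_Icc_of_hasDerivAt_nonpos
      ((hφ.mono (Icc_subset_Icc_left (by linarith))).add (by fun_prop))
      (fun t ht => (hder t ⟨by linarith [ht.1], ht.2⟩).add ((hasDerivAt_id t).const_mul (κ / 2)))
      (fun t ht => ?_)
    have hp := hpos t ⟨by linarith [ht.1], ht.2.le⟩
    have h1 := mul_le_mul_of_nonneg_left (hrot t ht) hκ.le
    have h2 : κ * (u t * (-(h t * v t) - lam * (|u t| ^ (q - 1) * u t - u t)) - v t ^ 2) /
        ((κ * u t) ^ 2 + v t ^ 2) ≤ -(κ / 2) := by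
      rw [div_le_iff₀ hp]
      linarith
    linarith
  have := hanti (left_mem_Icc.2 (by linarith)) (right_mem_Icc.2 (by linarith))
    (by linarith : T / 2 ≤ T)
  simp only at this
  linarith

end PhaseSol

namespace PhaseSol

variable {h : ℝ → ℝ} {lam q T : ℝ} {U W : ℝ → ℝ → ℝ}

/-- Solutions depend continuously on time and initial height jointly. -/
theorem continuousOn_family (hq : 1 < q) (hlam : 0 < lam) (hh : ∀ t ∈ Ioo 0 T, 0 < h t)
    (hfam : ∀ α, PhaseSol h lam q T (U α) (W α)) (hU0 : ∀ α, U α 0 = α) (hW0 : ∀ α, W α 0 = 0) :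
    ContinuousOn (fun p : ℝ × ℝ => U p.1 p.2) (univ ×ˢ Icc 0 T) ∧
      ContinuousOn (fun p : ℝ × ℝ => W p.1 p.2) (univ ×ˢ Icc 0 T) := by
  have key : ∀ A : ℝ, ∃ K : NNReal, ∀ t ∈ Icc 0 T,
      LipschitzOnWith K (fun α => U α t) (Icc (-A) A) ∧
      LipschitzOnWith K (fun α => W α t) (Icc (-A) A) := by
    intro A
    obtain ⟨K, hK⟩ := exists_dist_sq_le (q := q) hq hlam hh A
    refine ⟨Real.toNNReal √K, fun t ht => ?_⟩
    have hle : ∀ α ∈ Icc (-A) A, ∀ β ∈ Icc (-A) A,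
        (U α t - U β t) ^ 2 + (W α t - W β t) ^ 2 ≤ K * (α - β) ^ 2 := by
      intro α hα β hβ
      have := hK _ _ _ _ (hfam α) (hfam β) (by rw [hU0]; exact abs_le.2 hα)
        (by rw [hU0]; exact abs_le.2 hβ) (hW0 α) (hW0 β) t ht
      rwa [hU0, hU0] at this
    have habs : ∀ x y z : ℝ, x ^ 2 + y ^ 2 ≤ K * z ^ 2 → |x| ≤ √K * |z| := by
      intro x y z hxyz
      rw [← Real.sqrt_sq_eq_abs z, ← Real.sqrt_mul' _ (sq_nonneg z)]
      exact Real.abs_le_sqrt (by nlinarith [sq_nonneg y])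
    constructor
    · refine LipschitzOnWith.of_dist_le_mul fun α hα β hβ => ?_
      rw [Real.dist_eq, Real.dist_eq, Real.coe_toNNReal _ (Real.sqrt_nonneg K)]
      exact habs _ _ _ (hle α hα β hβ)
    · refine LipschitzOnWith.of_dist_le_mul fun α hα β hβ => ?_
      rw [Real.dist_eq, Real.dist_eq, Real.coe_toNNReal _ (Real.sqrt_nonneg K)]
      exact habs _ (U α t - U β t) _ (by rw [add_comm]; exact hle α hα β hβ)
  have hnhds : ∀ p : ℝ × ℝ, Icc (-(|p.1| + 1)) (|p.1| + 1) ×ˢ Icc 0 T ∈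
      nhdsWithin p (univ ×ˢ Icc 0 T) := by
    intro p
    have h1 : Icc (-(|p.1| + 1)) (|p.1| + 1) ∈ nhds p.1 :=
      Icc_mem_nhds (by linarith [neg_abs_le p.1]) (by linarith [le_abs_self p.1])
    have h2 : Icc (-(|p.1| + 1)) (|p.1| + 1) ×ˢ univ ∈ nhds p := prod_mem_nhds h1 univ_mem
    filter_upwards [nhdsWithin_le_nhds h2, self_mem_nhdsWithin] with x hx hx' using ⟨hx.1, hx'.2⟩
  have hmem : ∀ p : ℝ × ℝ, p ∈ univ ×ˢ Icc 0 T →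
      p ∈ Icc (-(|p.1| + 1)) (|p.1| + 1) ×ˢ Icc 0 T := fun p hp =>
    ⟨⟨by linarith [neg_abs_le p.1], by linarith [le_abs_self p.1]⟩, hp.2⟩
  constructor
  · intro p hp
    obtain ⟨K, hK⟩ := key (|p.1| + 1)
    exact (continuousOn_prod_of_continuousOn_lipschitzOnWith (fun p : ℝ × ℝ => U p.1 p.2) K
      (fun α _ => (hfam α).contU) (fun t ht => (hK t ht).1) p
        (hmem p hp)).mono_of_mem_nhdsWithin (hnhds p)
  · intro p hp
    obtain ⟨K, hK⟩ := key (|p.1| + 1)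
    exact (continuousOn_prod_of_continuousOn_lipschitzOnWith (fun p : ℝ × ℝ => W p.1 p.2) K
      (fun α _ => (hfam α).contV) (fun t ht => (hK t ht).2) p
        (hmem p hp)).mono_of_mem_nhdsWithin (hnhds p)

theorem continuous_end (hq : 1 < q) (hlam : 0 < lam) (hT : 0 < T) (hh : ∀ t ∈ Ioo 0 T, 0 < h t)
    (hfam : ∀ α, PhaseSol h lam q T (U α) (W α)) (hU0 : ∀ α, U α 0 = α) (hW0 : ∀ α, W α 0 = 0) :
    Continuous (fun α => U α T) ∧ Continuous (fun α => W α T) := by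
  obtain ⟨h1, h2⟩ := continuousOn_family hq hlam hh hfam hU0 hW0
  have h3 : Continuous fun α : ℝ => (α, T) := by fun_prop
  exact ⟨h1.comp_continuous h3 fun α => ⟨mem_univ _, right_mem_Icc.2 hT.le⟩,
    h2.comp_continuous h3 fun α => ⟨mem_univ _, right_mem_Icc.2 hT.le⟩⟩

theorem eq_one_of_initial (hq : 1 < q) (hlam : 0 < lam) (hh : ∀ t ∈ Ioo 0 T, 0 < h t)
    {u v : ℝ → ℝ} (hs : PhaseSol h lam q T u v) (hu0 : u 0 = 1) (hv0 : v 0 = 0) {t : ℝ}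
    (ht : t ∈ Icc 0 T) : u t = 1 ∧ v t = 0 := by
  obtain ⟨K, hK⟩ := exists_dist_sq_le (q := q) hq hlam hh 1
  have h1 := hK _ _ _ _ hs one (by rw [hu0, abs_one]) (by rw [abs_one]) hv0 rfl t ht
  rw [hu0, sub_self, sub_zero] at h1
  have h2 := sq_nonneg (u t - 1)
  have h3 := sq_nonneg (v t)
  have h4 : (u t - 1) ^ 2 = 0 := by linarith
  have h5 : v t ^ 2 = 0 := by linarith
  exact ⟨sub_eq_zero.1 (pow_eq_zero_iff two_ne_zero |>.1 h4), pow_eq_zero_iff two_ne_zero |>.1 h5⟩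

end PhaseSol

/-- A continuous angle staying on the positive horizontal axis is constant. -/
theorem angle_const_of_sin_eq_zero {X : Type*} [TopologicalSpace X] {S : Set X}
    (hS : IsPreconnected S) {θ : X → ℝ} (hθ : ContinuousOn θ S)
    (hsin : ∀ x ∈ S, Real.sin (θ x) = 0) {x y : X} (hx : x ∈ S) (hy : y ∈ S) : θ x = θ y := by
  have hoc := (hS.image θ hθ).ordConnected
  have hsub := hoc.uIcc_subset (mem_image_of_mem θ hx) (mem_image_of_mem θ hy)
  by_contra hne
  have hz : ∀ z ∈ uIcc (θ x) (θ y), Real.sin z = 0 := by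
    intro z hz
    obtain ⟨w, hw, rfl⟩ := hsub hz
    exact hsin w hw
  obtain ⟨m, hm⟩ := Real.sin_eq_zero_iff.1 (hz _ left_mem_uIcc)
  set δ := min 1 |θ y - θ x| with hδ
  have hδ0 : 0 < δ := lt_min one_pos (abs_pos.2 (sub_ne_zero.2 (Ne.symm hne)))
  have hδ1 : δ ≤ 1 := min_le_left _ _
  have hsδ : 0 < Real.sin δ := Real.sin_pos_of_pos_of_lt_pi hδ0 (by linarith [Real.pi_gt_three])
  have hδ2 : δ ≤ |θ y - θ x| := min_le_right _ _
  have hsx := hz _ left_mem_uIcc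
  have hcx : Real.cos (θ x) ≠ 0 := by
    intro h0
    have := Real.sin_sq_add_cos_sq (θ x)
    rw [hsx, h0] at this
    norm_num at this
  rcases le_total (θ x) (θ y) with hle | hle
  · rw [abs_of_nonneg (sub_nonneg.2 hle)] at hδ2
    have := hz (θ x + δ) (by rw [uIcc_of_le hle]; exact ⟨by linarith, by linarith⟩)
    rw [Real.sin_add, hsx, zero_mul, zero_add] at this
    exact (mul_ne_zero hcx hsδ.ne') this
  · rw [abs_of_nonpos (sub_nonpos.2 hle)] at hδ2
    have := hz (θ x - δ) (by rw [uIcc_of_ge hle]; exact ⟨by linarith, by linarith⟩)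
    rw [Real.sin_sub, hsx, zero_mul, zero_sub, neg_eq_zero] at this
    exact (mul_ne_zero hcx hsδ.ne') this

namespace PhaseSol

variable {h : ℝ → ℝ} {lam q T : ℝ} {U W : ℝ → ℝ → ℝ}

theorem exists_scaled_angle (hq : 1 < q) (hlam : 0 < lam) (hT : 0 < T)
    (hh : ∀ t ∈ Ioo 0 T, 0 < h t) (hc : ContinuousOn h (Ioc 0 T))
    (hfam : ∀ α, PhaseSol h lam q T (U α) (W α)) (hU0 : ∀ α, U α 0 = α) (hW0 : ∀ α, W α 0 = 0)
    {κ : ℝ} (hκ : 0 < κ) :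
    ∃ b : ℝ → ℝ, ContinuousOn b (Ioi 0) ∧ b 1 = 0 ∧ ∀ α, 0 < α → ∃ φ : ℝ → ℝ,
      ContinuousOn φ (Icc 0 T) ∧ φ 0 = 0 ∧ φ T = b α ∧ ∀ t ∈ Icc 0 T, ∃ r, 0 < r ∧
        κ * U α t = r * Real.cos (φ t) ∧ W α t = r * Real.sin (φ t) := by
  obtain ⟨hUc, hWc⟩ := continuousOn_family hq hlam hh hfam hU0 hW0
  set P : ℝ × ℝ → ℝ × ℝ := fun x => (Real.exp x.1, (projIcc 0 T hT.le x.2 : ℝ)) with hP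
  have hPc : Continuous P := by
    have : Continuous fun x : ℝ × ℝ => (projIcc 0 T hT.le x.2 : ℝ) :=
      continuous_subtype_val.comp (continuous_projIcc.comp continuous_snd)
    fun_prop
  have hPm : ∀ x, P x ∈ univ ×ˢ Icc 0 T := fun x => ⟨mem_univ _, (projIcc 0 T hT.le x.2).2⟩
  obtain ⟨θ, hθ, hθpol⟩ := exists_continuous_angle
    (fun x => κ * U (P x).1 (P x).2) (fun x => W (P x).1 (P x).2)
    (continuous_const.mul (hUc.comp_continuous hPc hPm)) (hWc.comp_continuous hPc hPm)
    (fun x hx => ne_zero_of_initial_ne_zero hq hlam hc (hfam _)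
      (by rw [hU0]; exact (Real.exp_pos _).ne') (hPm x).2 ((mul_eq_zero.1 hx).resolve_left hκ.ne'))
  have hPt : ∀ s, ∀ t ∈ Icc 0 T, P (s, t) = (Real.exp s, t) := fun s t ht => by
    simp only [hP, projIcc_of_mem hT.le ht]
  have hpol : ∀ s, ∀ t ∈ Icc 0 T, ∃ r, 0 < r ∧ κ * U (Real.exp s) t = r * Real.cos (θ (s, t)) ∧
      W (Real.exp s) t = r * Real.sin (θ (s, t)) := fun s t ht => by
    have := hθpol (s, t)
    rwa [hPt s t ht] at this
  have h0m : (0 : ℝ) ∈ Icc 0 T := left_mem_Icc.2 hT.le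
  have hTm : T ∈ Icc 0 T := right_mem_Icc.2 hT.le
  have hbase : ∀ s, θ (s, 0) = θ (0, 0) := by
    intro s
    refine angle_const_of_sin_eq_zero (θ := fun s => θ (s, 0)) isPreconnected_univ
      (by fun_prop) (fun s _ => ?_) (mem_univ s) (mem_univ 0)
    obtain ⟨r, hr, -, h2⟩ := hpol s 0 h0m
    rw [hW0, eq_comm, mul_eq_zero] at h2
    exact h2.resolve_left hr.ne'
  have hone : θ (0, T) = θ (0, 0) := by
    refine angle_const_of_sin_eq_zero (θ := fun t => θ (0, t)) (S := Icc 0 T) isPreconnected_Icc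
      (by fun_prop) (fun t ht => ?_) hTm h0m
    obtain ⟨r, hr, -, h2⟩ := hpol 0 t ht
    rw [Real.exp_zero, (eq_one_of_initial hq hlam hh (hfam 1) (hU0 1) (hW0 1) ht).2, eq_comm,
      mul_eq_zero] at h2
    exact h2.resolve_left hr.ne'
  obtain ⟨m, hm⟩ : ∃ m : ℤ, (m : ℝ) * (2 * Real.pi) = θ (0, 0) := by
    obtain ⟨r, hr, h1, h2⟩ := hpol 0 0 h0m
    rw [hW0, eq_comm, mul_eq_zero] at h2
    have hsin := h2.resolve_left hr.ne'
    rw [hU0, Real.exp_zero, mul_one] at h1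
    have hcos : 0 < Real.cos (θ (0, 0)) := by
      by_contra! hle
      nlinarith
    refine (Real.cos_eq_one_iff _).1 ?_
    nlinarith [Real.sin_sq_add_cos_sq (θ (0, 0))]
  refine ⟨fun α => θ (Real.log α, T) - m * (2 * Real.pi), ?_, ?_, fun α hα =>
    ⟨fun t => θ (Real.log α, t) - m * (2 * Real.pi), by fun_prop, ?_, rfl, fun t ht => ?_⟩⟩
  · have : ContinuousOn Real.log (Ioi 0) := Real.continuousOn_log.mono fun x hx => ne_of_gt hx
    fun_prop
  · simp only [Real.log_one]
    rw [hone, hm, sub_self]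
  · simp only
    rw [hbase, hm, sub_self]
  · have := hpol (Real.log α) t ht
    rw [Real.exp_log hα] at this
    simpa only [Real.cos_sub_int_mul_two_pi, Real.sin_sub_int_mul_two_pi] using this

end PhaseSol

/-- Two continuous angles lying in the same open or closed quadrants stay within `π`. -/
theorem abs_sub_lt_pi_of_same_quadrant {a b : ℝ → ℝ} (ha : ContinuousOn a (Ioi 0))
    (hb : ContinuousOn b (Ioi 0)) (ha1 : a 1 = 0) (hb1 : b 1 = 0)
    (hquad : ∀ α, 0 < α → ∃ x y r s κ, 0 < κ ∧ 0 < r ∧ 0 < s ∧ x = r * Real.cos (a α) ∧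
      y = r * Real.sin (a α) ∧ κ * x = s * Real.cos (b α) ∧ y = s * Real.sin (b α))
    {α : ℝ} (hα : 0 < α) : |a α - b α| < Real.pi := by
  have hpi := Real.pi_pos
  by_contra! hle
  obtain ⟨β, hβ, hβπ⟩ : ∃ β ∈ Ioi (0 : ℝ), |a β - b β| = Real.pi := by
    have hpre : IsPreconnected (Ioi (0 : ℝ)) := isPreconnected_Ioi
    have hcont : ContinuousOn (fun β => |a β - b β|) (Ioi 0) := (ha.sub hb).abs
    obtain ⟨β, hβ, hβπ⟩ := hpre.intermediate_value (mem_Ioi.2 one_pos) (mem_Ioi.2 hα) hcont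
      ⟨by simp only [ha1, hb1, sub_self, abs_zero]; exact hpi.le, hle⟩
    exact ⟨β, hβ, hβπ⟩
  obtain ⟨x, y, r, s, κ, hκ, hr, hs, hx, hy, hx', hy'⟩ := hquad β hβ
  have hcs : Real.cos (b β) = -Real.cos (a β) ∧ Real.sin (b β) = -Real.sin (a β) := by
    rcases eq_or_eq_neg_of_abs_eq hβπ with h | h
    · have : b β = a β - Real.pi := by linarith
      rw [this, Real.cos_sub_pi, Real.sin_sub_pi]
      exact ⟨rfl, rfl⟩
    · have : b β = a β + Real.pi := by linarith
      rw [this, Real.cos_add_pi, Real.sin_add_pi]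
      exact ⟨rfl, rfl⟩
  rw [hcs.1, hx] at hx'
  rw [hcs.2, hy] at hy'
  have hc0 : (κ * r + s) * Real.cos (a β) = 0 := by linarith
  have hs0 : (r + s) * Real.sin (a β) = 0 := by linarith
  have hc1 := (mul_eq_zero.1 hc0).resolve_left (by positivity)
  have hs1 := (mul_eq_zero.1 hs0).resolve_left (by positivity)
  have := Real.sin_sq_add_cos_sq (a β)
  rw [hc1, hs1] at this
  norm_num at this

namespace PhaseSol

variable {h : ℝ → ℝ} {lam q T : ℝ} {U W : ℝ → ℝ → ℝ}

/-- The angle of the end point of the solution tends to `-∞` with the initial height. -/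
theorem tendsto_angle_atBot (hq : 1 < q) (hlam : 0 < lam) (hT : 0 < T)
    (hh : ∀ t ∈ Ioo 0 T, 0 < h t) (hc : ContinuousOn h (Ioc 0 T)) {ν : ℝ} (hν : 1 ≤ ν)
    (hlim : Tendsto (fun t => t * h t) (nhdsWithin 0 (Ioi 0)) (nhds ν))
    (hsub : (ν - 1) * q < ν + 3)
    (hfam : ∀ α, PhaseSol h lam q T (U α) (W α)) (hU0 : ∀ α, U α 0 = α) (hW0 : ∀ α, W α 0 = 0)
    {a : ℝ → ℝ} (ha : ContinuousOn a (Ioi 0)) (ha1 : a 1 = 0)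
    (hpol : ∀ α, 0 < α → ∃ r, 0 < r ∧ U α T = r * Real.cos (a α) ∧ W α T = r * Real.sin (a α)) :
    Tendsto a atTop atBot := by
  refine tendsto_atBot.2 fun B => ?_
  set κ := max 1 ((3 * Real.pi / 2 - B) * 4 / T) with hκdef
  have hκ : 0 < κ := lt_of_lt_of_le one_pos (le_max_left _ _)
  have hκB : 3 * Real.pi / 2 - κ * T / 4 ≤ B := by
    have : (3 * Real.pi / 2 - B) * 4 / T ≤ κ := le_max_right _ _
    rw [div_le_iff₀ hT] at this
    linarith
  obtain ⟨H, hH⟩ := isCompact_Icc.exists_bound_of_continuousOn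
    (hc.mono (fun t ht => ⟨by linarith [ht.1], ht.2⟩ : Icc (T / 2) T ⊆ Ioc 0 T))
  obtain ⟨K, hK⟩ := exists_rotation_threshold hq hlam κ H
  obtain ⟨b, hb, hb1, hbφ⟩ := exists_scaled_angle hq hlam hT hh hc hfam hU0 hW0 hκ
  filter_upwards [eventually_le_phaseEnergy hq hlam hT hh hc hν hlim hsub K,
    eventually_gt_atTop 0] with α hα hα0
  obtain ⟨φ, hφ, hφ0, hφT, hφpol⟩ := hbφ α hα0
  have h1 : φ T ≤ Real.pi / 2 - κ * T / 4 := by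
    refine angle_le hT (hfam α) hκ hφ hφ0 hφpol fun t ht => ?_
    have htT : t ∈ Icc 0 T := ⟨by linarith [ht.1], ht.2.le⟩
    exact hK _ _ _ (hH t (Ioo_subset_Icc_self ht)) ((hα _ _ (hfam α) (hU0 α) (hW0 α)).trans
      ((hfam α).antitoneOn_phaseEnergy hq hh htT (right_mem_Icc.2 hT.le) ht.2.le))
  have h2 : |a α - b α| < Real.pi := by
    refine abs_sub_lt_pi_of_same_quadrant ha hb ha1 hb1 (fun β hβ => ?_) hα0
    obtain ⟨r, hr, h1, h2⟩ := hpol β hβ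
    obtain ⟨ψ, -, -, hψT, hψpol⟩ := hbφ β hβ
    obtain ⟨s, hs, h3, h4⟩ := hψpol T (right_mem_Icc.2 hT.le)
    rw [hψT] at h3 h4
    exact ⟨_, _, r, s, κ, hκ, hr, hs, h1, h2, h3, h4⟩
  have h3 := (abs_lt.1 h2).2
  rw [hφT] at h1
  linarith

end PhaseSol

/-- The last points at which an angle tending to `-∞` takes the values `-kπ` exist, and a
function separating consecutive antipodal points is monotone along them. -/
theorem exists_last_crossings {a ρ : ℝ → ℝ} (ha : ContinuousOn a (Ioi 0)) (ha1 : a 1 = 0)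
    (hbot : Tendsto a atTop atBot) (hρ : ContinuousOn ρ (Ioi 0))
    (hdisj : ∀ s t, 0 < s → 0 < t → a t = a s - Real.pi → ρ t ≠ ρ s) :
    (∀ k : ℕ, {α : ℝ | 0 < α ∧ a α = -(k : ℝ) * Real.pi}.Nonempty ∧
      BddAbove {α : ℝ | 0 < α ∧ a α = -(k : ℝ) * Real.pi}) ∧
    ∃ e : ℕ → ℝ, (∀ k : ℕ, IsGreatest {α : ℝ | 0 < α ∧ a α = -(k : ℝ) * Real.pi} (e k)) ∧
      ((∀ k, ρ (e (k + 1)) ≤ ρ (e k)) ∨ ∀ k, ρ (e k) ≤ ρ (e (k + 1))) := by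
  have hpi := Real.pi_pos
  have hivt : ∀ s c, 0 < s → c ≤ a s → ∃ t, s ≤ t ∧ a t = c := by
    intro s c hs hc
    obtain ⟨t, ht, hst⟩ := ((hbot.eventually_le_atBot c).and (eventually_ge_atTop s)).exists
    obtain ⟨x, hx, hxc⟩ := intermediate_value_Icc' hst
      (ha.mono fun x hx => hs.trans_le hx.1) ⟨ht, hc⟩
    exact ⟨x, hx.1, hxc⟩
  have hne : ∀ k : ℕ, {α : ℝ | 0 < α ∧ a α = -(k : ℝ) * Real.pi}.Nonempty := by
    intro k
    obtain ⟨t, ht, hat⟩ := hivt 1 (-(k : ℝ) * Real.pi) one_pos (by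
      rw [ha1, neg_mul]
      exact neg_nonpos.2 (by positivity))
    exact ⟨t, one_pos.trans_le ht, hat⟩
  have hbdd : ∀ k : ℕ, BddAbove {α : ℝ | 0 < α ∧ a α = -(k : ℝ) * Real.pi} := by
    intro k
    obtain ⟨M, hM⟩ := (hbot.eventually_lt_atBot (-(k : ℝ) * Real.pi)).exists_forall_of_atTop
    refine ⟨M, fun α hα => ?_⟩
    by_contra! hlt
    exact (hM α hlt.le).ne hα.2
  refine ⟨fun k => ⟨hne k, hbdd k⟩, ?_⟩
  have hmax : ∀ k : ℕ, ∃ x, IsGreatest {α : ℝ | 0 < α ∧ a α = -(k : ℝ) * Real.pi} x := by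
    intro k
    set S := {α : ℝ | 0 < α ∧ a α = -(k : ℝ) * Real.pi} with hS
    have hlub := isLUB_csSup (hne k) (hbdd k)
    obtain ⟨y, hy⟩ := hne k
    have hpos : 0 < sSup S := hy.1.trans_le (hlub.1 hy)
    refine ⟨sSup S, ⟨hpos, ?_⟩, hlub.1⟩
    have hcl := hlub.mem_closure ⟨y, hy⟩
    have := mem_closure_iff_nhdsWithin_neBot.1 hcl
    refine tendsto_nhds_unique (f := a) (l := nhdsWithin (sSup S) S)
      ((ha.continuousAt (Ioi_mem_nhds hpos)).mono_left nhdsWithin_le_nhds)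
      (tendsto_const_nhds.congr' ?_)
    filter_upwards [self_mem_nhdsWithin] with z hz using hz.2.symm
  choose e he using hmax
  refine ⟨e, he, ?_⟩
  have hval : ∀ k, a (e k) = -(k : ℝ) * Real.pi := fun k => (he k).1.2
  have hpos : ∀ k, 0 < e k := fun k => (he k).1.1
  have hstep : ∀ k, a (e (k + 1)) = a (e k) - Real.pi := fun k => by
    rw [hval, hval]
    push_cast
    ring
  have hlast : ∀ k s, e k ≤ s → a s ≤ a (e k) := by
    intro k s hs
    by_contra! hlt
    obtain ⟨t, hst, hat⟩ := hivt s _ ((hpos k).trans_le hs) hlt.le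
    have hts : t ≤ e k := (he k).2 ⟨(hpos k).trans_le (hs.trans hst), hat.trans (hval k)⟩
    rw [le_antisymm hs (hst.trans hts)] at hlt
    exact lt_irrefl _ hlt
  have hmono : ∀ k, e k ≤ e (k + 1) := by
    intro k
    by_contra! hlt
    have := hlast (k + 1) (e k) hlt.le
    rw [hstep] at this
    linarith
  have hprop : ∀ σ : ℝ → ℝ, ContinuousOn σ (Ioi 0) →
      (∀ s t, 0 < s → 0 < t → a t = a s - Real.pi → σ t ≠ σ s) →
      σ (e 0) < σ (e 1) → ∀ k, σ (e k) < σ (e (k + 1)) := by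
    intro σ hσ hσd h01 k
    induction k with
    | zero => exact h01
    | succ k ih =>
      have hsub : Ici (e k) ⊆ Ioi 0 := fun x hx => (hpos k).trans_le hx
      exact height_lt_of_last_crossings (hmono k) (hmono (k + 1)) (ha.mono hsub) (hσ.mono hsub)
        (hstep k) (hstep (k + 1)) (hlast k) (hlast (k + 1)) (hlast (k + 2)) hbot
        (fun s t hs ht => hσd s t ((hpos k).trans_le hs) ((hpos k).trans_le ht)) ih
  rcases lt_or_gt_of_ne (hdisj _ _ (hpos 0) (hpos 1) (hstep 0)) with hlt | hlt
  · refine Or.inl fun k => ?_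
    have := hprop (fun x => -ρ x) hρ.neg
      (fun s t hs ht hst h => hdisj s t hs ht hst (neg_injective h)) (neg_lt_neg hlt) k
    exact (neg_lt_neg_iff.1 this).le
  · exact Or.inr fun k => (hprop ρ hρ hdisj hlt k).le

theorem subcritical_exponent_bound {n m₁ m₂ : ℤ} (hm₁n : m₁ ≤ n - 2) {q : ℝ}
    (hqsub : min m₁ m₂ < n - 2 →
      q < ((n : ℝ) - (min m₁ m₂ : ℝ) + 2) / ((n : ℝ) - (min m₁ m₂ : ℝ) - 2)) :
    ((n : ℝ) - m₁ - 1 - 1) * q < (n : ℝ) - m₁ - 1 + 3 := by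
  have hm : (m₁ : ℝ) ≤ n - 2 := by exact_mod_cast hm₁n
  rcases hm₁n.eq_or_lt with h | h
  · have : (m₁ : ℝ) = n - 2 := by exact_mod_cast h
    rw [this]
    norm_num
  · have hlt := hqsub ((min_le_left _ _).trans_lt h)
    have h1 : min (m₁ : ℝ) m₂ ≤ m₁ := min_le_left _ _
    have h2 : (m₁ : ℝ) < n - 2 := by exact_mod_cast h
    have h3 : 0 < (n : ℝ) - min (m₁ : ℝ) m₂ - 2 := by linarith
    refine (mul_lt_mul_of_pos_left hlt (by linarith)).trans_le ?_
    rw [← mul_div_assoc, div_le_iff₀ h3]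
    nlinarith

theorem stmt_17
    (d lam : ℝ) (hd : 0 < d) (hlam : 0 < lam)
    (n m₁ m₂ : ℤ) (hn : 3 ≤ n)
    (hm₁0 : 0 ≤ m₁) (hm₁n : m₁ ≤ n - 2) (hm₂0 : 0 ≤ m₂) (hm₂n : m₂ ≤ n - 2)
    (h : ℝ → ℝ) (hC1 : ContDiffOn ℝ 1 h (Set.Ioo 0 d))
    (hder : ∀ t ∈ Set.Ioo 0 d, deriv h t < 0)
    (hlim0 : Filter.Tendsto (fun t => t * h t) (nhdsWithin 0 (Set.Ioi 0))
      (nhds ((n : ℝ) - (m₁ : ℝ) - 1)))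
    (hlimd : Filter.Tendsto (fun t => (t - d) * h t) (nhdsWithin d (Set.Iio d))
      (nhds ((n : ℝ) - (m₂ : ℝ) - 1)))
    (q : ℝ) (hq1 : 1 < q)
    (hqsub : min m₁ m₂ < n - 2 →
      q < ((n : ℝ) - (min m₁ m₂ : ℝ) + 2) / ((n : ℝ) - (min m₁ m₂ : ℝ) - 2))
    (t₀ : ℝ) (ht₀ : t₀ ∈ Set.Ioo 0 d)
    (hpos : ∀ t ∈ Set.Ioo 0 t₀, 0 < h t) (hneg : ∀ t ∈ Set.Ioo t₀ d, h t < 0)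
    (U U' U'' : ℝ → ℝ → ℝ)
    (hU : ∀ α : ℝ, SolOn h lam q (Set.Icc 0 t₀) (Set.Ioc 0 t₀) (U α) (U' α) (U'' α) ∧
      U α 0 = α ∧ U' α 0 = 0)
    (hUuniq : ∀ α : ℝ, ∀ u u' u'' : ℝ → ℝ,
      SolOn h lam q (Set.Icc 0 t₀) (Set.Ioc 0 t₀) u u' u'' → u 0 = α → u' 0 = 0 →
      ∀ t ∈ Set.Icc 0 t₀, u t = U α t ∧ u' t = U' α t)
    (V V' V'' : ℝ → ℝ → ℝ)
    (hV : ∀ β : ℝ, SolOn h lam q (Set.Icc t₀ d) (Set.Ico t₀ d) (V β) (V' β) (V'' β) ∧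
      V β d = β ∧ V' β d = 0)
    (hVuniq : ∀ β : ℝ, ∀ u u' u'' : ℝ → ℝ,
      SolOn h lam q (Set.Icc t₀ d) (Set.Ico t₀ d) u u' u'' → u d = β → u' d = 0 →
      ∀ t ∈ Set.Icc t₀ d, u t = V β t ∧ u' t = V' β t)
    (a : ℝ → ℝ) (haCont : ContinuousOn a (Set.Ioi 0)) (ha1 : a 1 = 0)
    (haAngle : ∀ α : ℝ, 0 < α →
      U α t₀ = enorm2 (U α t₀, U' α t₀) * Real.cos (a α) ∧
      U' α t₀ = enorm2 (U α t₀, U' α t₀) * Real.sin (a α))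
    (b : ℝ → ℝ) (hbCont : ContinuousOn b (Set.Ioi 0)) (hb1 : b 1 = 0)
    (hbAngle : ∀ β : ℝ, 0 < β →
      V β t₀ = enorm2 (V β t₀, V' β t₀) * Real.cos (b β) ∧
      V' β t₀ = enorm2 (V β t₀, V' β t₀) * Real.sin (b β))
    :
    (∀ k : ℕ, {α : ℝ | 0 < α ∧ a α = -(k : ℝ) * Real.pi}.Nonempty ∧
      BddAbove {α : ℝ | 0 < α ∧ a α = -(k : ℝ) * Real.pi}) ∧
    ∃ e : ℕ → ℝ,
      (∀ k : ℕ, IsGreatest {α : ℝ | 0 < α ∧ a α = -(k : ℝ) * Real.pi} (e k)) ∧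
      ((∀ k : ℕ, enorm2 (U (e (k + 1)) t₀, U' (e (k + 1)) t₀) ≤
          enorm2 (U (e k) t₀, U' (e k) t₀)) ∨
       (∀ k : ℕ, enorm2 (U (e k) t₀, U' (e k) t₀) ≤
          enorm2 (U (e (k + 1)) t₀, U' (e (k + 1)) t₀))) := by
  have hT : 0 < t₀ := ht₀.1
  have hfam : ∀ α, PhaseSol h lam q t₀ (U α) (U' α) := fun α => (hU α).1.phaseSol
  have hU0 : ∀ α, U α 0 = α := fun α => (hU α).2.1
  have hW0 : ∀ α, U' α 0 = 0 := fun α => (hU α).2.2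
  have hc : ContinuousOn h (Ioc 0 t₀) :=
    hC1.continuousOn.mono fun t ht => ⟨ht.1, ht.2.trans_lt ht₀.2⟩
  have hν : 1 ≤ (n : ℝ) - m₁ - 1 := by
    have : (m₁ : ℝ) ≤ n - 2 := by exact_mod_cast hm₁n
    linarith
  obtain ⟨hUc, hWc⟩ := PhaseSol.continuous_end hq1 hlam hT hpos hfam hU0 hW0
  have hnorm : ∀ α, 0 < α → 0 < enorm2 (U α t₀, U' α t₀) := by
    intro α hα
    refine Real.sqrt_pos.2 ?_
    by_cases hu : U α t₀ = 0
    · have := (hfam α).ne_zero_of_initial_ne_zero hq1 hlam hc (by rw [hU0]; exact hα.ne')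
        (right_mem_Icc.2 hT.le) hu
      positivity
    · positivity
  have hbot : Tendsto a atTop atBot :=
    PhaseSol.tendsto_angle_atBot hq1 hlam hT hpos hc hν hlim0
      (subcritical_exponent_bound hm₁n hqsub) hfam hU0 hW0 haCont ha1
      fun α hα => ⟨_, hnorm α hα, haAngle α hα⟩
  refine exists_last_crossings (ρ := fun α => enorm2 (U α t₀, U' α t₀)) haCont ha1 hbot
    (by unfold enorm2; fun_prop) fun s t hs ht hst hρ => ?_
  obtain ⟨hs1, hs2⟩ := haAngle s hs
  obtain ⟨ht1, ht2⟩ := haAngle t ht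
  rw [hst, Real.cos_sub_pi, hρ, mul_neg, ← hs1] at ht1
  rw [hst, Real.sin_sub_pi, hρ, mul_neg, ← hs2] at ht2
  have := PhaseSol.initial_eq_of_end_eq hq1 hlam hT hc (hfam t) (hfam s).neg ht1 ht2
  rw [hU0, hU0] at this
  linarith
end

section
/- Let e₀ = max{α > 0 : a(α) = 0} (this maximum exists). Then u_{e₀}'(t₀) = 0, u_{e₀}(t₀) > 0, and u_{e₀}(t₀) ≤ 1. -/
open Set Filter

/-- The odd power nonlinearity `x ↦ |x|^(q-1) x`. -/
noncomputable def oddPow (q x : ℝ) : ℝ := |x| ^ (q - 1) * x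

/-- The primitive of `x ↦ oddPow q x - x` vanishing at `0`. -/
noncomputable def potential (q x : ℝ) : ℝ := |x| ^ (q + 1) / (q + 1) - x ^ 2 / 2

/-- The energy of a phase point `(x, y)`. -/
noncomputable def energy (lam q x y : ℝ) : ℝ := y ^ 2 / 2 + lam * potential q x

/-- `u` solves the regular initial value problem with initial height `α` on `[0, T]`,
and `v` is its derivative. -/
structure IsShot (h : ℝ → ℝ) (lam q T α : ℝ) (u v : ℝ → ℝ) : Prop where
  hasDeriv : ∀ t ∈ Icc 0 T, HasDerivWithinAt u (v t) (Icc 0 T) t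
  cont : ContinuousOn v (Icc 0 T)
  ode : ∀ t ∈ Ioc 0 T,
    HasDerivWithinAt v (-(h t * v t) - lam * (oddPow q (u t) - u t)) (Ioc 0 T) t
  init : u 0 = α
  init_deriv : v 0 = 0

theorem monotoneOn_Icc_of_hasDerivAt {a b : ℝ} {f f' : ℝ → ℝ} (hc : ContinuousOn f (Icc a b))
    (hf : ∀ t ∈ Ioo a b, HasDerivAt f (f' t) t) (hn : ∀ t ∈ Ioo a b, 0 ≤ f' t) :
    MonotoneOn f (Icc a b) := by
  refine monotoneOn_of_hasDerivWithinAt_nonneg (f' := f') (convex_Icc a b) hc ?_ ?_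
  · intro x hx
    rw [interior_Icc] at hx ⊢
    exact (hf x hx).hasDerivWithinAt
  · intro x hx
    rw [interior_Icc] at hx
    exact hn x hx

theorem antitoneOn_Icc_of_hasDerivAt {a b : ℝ} {f f' : ℝ → ℝ} (hc : ContinuousOn f (Icc a b))
    (hf : ∀ t ∈ Ioo a b, HasDerivAt f (f' t) t) (hn : ∀ t ∈ Ioo a b, f' t ≤ 0) :
    AntitoneOn f (Icc a b) := by
  refine antitoneOn_of_hasDerivWithinAt_nonpos (f' := f') (convex_Icc a b) hc ?_ ?_
  · intro x hx
    rw [interior_Icc] at hx ⊢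
    exact (hf x hx).hasDerivWithinAt
  · intro x hx
    rw [interior_Icc] at hx
    exact hn x hx

theorem abs_rpow_add_one {q : ℝ} (hq : 1 < q) (x : ℝ) : |x| ^ (q + 1) = x * oddPow q x := by
  unfold oddPow
  rcases eq_or_ne x 0 with rfl | hx
  · simp [Real.zero_rpow (by linarith : q + 1 ≠ 0)]
  · have : |x| ^ (q + 1) = |x| ^ (q - 1) * |x| ^ (2 : ℝ) := by
      rw [← Real.rpow_add (abs_pos.2 hx)]; congr 1; ring
    rw [this, Real.rpow_two, sq_abs]; ring

theorem hasDerivAt_potential {q : ℝ} (hq : 1 < q) (x : ℝ) :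
    HasDerivAt (potential q) (oddPow q x - x) x := by
  have h1 := ((hasDerivAt_abs_rpow x (p := q + 1) (by linarith)).div_const (q + 1)).sub
    (((hasDerivAt_id x).pow 2).div_const 2)
  refine h1.congr_deriv ?_
  have : q + 1 - 2 = q - 1 := by ring
  have h2 : q + 1 ≠ 0 := by linarith
  simp only [oddPow, this, id]
  field_simp
  simp
  ring

theorem hasDerivAt_oddPow {q : ℝ} (hq : 1 < q) (x : ℝ) :
    HasDerivAt (oddPow q) (q * |x| ^ (q - 1)) x := by
  rcases lt_trichotomy x 0 with hx | rfl | hx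
  · have h1 : HasDerivAt (fun y : ℝ => -((-y) ^ q)) (q * |x| ^ (q - 1)) x := by
      have := (((Real.hasDerivAt_rpow_const (x := -x) (p := q) (Or.inr hq.le))).comp x
        (hasDerivAt_neg x)).neg
      refine this.congr_deriv ?_
      rw [abs_of_neg hx]; ring
    refine h1.congr_of_eventuallyEq ?_
    filter_upwards [Iio_mem_nhds hx] with y (hy : y < 0)
    unfold oddPow
    rw [abs_of_neg hy, Real.rpow_sub_one (by linarith)]
    have : y ≠ 0 := hy.ne
    field_simp
  · rw [hasDerivAt_iff_tendsto_slope]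
    have h1 : ContinuousAt (fun y : ℝ => |y| ^ (q - 1)) 0 :=
      continuous_abs.continuousAt.rpow_const (Or.inr (by linarith))
    have h2 := h1.tendsto.mono_left (nhdsWithin_le_nhds (s := {0}ᶜ))
    have h3 : q - 1 ≠ 0 := by linarith
    simp only [abs_zero, Real.zero_rpow h3, mul_zero] at h2 ⊢
    refine h2.congr' ?_
    filter_upwards [self_mem_nhdsWithin] with y hy
    have : y ≠ 0 := hy
    simp [slope_def_field, oddPow, this]
  · have h1 : HasDerivAt (fun y : ℝ => y ^ q) (q * |x| ^ (q - 1)) x := by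
      rw [abs_of_pos hx]
      exact Real.hasDerivAt_rpow_const (Or.inr hq.le)
    refine h1.congr_of_eventuallyEq ?_
    filter_upwards [Ioi_mem_nhds hx] with y (hy : 0 < y)
    unfold oddPow
    rw [abs_of_pos hy, Real.rpow_sub_one (by linarith)]
    field_simp

theorem abs_oddPow_sub_le {q : ℝ} (hq : 1 < q) {B x y : ℝ} (hx : |x| ≤ B) (hy : |y| ≤ B) :
    |oddPow q x - oddPow q y| ≤ q * B ^ (q - 1) * |x - y| := by
  have := Convex.norm_image_sub_le_of_norm_hasDerivWithin_le (𝕜 := ℝ) (f := oddPow q)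
    (f' := fun x => q * |x| ^ (q - 1)) (s := Icc (-B) B) (x := y) (y := x) (C := q * B ^ (q - 1))
    (fun z _ => (hasDerivAt_oddPow hq z).hasDerivWithinAt) ?_ (convex_Icc _ _)
    (abs_le.1 hy) (abs_le.1 hx)
  · simpa using this
  · intro z hz
    have hz' : |z| ≤ B := abs_le.2 hz
    rw [Real.norm_of_nonneg (by positivity)]
    gcongr

theorem oddPow_one (q : ℝ) : oddPow q 1 = 1 := by simp [oddPow]

theorem oddPow_zero (q : ℝ) : oddPow q 0 = 0 := by simp [oddPow]

theorem oddPow_lt_self {q : ℝ} (hq : 1 < q) {x : ℝ} (h0 : 0 < x) (h1 : x < 1) :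
    oddPow q x < x := by
  have : |x| ^ (q - 1) < 1 := by
    rw [abs_of_pos h0]; exact Real.rpow_lt_one h0.le h1 (by linarith)
  unfold oddPow
  nlinarith

theorem lt_oddPow_self {q : ℝ} (hq : 1 < q) {x : ℝ} (h1 : 1 < x) : x < oddPow q x := by
  have : 1 < |x| ^ (q - 1) := by
    rw [abs_of_pos (by linarith)]; exact Real.one_lt_rpow h1 (by linarith)
  unfold oddPow
  nlinarith

theorem potential_neg {q : ℝ} (hq : 1 < q) {x : ℝ} (h0 : 0 < x) (h1 : x ≤ 1) :
    potential q x < 0 := by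
  have h2 : |x| ^ (q - 1) ≤ 1 := by
    rw [abs_of_pos h0]; exact Real.rpow_le_one h0.le h1 (by linarith)
  have h3 : |x| ^ (q + 1) ≤ x ^ 2 := by
    rw [abs_rpow_add_one hq]; unfold oddPow; nlinarith [sq_nonneg x]
  have h4 : |x| ^ (q + 1) / (q + 1) ≤ x ^ 2 / (q + 1) := by gcongr
  have h5 : x ^ 2 / (q + 1) < x ^ 2 / 2 := by
    apply div_lt_div_of_pos_left <;> first | positivity | linarith
  unfold potential
  linarith

/-- A superquadratic power dominates a square, up to a constant. -/
theorem exists_sq_le_mul_rpow_add {q η : ℝ} (hq : 1 < q) (hη : 0 < η) :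
    ∃ C : ℝ, 0 ≤ C ∧ ∀ x : ℝ, x ^ 2 ≤ η * |x| ^ (q + 1) + C := by
  set m : ℝ := (1 / η) ^ (1 / (q - 1)) with hm
  have hm0 : 0 < m := by positivity
  refine ⟨m ^ 2, by positivity, fun x => ?_⟩
  rcases le_or_gt |x| m with hx | hx
  · have : x ^ 2 ≤ m ^ 2 := by rw [← sq_abs]; gcongr
    have : 0 ≤ η * |x| ^ (q + 1) := by positivity
    linarith
  · have h1 : m ^ (q - 1) ≤ |x| ^ (q - 1) := by gcongr
    have h2 : m ^ (q - 1) = 1 / η := by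
      rw [hm, ← Real.rpow_mul (by positivity), one_div_mul_cancel (by linarith), Real.rpow_one]
    have h3 : 1 ≤ η * |x| ^ (q - 1) := by
      calc 1 = η * (1 / η) := by field_simp
        _ ≤ _ := by rw [← h2]; gcongr
    have h4 : η * |x| ^ (q + 1) = η * |x| ^ (q - 1) * x ^ 2 := by
      rw [abs_rpow_add_one hq]; unfold oddPow; ring
    nlinarith [sq_nonneg x, sq_nonneg m]

theorem exists_potential_lower_bound {q : ℝ} (hq : 1 < q) :
    ∃ C : ℝ, 0 ≤ C ∧ ∀ x : ℝ, x ^ 2 / 2 - C ≤ potential q x := by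
  obtain ⟨C, hC, h⟩ := exists_sq_le_mul_rpow_add hq (η := 1 / (q + 1)) (by positivity)
  refine ⟨C, hC, fun x => ?_⟩
  have := h x
  unfold potential
  rw [one_div_mul_eq_div] at this
  linarith

namespace IsShot

variable {h : ℝ → ℝ} {lam q T α : ℝ} {u v : ℝ → ℝ}

theorem continuousOn (hs : IsShot h lam q T α u v) : ContinuousOn u (Icc 0 T) :=
  fun t ht => (hs.hasDeriv t ht).continuousWithinAt

theorem hasDerivAt (hs : IsShot h lam q T α u v) {t : ℝ} (ht : t ∈ Ioo 0 T) :
    HasDerivAt u (v t) t :=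
  (hs.hasDeriv t (Ioo_subset_Icc_self ht)).hasDerivAt (Icc_mem_nhds ht.1 ht.2)

theorem hasDerivAt_deriv (hs : IsShot h lam q T α u v) {t : ℝ} (ht : t ∈ Ioo 0 T) :
    HasDerivAt v (-(h t * v t) - lam * (oddPow q (u t) - u t)) t :=
  (hs.ode t (Ioo_subset_Ioc_self ht)).hasDerivAt (Ioc_mem_nhds ht.1 ht.2)

theorem hasDerivAt_energy (hs : IsShot h lam q T α u v) (hq : 1 < q) {t : ℝ}
    (ht : t ∈ Ioo 0 T) :
    HasDerivAt (fun t => energy lam q (u t) (v t)) (-(h t * v t ^ 2)) t := by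
  have h1 := (((hs.hasDerivAt_deriv ht).pow 2).div_const 2).add
    (((hasDerivAt_potential hq (u t)).comp t (hs.hasDerivAt ht)).const_mul lam)
  refine h1.congr_deriv ?_
  simp
  ring

theorem continuousOn_energy (hs : IsShot h lam q T α u v) (hq : 1 < q) :
    ContinuousOn (fun t => energy lam q (u t) (v t)) (Icc 0 T) := by
  have h1 : Continuous (potential q) :=
    continuous_iff_continuousAt.2 fun x => (hasDerivAt_potential hq x).continuousAt
  unfold energy
  exact ((hs.cont.pow 2).div_const 2).add ((h1.comp_continuousOn hs.continuousOn).const_smul lam)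

theorem antitoneOn_energy (hs : IsShot h lam q T α u v) (hq : 1 < q)
    (hh : ∀ t ∈ Ioo 0 T, 0 < h t) :
    AntitoneOn (fun t => energy lam q (u t) (v t)) (Icc 0 T) := by
  refine antitoneOn_Icc_of_hasDerivAt (hs.continuousOn_energy hq)
    (fun t ht => hs.hasDerivAt_energy hq ht) fun t ht => ?_
  have := hh t ht
  have : 0 ≤ h t * v t ^ 2 := by positivity
  linarith

theorem abs_le_of_lower_bound (hs : IsShot h lam q T α u v) (hq : 1 < q) (hlam : 0 < lam)
    (hh : ∀ t ∈ Ioo 0 T, 0 < h t) {C : ℝ} (hC : ∀ x : ℝ, x ^ 2 / 2 - C ≤ potential q x)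
    {t : ℝ} (ht : t ∈ Icc 0 T) :
    v t ^ 2 ≤ 2 * lam * (potential q α + C) ∧ u t ^ 2 ≤ 2 * (potential q α + C) := by
  have h1 := hs.antitoneOn_energy hq hh ⟨le_rfl, ht.1.trans ht.2⟩ ht ht.1
  simp only [energy, hs.init, hs.init_deriv] at h1
  have h2 := hC (u t)
  have h3 : lam * (u t ^ 2 / 2 - C) ≤ lam * potential q (u t) := by gcongr
  have h4 : 0 ≤ lam * (u t ^ 2 / 2) := by positivity
  constructor
  · nlinarith
  · have : lam * (u t ^ 2 / 2) ≤ lam * (potential q α + C) := by nlinarith [sq_nonneg (v t)]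
    have := le_of_mul_le_mul_left this hlam
    linarith

/-- Shots with bounded heights stay uniformly bounded. -/
theorem exists_bound (h : ℝ → ℝ) {lam q T : ℝ} (hq : 1 < q) (hlam : 0 < lam)
    (hh : ∀ t ∈ Ioo 0 T, 0 < h t) (R : ℝ) :
    ∃ B : ℝ, 0 ≤ B ∧ ∀ α u v, |α| ≤ R → IsShot h lam q T α u v → ∀ t ∈ Icc 0 T, |u t| ≤ B := by
  obtain ⟨C, hC0, hC⟩ := exists_potential_lower_bound hq
  set M := R ^ (q + 1) / (q + 1) + C
  refine ⟨Real.sqrt (2 * M), Real.sqrt_nonneg _, fun α u v hα hs t ht => ?_⟩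
  apply Real.abs_le_sqrt
  refine (hs.abs_le_of_lower_bound hq hlam hh hC ht).2.trans ?_
  have : |α| ^ (q + 1) / (q + 1) ≤ R ^ (q + 1) / (q + 1) := by
    gcongr
  have : potential q α ≤ R ^ (q + 1) / (q + 1) := by
    unfold potential
    nlinarith [sq_nonneg α]
  simp only [M]
  linarith

/-- Shots depend Lipschitz continuously on their height, up to the singular endpoint. -/
theorem exists_lipschitz (h : ℝ → ℝ) {lam q T : ℝ} (hq : 1 < q) (hlam : 0 < lam)
    (hh : ∀ t ∈ Ioo 0 T, 0 < h t) (R : ℝ) :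
    ∃ K : ℝ, 0 < K ∧ ∀ α β u v u₂ v₂, |α| ≤ R → |β| ≤ R → IsShot h lam q T α u v →
      IsShot h lam q T β u₂ v₂ → ∀ t ∈ Icc 0 T,
        |u t - u₂ t| ≤ K * |α - β| ∧ |v t - v₂ t| ≤ K * |α - β| := by
  obtain ⟨B, hB0, hB⟩ := exists_bound h hq hlam hh R
  set L := 1 + lam * (q * B ^ (q - 1) + 1) with hL
  have hL0 : 0 < L := by positivity
  refine ⟨Real.exp (L * T), Real.exp_pos _, fun α β u v u₂ v₂ hα hβ h₁ h₂ t ht => ?_⟩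
  set V : ℝ → ℝ := fun t => Real.exp (-(2 * L) * t) * ((u t - u₂ t) ^ 2 + (v t - v₂ t) ^ 2) with hV
  have hanti : AntitoneOn V (Icc 0 T) := by
    refine antitoneOn_Icc_of_hasDerivAt (f' := fun t => Real.exp (-(2 * L) * t) *
      (-(2 * L) * ((u t - u₂ t) ^ 2 + (v t - v₂ t) ^ 2) + 2 * (u t - u₂ t) * (v t - v₂ t) +
        2 * (v t - v₂ t) * (-(h t * (v t - v₂ t)) - lam * (oddPow q (u t) - oddPow q (u₂ t)
          - (u t - u₂ t))))) ?_ ?_ ?_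
    · exact ContinuousOn.mul (by fun_prop) (((h₁.continuousOn.sub h₂.continuousOn).pow 2).add
        ((h₁.cont.sub h₂.cont).pow 2))
    · intro t ht
      have e1 : HasDerivAt (fun t => Real.exp (-(2 * L) * t))
          (Real.exp (-(2 * L) * t) * (-(2 * L))) t := by
        simpa using ((hasDerivAt_id t).const_mul (-(2 * L))).exp
      have e2 := ((h₁.hasDerivAt ht).sub (h₂.hasDerivAt ht)).pow 2
      have e3 := ((h₁.hasDerivAt_deriv ht).sub (h₂.hasDerivAt_deriv ht)).pow 2
      refine (e1.mul (e2.add e3)).congr_deriv ?_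
      simp
      ring
    · intro t ht
      have ht' := Ioo_subset_Icc_self ht
      refine mul_nonpos_of_nonneg_of_nonpos (Real.exp_pos _).le ?_
      have hLip := abs_oddPow_sub_le hq (hB _ _ _ hα h₁ t ht') (hB _ _ _ hβ h₂ t ht')
      set w := u t - u₂ t
      set z := v t - v₂ t
      set g := oddPow q (u t) - oddPow q (u₂ t)
      have p1 : 0 ≤ h t * z ^ 2 := mul_nonneg (hh t ht).le (sq_nonneg _)
      have p2 : |g - w| ≤ (q * B ^ (q - 1) + 1) * |w| := by
        calc |g - w| ≤ |g| + |w| := abs_sub _ _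
          _ ≤ _ := by linarith
      have p3 : -(lam * (z * (g - w))) ≤ lam * ((q * B ^ (q - 1) + 1) * (|w| * |z|)) := by
        have : -(z * (g - w)) ≤ (q * B ^ (q - 1) + 1) * (|w| * |z|) := by
          calc -(z * (g - w)) ≤ |z * (g - w)| := neg_le_abs _
            _ = |z| * |g - w| := abs_mul _ _
            _ ≤ |z| * ((q * B ^ (q - 1) + 1) * |w|) := by gcongr
            _ = _ := by ring
        calc -(lam * (z * (g - w))) = lam * -(z * (g - w)) := by ring
          _ ≤ _ := by gcongr
      have p4 : w * z ≤ |w| * |z| := by rw [← abs_mul]; exact le_abs_self _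
      have p5 : 2 * (|w| * |z|) ≤ w ^ 2 + z ^ 2 := by
        rw [← sq_abs w, ← sq_abs z]; nlinarith [sq_nonneg (|w| - |z|)]
      have p6 : L * (2 * (|w| * |z|)) ≤ L * (w ^ 2 + z ^ 2) := by gcongr
      have p7 : 0 ≤ L * (w ^ 2 + z ^ 2) := by positivity
      have p8 : L * (|w| * |z|) = |w| * |z| + lam * ((q * B ^ (q - 1) + 1) * (|w| * |z|)) := by
        rw [hL]; ring
      nlinarith
  have h0 := hanti ⟨le_rfl, ht.1.trans ht.2⟩ ht ht.1
  simp only [hV, h₁.init, h₂.init, h₁.init_deriv, h₂.init_deriv] at h0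
  have h1 : (u t - u₂ t) ^ 2 + (v t - v₂ t) ^ 2 ≤ (Real.exp (L * T) * |α - β|) ^ 2 := by
    have e0 : Real.exp (2 * L * t) ≤ Real.exp (2 * L * T) := by
      gcongr; exact ht.2
    have e1 : Real.exp (L * T) ^ 2 = Real.exp (2 * L * T) := by
      rw [← Real.exp_nat_mul]; congr 1; push_cast; ring
    have e2 : Real.exp (2 * L * t) * Real.exp (-(2 * L) * t) = 1 := by
      rw [← Real.exp_add]; simp
    rw [mul_pow, e1, sq_abs]
    calc (u t - u₂ t) ^ 2 + (v t - v₂ t) ^ 2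
        = Real.exp (2 * L * t) *
          (Real.exp (-(2 * L) * t) * ((u t - u₂ t) ^ 2 + (v t - v₂ t) ^ 2)) := by
            rw [← mul_assoc, e2, one_mul]
      _ ≤ Real.exp (2 * L * t) * (α - β) ^ 2 := by
            gcongr; simpa using h0
      _ ≤ _ := by gcongr
  constructor
  · exact abs_le_of_sq_le_sq (by nlinarith [sq_nonneg (v t - v₂ t)]) (by positivity)
  · exact abs_le_of_sq_le_sq (by nlinarith [sq_nonneg (u t - u₂ t)]) (by positivity)

/-- A shot that rests at an equilibrium at some positive time started there. -/
theorem height_eq_of_rest (hs : IsShot h lam q T α u v) (hq : 1 < q) (hlam : 0 < lam)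
    (hc : ContinuousOn h (Ioc 0 T)) {c : ℝ} (hc0 : oddPow q c = c) {τ : ℝ} (hτ : τ ∈ Ioc 0 T)
    (hu : u τ = c) (hv : v τ = 0) : α = c := by
  have key : ∀ ε ∈ Ioo 0 τ, u ε = c := by
    intro ε hε
    have hsub : Icc ε τ ⊆ Icc 0 T := Icc_subset_Icc hε.1.le hτ.2
    obtain ⟨H, hH⟩ := isCompact_Icc.exists_bound_of_continuousOn
      (hc.mono (fun t ht => ⟨hε.1.trans_le ht.1, ht.2.trans hτ.2⟩ : Icc ε τ ⊆ Ioc 0 T))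
    obtain ⟨B, hB⟩ := isCompact_Icc.exists_bound_of_continuousOn
      (hs.continuousOn.mono hsub)
    set B' := max B |c|
    have hB'0 : 0 ≤ B' := (abs_nonneg c).trans (le_max_right _ _)
    have hH0 : 0 ≤ H := (norm_nonneg _).trans (hH ε ⟨le_rfl, hε.2.le⟩)
    set L := 1 + H + lam * (q * B' ^ (q - 1) + 1) with hL
    have hL0 : 0 < L := by positivity
    have hmono : MonotoneOn (fun t => Real.exp (2 * L * t) * ((u t - c) ^ 2 + v t ^ 2))
        (Icc ε τ) := by
      refine monotoneOn_Icc_of_hasDerivAt (f' := fun t => Real.exp (2 * L * t) *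
        (2 * L * ((u t - c) ^ 2 + v t ^ 2) + 2 * (u t - c) * v t +
          2 * v t * (-(h t * v t) - lam * (oddPow q (u t) - u t)))) ?_ ?_ ?_
      · exact ContinuousOn.mul (by fun_prop) ((((hs.continuousOn.mono hsub).sub
          continuousOn_const).pow 2).add ((hs.cont.mono hsub).pow 2))
      · intro t ht
        have ht' : t ∈ Ioo 0 T := ⟨hε.1.trans ht.1, ht.2.trans_le hτ.2⟩
        have e1 : HasDerivAt (fun t => Real.exp (2 * L * t))
            (Real.exp (2 * L * t) * (2 * L)) t := by
          simpa using ((hasDerivAt_id t).const_mul (2 * L)).exp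
        have e2 := ((hs.hasDerivAt ht').sub_const c).pow 2
        have e3 := (hs.hasDerivAt_deriv ht').pow 2
        refine (e1.mul (e2.add e3)).congr_deriv ?_
        simp
        ring
      · intro t ht
        have ht' := Ioo_subset_Icc_self ht
        refine mul_nonneg (Real.exp_pos _).le ?_
        have hLip := abs_oddPow_sub_le hq ((hB t ht').trans (le_max_left B |c|))
          (le_max_right B |c|)
        rw [hc0] at hLip
        have hHt : h t ≤ H := (le_abs_self _).trans (hH t ht')
        have hsplit : oddPow q (u t) - u t = oddPow q (u t) - c - (u t - c) := by ring
        rw [hsplit]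
        set w := u t - c
        set z := v t
        set g := oddPow q (u t) - c
        have p1 : h t * z ^ 2 ≤ H * z ^ 2 := by gcongr
        have p2 : |g - w| ≤ (q * B' ^ (q - 1) + 1) * |w| := by
          calc |g - w| ≤ |g| + |w| := abs_sub _ _
            _ ≤ _ := by linarith
        have p3 : lam * (z * (g - w)) ≤ lam * ((q * B' ^ (q - 1) + 1) * (|w| * |z|)) := by
          have : z * (g - w) ≤ (q * B' ^ (q - 1) + 1) * (|w| * |z|) := by
            calc z * (g - w) ≤ |z * (g - w)| := le_abs_self _
              _ = |z| * |g - w| := abs_mul _ _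
              _ ≤ |z| * ((q * B' ^ (q - 1) + 1) * |w|) := by gcongr
              _ = _ := by ring
          gcongr
        have p4 : -(w * z) ≤ |w| * |z| := by rw [← abs_mul]; exact neg_le_abs _
        have p5 : 2 * (|w| * |z|) ≤ w ^ 2 + z ^ 2 := by
          rw [← sq_abs w, ← sq_abs z]; nlinarith [sq_nonneg (|w| - |z|)]
        have p6 : (L - H) * (2 * (|w| * |z|)) ≤ (L - H) * (w ^ 2 + z ^ 2) := by
          gcongr
          rw [hL]
          have : 0 ≤ lam * (q * B' ^ (q - 1) + 1) := by positivity
          linarith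
        have p7 : H * (w ^ 2 + z ^ 2) ≤ L * (w ^ 2 + z ^ 2) := by
          gcongr
          rw [hL]
          have : 0 ≤ lam * (q * B' ^ (q - 1) + 1) := by positivity
          linarith
        have p8 : (L - H) * (|w| * |z|) =
            |w| * |z| + lam * ((q * B' ^ (q - 1) + 1) * (|w| * |z|)) := by
          rw [hL]; ring
        have p9 : 0 ≤ H * w ^ 2 := by positivity
        nlinarith
    have h0 := hmono ⟨le_rfl, hε.2.le⟩ ⟨hε.2.le, le_rfl⟩ hε.2.le
    simp only [hu, hv, sub_self] at h0
    have h1 : (u ε - c) ^ 2 + v ε ^ 2 ≤ 0 := by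
      by_contra! hcon
      have := mul_pos (Real.exp_pos (2 * L * ε)) hcon
      norm_num at h0
      linarith
    have h2 : (u ε - c) ^ 2 = 0 := le_antisymm (by nlinarith [sq_nonneg (v ε)]) (sq_nonneg _)
    have := pow_eq_zero_iff (two_ne_zero) |>.1 h2
    linarith
  have h1 : Tendsto u (nhdsWithin 0 (Ioo 0 τ)) (nhds (u 0)) :=
    (hs.continuousOn 0 ⟨le_rfl, (hτ.1.trans_le hτ.2).le⟩).mono
      (fun t ht => ⟨ht.1.le, ht.2.le.trans hτ.2⟩)
  have h2 : Tendsto u (nhdsWithin 0 (Ioo 0 τ)) (nhds c) :=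
    tendsto_const_nhds.congr' (by
      filter_upwards [self_mem_nhdsWithin] with t ht using (key t ht).symm)
  have : (nhdsWithin (0 : ℝ) (Ioo 0 τ)).NeBot := by
    rw [← mem_closure_iff_nhdsWithin_neBot, closure_Ioo hτ.1.ne]
    exact ⟨le_rfl, hτ.1.le⟩
  rw [← hs.init]
  exact tendsto_nhds_unique h1 h2

end IsShot

/-- The integrating factor of the damping term. -/
theorem exists_weight {h : ℝ → ℝ} {d T : ℝ} (hc : ContinuousOn h (Ioo 0 d)) (hT : T ∈ Ioo 0 d) :
    ∃ p : ℝ → ℝ, ∀ t ∈ Ioo 0 d, 0 < p t ∧ HasDerivAt p (h t * p t) t := by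
  refine ⟨fun t => Real.exp (∫ s in T..t, h s), fun t ht => ⟨Real.exp_pos _, ?_⟩⟩
  have hsub : uIcc T t ⊆ Ioo 0 d := ordConnected_Ioo.uIcc_subset hT ht
  have h1 : HasDerivAt (fun t => ∫ s in T..t, h s) (h t) t :=
    intervalIntegral.integral_hasDerivAt_right (hc.mono hsub).intervalIntegrable
      (hc.stronglyMeasurableAtFilter isOpen_Ioo t ht) (hc.continuousAt (Ioo_mem_nhds ht.1 ht.2))
  exact h1.exp.congr_deriv (mul_comm _ _)

theorem weight_le {h p : ℝ → ℝ} {T : ℝ} (hh : ∀ t ∈ Ioo 0 T, 0 < h t)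
    (hp : ∀ t ∈ Ioc 0 T, 0 < p t ∧ HasDerivAt p (h t * p t) t) {s t : ℝ} (hs : 0 < s)
    (hst : s ≤ t) (ht : t ≤ T) : p s ≤ p t := by
  have : MonotoneOn p (Icc s t) := by
    refine monotoneOn_Icc_of_hasDerivAt (f' := fun t => h t * p t) ?_ ?_ ?_
    · exact fun x hx => (hp x ⟨hs.trans_le hx.1, hx.2.trans ht⟩).2.continuousAt.continuousWithinAt
    · exact fun x hx => (hp x ⟨hs.trans hx.1, hx.2.le.trans ht⟩).2
    · exact fun x hx => (mul_pos (hh x ⟨hs.trans hx.1, hx.2.trans_le ht⟩)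
        (hp x ⟨hs.trans hx.1, hx.2.le.trans ht⟩).1).le
  exact this ⟨le_rfl, hst⟩ ⟨hst, le_rfl⟩ hst

theorem weight_lower_bound {h p : ℝ → ℝ} {δ κ : ℝ}
    (hp : ∀ t ∈ Ioc 0 δ, 0 < p t ∧ HasDerivAt p (h t * p t) t)
    (hκ : ∀ t ∈ Ioc 0 δ, t * h t ≤ κ) {t : ℝ} (ht : t ∈ Ioc 0 δ) :
    p δ * δ ^ (-κ) * t ^ κ ≤ p t := by
  have hanti : AntitoneOn (fun t => p t * t ^ (-κ)) (Icc t δ) := by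
    have hd : ∀ x ∈ Icc t δ, HasDerivAt (fun t => p t * t ^ (-κ))
        (h x * p x * x ^ (-κ) + p x * (-κ * x ^ (-κ - 1))) x := fun x hx =>
      (hp x ⟨ht.1.trans_le hx.1, hx.2⟩).2.mul
        (Real.hasDerivAt_rpow_const (Or.inl (ht.1.trans_le hx.1).ne'))
    refine antitoneOn_Icc_of_hasDerivAt
      (fun x hx => (hd x hx).continuousAt.continuousWithinAt)
      (fun x hx => hd x (Ioo_subset_Icc_self hx)) fun x hx => ?_
    have hx0 : 0 < x := ht.1.trans hx.1
    have hxm : x ∈ Ioc 0 δ := ⟨hx0, hx.2.le⟩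
    have e : h x * p x * x ^ (-κ) + p x * (-κ * x ^ (-κ - 1)) =
        p x * x ^ (-κ - 1) * (x * h x - κ) := by
      rw [Real.rpow_sub_one hx0.ne']; field_simp; ring
    rw [e]
    have := (hp x hxm).1
    exact mul_nonpos_of_nonneg_of_nonpos (by positivity) (by linarith [hκ x hxm])
  have h1 := hanti ⟨le_rfl, ht.2⟩ ⟨ht.2, le_rfl⟩ ht.2
  simp only at h1
  have ht0 := ht.1
  calc p δ * δ ^ (-κ) * t ^ κ ≤ p t * t ^ (-κ) * t ^ κ := by gcongr
    _ = p t := by rw [mul_assoc, ← Real.rpow_add ht0]; simp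

/-- The Pohozaev-type inequality for the dilation identity at effective dimension near `k + 1`. -/
theorem pohozaev_density_lower_bound {lam q k ε s x y : ℝ} (hq : 1 < q) (hlam : 0 < lam)
    (h1 : k - ε ≤ s) (h2 : s ≤ k + ε) :
    lam * (((1 + k - ε) / (q + 1) - (k - 1 + ε) / 2) * |x| ^ (q + 1) - x ^ 2) ≤
      y ^ 2 * ((1 - s) / 2 + (k - 1 + ε) / 2) +
        lam * ((1 + s) * potential q x - (k - 1 + ε) / 2 * (x * oddPow q x - x ^ 2)) := by
  have e : y ^ 2 * ((1 - s) / 2 + (k - 1 + ε) / 2) +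
        lam * ((1 + s) * potential q x - (k - 1 + ε) / 2 * (x * oddPow q x - x ^ 2)) =
      y ^ 2 * ((k + ε - s) / 2) + lam * (((1 + s) / (q + 1) - (k - 1 + ε) / 2) * |x| ^ (q + 1)
        - x ^ 2 * ((s - k - ε) / 2 + 1)) := by
    rw [← abs_rpow_add_one hq]
    unfold potential
    field_simp
    ring
  rw [e]
  have p1 : 0 ≤ y ^ 2 * ((k + ε - s) / 2) := mul_nonneg (sq_nonneg _) (by linarith)
  have p2 : ((1 + k - ε) / (q + 1) - (k - 1 + ε) / 2) * |x| ^ (q + 1) ≤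
      ((1 + s) / (q + 1) - (k - 1 + ε) / 2) * |x| ^ (q + 1) := by
    gcongr ?_ * _
    gcongr ?_ / _ - _
    linarith
  have p3 : x ^ 2 * ((s - k - ε) / 2 + 1) ≤ x ^ 2 := by nlinarith [sq_nonneg x]
  have : lam * (((1 + k - ε) / (q + 1) - (k - 1 + ε) / 2) * |x| ^ (q + 1) - x ^ 2) ≤
      lam * (((1 + s) / (q + 1) - (k - 1 + ε) / 2) * |x| ^ (q + 1)
        - x ^ 2 * ((s - k - ε) / 2 + 1)) := by
    gcongr
  linarith

namespace IsShot

variable {h p : ℝ → ℝ} {lam q T α : ℝ} {u v : ℝ → ℝ}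

/-- A shot with positive slope somewhere has descended to height `1` before. -/
theorem exists_le_one (hs : IsShot h lam q T α u v) (hq : 1 < q) (hlam : 0 < lam)
    (hh : ∀ t ∈ Ioo 0 T, 0 < h t)
    (hp : ∀ t ∈ Ioc 0 T, 0 < p t ∧ HasDerivAt p (h t * p t) t) {s : ℝ} (hsT : s ∈ Icc 0 T)
    (hv : 0 < v s) : ∃ t ∈ Icc 0 s, u t ≤ 1 := by
  by_contra! hcon
  have hs0 : 0 < s := by
    rcases hsT.1.eq_or_lt with h0 | h0
    · rw [← h0, hs.init_deriv] at hv; exact absurd hv (lt_irrefl _)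
    · exact h0
  have key : ∀ t ∈ Ioo 0 s, v s ≤ v t := by
    intro t ht
    have hsub : Icc t s ⊆ Icc 0 T := Icc_subset_Icc ht.1.le hsT.2
    have hanti : AntitoneOn (fun t => p t * v t) (Icc t s) := by
      refine antitoneOn_Icc_of_hasDerivAt (f' := fun t => h t * p t * v t + p t *
        (-(h t * v t) - lam * (oddPow q (u t) - u t))) ?_ ?_ ?_
      · exact ContinuousOn.mul (fun x hx => (hp x ⟨ht.1.trans_le hx.1,
          hx.2.trans hsT.2⟩).2.continuousAt.continuousWithinAt) (hs.cont.mono hsub)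
      · exact fun x hx => (hp x ⟨ht.1.trans hx.1, hx.2.le.trans hsT.2⟩).2.mul
          (hs.hasDerivAt_deriv ⟨ht.1.trans hx.1, hx.2.trans_le hsT.2⟩)
      · intro x hx
        have hx1 := lt_oddPow_self hq (hcon x ⟨(ht.1.trans hx.1).le, hx.2.le⟩)
        have hx2 := (hp x ⟨ht.1.trans hx.1, hx.2.le.trans hsT.2⟩).1
        have : 0 ≤ p x * (lam * (oddPow q (u x) - u x)) :=
          mul_nonneg hx2.le (mul_nonneg hlam.le (by linarith))
        linarith
    have h1 := hanti ⟨le_rfl, ht.2.le⟩ ⟨ht.2.le, le_rfl⟩ ht.2.le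
    have h2 := weight_le hh hp ht.1 ht.2.le hsT.2
    have h3 := (hp t ⟨ht.1, ht.2.le.trans hsT.2⟩).1
    simp only at h1
    have h4 : p t * v s ≤ p t * v t := by nlinarith
    exact le_of_mul_le_mul_left h4 h3
  have h1 : Tendsto v (nhdsWithin 0 (Ioo 0 s)) (nhds (v 0)) :=
    (hs.cont 0 ⟨le_rfl, hsT.1.trans hsT.2⟩).mono fun t ht => ⟨ht.1.le, ht.2.le.trans hsT.2⟩
  have : (nhdsWithin (0 : ℝ) (Ioo 0 s)).NeBot := by
    rw [← mem_closure_iff_nhdsWithin_neBot, closure_Ioo hs0.ne]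
    exact ⟨le_rfl, hs0.le⟩
  have h2 : v s ≤ v 0 := ge_of_tendsto h1 (by
    filter_upwards [self_mem_nhdsWithin] with t ht using key t ht)
  rw [hs.init_deriv] at h2
  linarith

theorem hasDerivAt_pohozaev (hs : IsShot h lam q T α u v) (hq : 1 < q) (c : ℝ) {t : ℝ}
    (ht : t ∈ Ioo 0 T) (hp : HasDerivAt p (h t * p t) t) :
    HasDerivAt (fun t => p t * (t * energy lam q (u t) (v t) + c * (u t * v t)))
      (p t * (v t ^ 2 * ((1 - t * h t) / 2 + c) + lam * ((1 + t * h t) * potential q (u t) -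
        c * (u t * oddPow q (u t) - u t ^ 2)))) t := by
  have h1 := hp.mul (((hasDerivAt_id t).mul (hs.hasDerivAt_energy hq ht)).add
    (((hs.hasDerivAt ht).mul (hs.hasDerivAt_deriv ht)).const_mul c))
  refine h1.congr_deriv ?_
  simp only [energy, id, Pi.add_apply, Pi.mul_apply]
  ring

/-- A tall shot stays above half its height on an interval of the natural scaling length. -/
theorem half_le (hs : IsShot h lam q T α u v) (hq : 1 < q) (hlam : 0 < lam)
    (hh : ∀ t ∈ Ioo 0 T, 0 < h t) {C : ℝ} (hC0 : 0 ≤ C)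
    (hC : ∀ x : ℝ, x ^ 2 / 2 - C ≤ potential q x) (hα : 1 ≤ α) {t : ℝ} (ht : t ∈ Icc 0 T)
    (htr : t ≤ α ^ ((1 - q) / 2) / (2 * Real.sqrt (2 * lam * (1 + C)))) : α / 2 ≤ u t := by
  set b := Real.sqrt (2 * lam * (1 + C)) with hb
  have hb0 : 0 < b := Real.sqrt_pos.2 (by positivity)
  have hα0 : 0 < α := by linarith
  have hpot : potential q α + C ≤ (1 + C) * α ^ (q + 1) := by
    have h1 : 1 ≤ α ^ (q + 1) := Real.one_le_rpow hα (by linarith)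
    have h2 : α ^ (q + 1) / (q + 1) ≤ α ^ (q + 1) := div_le_self (by linarith) (by linarith)
    unfold potential
    rw [abs_of_pos hα0]
    nlinarith [sq_nonneg α]
  have hv : ∀ s ∈ Icc 0 T, |v s| ≤ b * α ^ ((q + 1) / 2) := by
    intro s hsT
    have e : (b * α ^ ((q + 1) / 2)) ^ 2 = 2 * lam * ((1 + C) * α ^ (q + 1)) := by
      rw [mul_pow, hb, Real.sq_sqrt (by positivity), ← Real.rpow_natCast, ← Real.rpow_mul hα0.le]
      norm_num
      ring
    refine abs_le_of_sq_le_sq ?_ (by positivity)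
    rw [e]
    refine (hs.abs_le_of_lower_bound hq hlam hh hC hsT).1.trans ?_
    gcongr
  have h1 := Convex.norm_image_sub_le_of_norm_hasDerivWithin_le (𝕜 := ℝ)
    hs.hasDeriv hv (convex_Icc 0 T) ⟨le_rfl, ht.1.trans ht.2⟩ ht
  rw [hs.init, Real.norm_eq_abs, sub_zero, Real.norm_of_nonneg ht.1] at h1
  have h2 : b * α ^ ((q + 1) / 2) * t ≤ α / 2 := by
    calc b * α ^ ((q + 1) / 2) * t
        ≤ b * α ^ ((q + 1) / 2) * (α ^ ((1 - q) / 2) / (2 * b)) := by gcongr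
      _ = α ^ ((q + 1) / 2) * α ^ ((1 - q) / 2) / 2 := by field_simp
      _ = α / 2 := by
        rw [← Real.rpow_add hα0]
        have : (q + 1) / 2 + (1 - q) / 2 = 1 := by ring
        rw [this, Real.rpow_one]
  have := (abs_le.1 h1).1
  linarith

/-- If the energy at `δ` is large, it is still positive at `T`. -/
theorem energy_pos_of_large (hs : IsShot h lam q T α u v) (hq : 1 < q) (hlam : 0 < lam)
    {C H δ : ℝ} (hC0 : 0 ≤ C) (hC : ∀ x : ℝ, x ^ 2 / 2 - C ≤ potential q x)
    (hδ : δ ∈ Ioo 0 T) (hH : ∀ t ∈ Icc δ T, h t ≤ H) (hH0 : 0 ≤ H)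
    (hE : lam * C * Real.exp (2 * H * (T - δ)) < energy lam q (u δ) (v δ)) :
    0 < energy lam q (u T) (v T) := by
  have hsub : Icc δ T ⊆ Icc 0 T := Icc_subset_Icc hδ.1.le le_rfl
  have hmono : MonotoneOn (fun t => Real.exp (2 * H * t) * (energy lam q (u t) (v t) + lam * C))
      (Icc δ T) := by
    refine monotoneOn_Icc_of_hasDerivAt (f' := fun t => Real.exp (2 * H * t) * (2 * H) *
      (energy lam q (u t) (v t) + lam * C) + Real.exp (2 * H * t) * (-(h t * v t ^ 2))) ?_ ?_ ?_
    · exact ContinuousOn.mul (by fun_prop)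
        (((hs.continuousOn_energy hq).mono hsub).add continuousOn_const)
    · intro t ht
      have e1 : HasDerivAt (fun t => Real.exp (2 * H * t))
          (Real.exp (2 * H * t) * (2 * H)) t := by
        simpa using ((hasDerivAt_id t).const_mul (2 * H)).exp
      exact e1.mul ((hs.hasDerivAt_energy hq ⟨hδ.1.trans ht.1, ht.2⟩).add_const (lam * C))
    · intro t ht
      have h1 := hH t (Ioo_subset_Icc_self ht)
      have h2 : v t ^ 2 / 2 ≤ energy lam q (u t) (v t) + lam * C := by
        have := mul_le_mul_of_nonneg_left (hC (u t)) hlam.le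
        have h3 : 0 ≤ lam * (u t ^ 2 / 2) := by positivity
        unfold energy
        linarith
      have h3 : h t * v t ^ 2 ≤ H * v t ^ 2 := by gcongr
      have h4 : H * (v t ^ 2 / 2) ≤ H * (energy lam q (u t) (v t) + lam * C) := by gcongr
      have h5 : 0 ≤ Real.exp (2 * H * t) * (2 * H * (energy lam q (u t) (v t) + lam * C)
        - h t * v t ^ 2) := mul_nonneg (Real.exp_pos _).le (by linarith)
      linarith
  have h1 := hmono ⟨le_rfl, hδ.2.le⟩ ⟨hδ.2.le, le_rfl⟩ hδ.2.le
  simp only at h1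
  have h2 : Real.exp (2 * H * T) = Real.exp (2 * H * δ) * Real.exp (2 * H * (T - δ)) := by
    rw [← Real.exp_add]; congr 1; ring
  rw [h2, mul_assoc (Real.exp (2 * H * δ))] at h1
  have h3 := le_of_mul_le_mul_left h1 (Real.exp_pos _)
  have h4 : 0 ≤ lam * C := by positivity
  have h5 := Real.exp_pos (2 * H * (T - δ))
  by_contra! hcon
  have : Real.exp (2 * H * (T - δ)) * energy lam q (u T) (v T) ≤ 0 :=
    mul_nonpos_of_nonneg_of_nonpos h5.le hcon
  nlinarith

/-- Lower bound for the Pohozaev functional of a tall shot. -/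
theorem pohozaev_lower_bound (hs : IsShot h lam q T α u v) (hq : 1 < q) (hlam : 0 < lam)
    (hh : ∀ t ∈ Ioo 0 T, 0 < h t)
    (hp : ∀ t ∈ Ioc 0 T, 0 < p t ∧ HasDerivAt p (h t * p t) t) {c η D δ r : ℝ}
    (hη : 0 < η) (hD : 0 ≤ D) (hδ : δ ∈ Ioo 0 T) (hr : r ∈ Ioo 0 δ)
    (hdens : ∀ t ∈ Ioo 0 δ, lam * (η * |u t| ^ (q + 1) - D) ≤
      v t ^ 2 * ((1 - t * h t) / 2 + c) + lam * ((1 + t * h t) * potential q (u t) -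
        c * (u t * oddPow q (u t) - u t ^ 2)))
    (hα : 0 < α) (hαD : D ≤ η / 2 * (α / 2) ^ (q + 1))
    (hu : ∀ t ∈ Icc 0 r, α / 2 ≤ u t) :
    r / 2 * (p (r / 2) * (lam * (η / 2 * (α / 2) ^ (q + 1)))) - δ * (p δ * (lam * D)) ≤
      p δ * (δ * energy lam q (u δ) (v δ) + c * (u δ * v δ)) := by
  set Q : ℝ → ℝ := fun t => p t * (t * energy lam q (u t) (v t) + c * (u t * v t)) with hQ
  set X := lam * (η / 2 * (α / 2) ^ (q + 1)) with hX
  have hX0 : 0 ≤ X := by positivity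
  have hpT : ∀ t ∈ Ioo 0 T, 0 < p t ∧ HasDerivAt p (h t * p t) t :=
    fun t ht => hp t (Ioo_subset_Ioc_self ht)
  have hdQ : ∀ t ∈ Ioo 0 T, HasDerivAt Q (p t * (v t ^ 2 * ((1 - t * h t) / 2 + c) +
      lam * ((1 + t * h t) * potential q (u t) - c * (u t * oddPow q (u t) - u t ^ 2)))) t :=
    fun t ht => hs.hasDerivAt_pohozaev hq c ht (hpT t ht).2
  have hT : ∀ {a b : ℝ}, 0 < a → b ≤ δ → ∀ t ∈ Icc a b, t ∈ Ioo 0 T := fun ha hb t ht =>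
    ⟨ha.trans_le ht.1, (ht.2.trans hb).trans_lt hδ.2⟩
  have hincr : ∀ a b m : ℝ, 0 < a → a ≤ b → b ≤ δ →
      (∀ t ∈ Ioo a b, m ≤ p t * (lam * (η * |u t| ^ (q + 1) - D))) → (b - a) * m ≤ Q b - Q a := by
    intro a b m ha hab hb hm
    have : MonotoneOn (fun t => Q t - m * t) (Icc a b) := by
      refine monotoneOn_Icc_of_hasDerivAt (f' := fun t => p t * (v t ^ 2 * ((1 - t * h t) / 2 + c) +
        lam * ((1 + t * h t) * potential q (u t) - c * (u t * oddPow q (u t) - u t ^ 2))) - m)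
        ?_ ?_ ?_
      · exact ContinuousOn.sub
          (fun t ht => (hdQ t (hT ha hb t ht)).continuousAt.continuousWithinAt) (by fun_prop)
      · intro t ht
        refine ((hdQ t (hT ha hb t (Ioo_subset_Icc_self ht))).sub
          ((hasDerivAt_id t).const_mul m)).congr_deriv ?_
        simp
      · intro t ht
        have h1 := hm t ht
        have h2 := hdens t ⟨ha.trans ht.1, ht.2.trans_le hb⟩
        have h3 := mul_le_mul_of_nonneg_left h2 (hpT t (hT ha hb t (Ioo_subset_Icc_self ht))).1.le
        linarith
    have := this ⟨le_rfl, hab⟩ ⟨hab, le_rfl⟩ hab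
    simp only at this
    linarith
  have hlow : ∀ t ∈ Icc 0 r, X ≤ lam * (η * |u t| ^ (q + 1) - D) := by
    intro t ht
    have h1 : (α / 2) ^ (q + 1) ≤ |u t| ^ (q + 1) := by
      gcongr
      exact (hu t ht).trans (le_abs_self _)
    have h2 : η * (α / 2) ^ (q + 1) ≤ η * |u t| ^ (q + 1) := by gcongr
    rw [hX]
    gcongr
    linarith
  have hr2 : 0 < r / 2 := half_pos hr.1
  have step1 : 0 ≤ Q (r / 2) := by
    have hTT : (0:ℝ) ∈ Icc 0 T := ⟨le_rfl, (hδ.1.trans hδ.2).le⟩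
    have lim1 : Tendsto (fun t => t * energy lam q (u t) (v t) + c * (u t * v t))
        (nhdsWithin 0 (Ioo 0 (r / 2))) (nhds 0) := by
      have : ContinuousWithinAt (fun t => t * energy lam q (u t) (v t) + c * (u t * v t))
          (Icc 0 T) 0 :=
        ((continuousWithinAt_id).mul (hs.continuousOn_energy hq 0 hTT)).add
          ((((hs.continuousOn 0 hTT).mul (hs.cont 0 hTT))).const_smul c)
      have := this.mono (fun t ht => ⟨ht.1.le, by linarith [ht.2, hr.2, hδ.2, hr.1]⟩ :
        Ioo 0 (r / 2) ⊆ Icc 0 T)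
      have h2 := this.tendsto
      simpa [hs.init_deriv] using h2
    have lim2 : Tendsto Q (nhdsWithin 0 (Ioo 0 (r / 2))) (nhds 0) := by
      refine squeeze_zero_norm' (a := fun t => p T *
        |t * energy lam q (u t) (v t) + c * (u t * v t)|) ?_ ?_
      · filter_upwards [self_mem_nhdsWithin] with t ht
        have h1 := weight_le hh hp ht.1 (by linarith [ht.2, hr.2, hδ.2, hr.1] : t ≤ T) le_rfl
        have h2 := (hp t ⟨ht.1, by linarith [ht.2, hr.2, hδ.2, hr.1]⟩).1
        rw [hQ, Real.norm_eq_abs, abs_mul, abs_of_pos h2]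
        gcongr
      · simpa using lim1.abs.const_mul (p T)
    have : (nhdsWithin (0 : ℝ) (Ioo 0 (r / 2))).NeBot := by
      rw [← mem_closure_iff_nhdsWithin_neBot, closure_Ioo hr2.ne]
      exact ⟨le_rfl, hr2.le⟩
    refine le_of_tendsto lim2 ?_
    filter_upwards [self_mem_nhdsWithin] with t ht
    have := hincr t (r / 2) 0 ht.1 ht.2.le (by linarith [hr.2, hr.1]) fun s hs' => by
      have h1 := hlow s ⟨(ht.1.trans hs'.1).le, by linarith [hs'.2, hr.1]⟩
      have h2 := (hp s ⟨ht.1.trans hs'.1, by linarith [hs'.2, hr.2, hδ.2, hr.1]⟩).1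
      exact mul_nonneg h2.le (hX0.trans h1)
    linarith
  have step2 : r / 2 * (p (r / 2) * X) ≤ Q r - Q (r / 2) := by
    have := hincr (r / 2) r (p (r / 2) * X) hr2 (by linarith) hr.2.le fun s hs' => by
      have h1 := hlow s ⟨(hr2.trans hs'.1).le, hs'.2.le⟩
      have h2 := weight_le hh hp hr2 hs'.1.le (by linarith [hs'.2, hr.2, hδ.2] : s ≤ T)
      have h3 := (hp (r / 2) ⟨hr2, by linarith [hr.2, hδ.2]⟩).1
      exact mul_le_mul h2 h1 hX0 (h3.le.trans h2)
    linarith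
  have step3 : -(δ * (p δ * (lam * D))) ≤ Q δ - Q r := by
    have := hincr r δ (-(p δ * (lam * D))) hr.1 hr.2.le le_rfl fun s hs' => by
      have h2 := weight_le hh hp (hr.1.trans hs'.1) hs'.2.le hδ.2.le
      have h3 := (hp s ⟨hr.1.trans hs'.1, hs'.2.le.trans hδ.2.le⟩).1
      have h4 : 0 ≤ p s * (lam * (η * |u s| ^ (q + 1))) := by positivity
      have h5 : p s * (lam * D) ≤ p δ * (lam * D) := by gcongr
      linarith
    have hpd := (hp δ ⟨hδ.1, hδ.2.le⟩).1
    have : 0 ≤ r * (p δ * (lam * D)) := by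
      have := hr.1
      positivity
    linarith
  linarith

end IsShot

set_option maxHeartbeats 1000000 in
/-- In the subcritical range, tall shots keep positive energy. -/
theorem exists_energy_pos {h : ℝ → ℝ} {lam q T d k : ℝ} (hq : 1 < q) (hlam : 0 < lam)
    (hc : ContinuousOn h (Ioo 0 d)) (hT : T ∈ Ioo 0 d) (hh : ∀ t ∈ Ioo 0 T, 0 < h t)
    (hk : 1 ≤ k) (hsub : (k - 1) * q < k + 3)
    (hlim : Tendsto (fun t => t * h t) (nhdsWithin 0 (Ioi 0)) (nhds k)) :
    ∃ A : ℝ, ∀ α u v, A ≤ α → IsShot h lam q T α u v → 0 < energy lam q (u T) (v T) := by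
  obtain ⟨p, hp'⟩ := exists_weight hc hT
  have hp : ∀ t ∈ Ioc 0 T, 0 < p t ∧ HasDerivAt p (h t * p t) t :=
    fun t ht => hp' t ⟨ht.1, ht.2.trans_lt hT.2⟩
  obtain ⟨C, hC0, hC⟩ := exists_potential_lower_bound hq
  set ε := (k + 3 - (k - 1) * q) / (2 * (q + 3)) with hε
  have hε0 : 0 < ε := div_pos (by linarith) (by linarith)
  have hεD : ε * (2 * (q + 3)) = k + 3 - (k - 1) * q := by
    rw [hε]; field_simp
  set c := (k - 1 + ε) / 2 with hcdef
  have hc0 : 0 ≤ c := by rw [hcdef]; linarith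
  set η := ((1 + k - ε) / (q + 1) - c) / 2 with hηdef
  have hη0 : 0 < η := by
    have : c < (1 + k - ε) / (q + 1) := by
      rw [hcdef, lt_div_iff₀ (by linarith)]
      nlinarith
    rw [hηdef]; linarith
  obtain ⟨D, hD0, hD⟩ := exists_sq_le_mul_rpow_add hq hη0
  obtain ⟨δ, hδ, hδb⟩ : ∃ δ ∈ Ioo 0 T, ∀ t ∈ Ioc 0 δ, k - ε ≤ t * h t ∧ t * h t ≤ k + ε := by
    have h1 := hlim.eventually (Icc_mem_nhds (by linarith : k - ε < k) (by linarith : k < k + ε))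
    obtain ⟨b, hb0, hb⟩ := mem_nhdsGT_iff_exists_Ioo_subset.1 h1
    have hb0' : 0 < b := hb0
    have hmin : 0 < min b T := lt_min hb0' hT.1
    refine ⟨min b T / 2, ⟨by linarith, by linarith [min_le_right b T]⟩, fun t ht => ?_⟩
    exact hb ⟨ht.1, by linarith [min_le_left b T, ht.2]⟩
  obtain ⟨H', hH'⟩ := isCompact_Icc.exists_bound_of_continuousOn
    (hc.mono (fun t ht => ⟨hδ.1.trans_le ht.1, ht.2.trans_lt hT.2⟩ : Icc δ T ⊆ Ioo 0 d))
  have hH'0 : 0 ≤ H' := (norm_nonneg _).trans (hH' δ ⟨le_rfl, hδ.2.le⟩)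
  have hH : ∀ t ∈ Icc δ T, h t ≤ H' := fun t ht => (le_abs_self _).trans (hH' t ht)
  set b := Real.sqrt (2 * lam * (1 + C)) with hb
  have hb0 : 0 < b := Real.sqrt_pos.2 (by positivity)
  have hpδ := (hp δ ⟨hδ.1, hδ.2.le⟩).1
  set r : ℝ → ℝ := fun α => α ^ ((1 - q) / 2) / (2 * b) with hr
  have hrlim : Tendsto r atTop (nhds 0) := by
    have : Tendsto (fun α : ℝ => α ^ (-((q - 1) / 2))) atTop (nhds 0) :=
      tendsto_rpow_neg_atTop (by linarith)
    have := this.div_const (2 * b)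
    rw [zero_div] at this
    refine this.congr fun α => ?_
    rw [hr]
    congr 2
    ring
  set κ := k + ε with hκ
  set σ := (1 - q) / 2 * (κ + 1) + (q + 1) with hσ
  have hσ0 : 0 < σ := by
    rw [hσ, hκ]
    nlinarith
  set c₁ := p δ * δ ^ (-κ) * (1 / (4 * b)) ^ (κ + 1) * (lam * (η / 2 * (1 / 2) ^ (q + 1))) with hc₁
  have hδ0 := hδ.1
  have hc₁0 : 0 < c₁ := by positivity
  set M := lam * C * Real.exp (2 * H' * (T - δ)) with hM
  set N := δ * (p δ * (lam * D)) +
    p δ * ((δ + c / lam + c) * M + c * (C + lam * C)) with hN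
  have hbig : ∀ᶠ α : ℝ in atTop, N < c₁ * α ^ σ :=
    ((tendsto_rpow_atTop hσ0).const_mul_atTop hc₁0).eventually_gt_atTop N
  have hbig2 : ∀ᶠ α : ℝ in atTop, D < η / 2 * (1 / 2) ^ (q + 1) * α ^ (q + 1) :=
    ((tendsto_rpow_atTop (by linarith : 0 < q + 1)).const_mul_atTop
      (by positivity)).eventually_gt_atTop D
  obtain ⟨A, hA⟩ := eventually_atTop.1
    (((hbig.and hbig2).and (hrlim.eventually_lt_const hδ0)).and (eventually_ge_atTop (1 : ℝ)))
  refine ⟨A, fun α u v hα hs => ?_⟩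
  obtain ⟨⟨⟨hb1, hb2⟩, hb3⟩, hb4⟩ := hA α hα
  have hα0 : 0 < α := by linarith
  have hαhalf : (α / 2) ^ (q + 1) = (1 / 2) ^ (q + 1) * α ^ (q + 1) := by
    rw [← Real.mul_rpow (by norm_num) hα0.le]; congr 1; ring
  have hr0 : 0 < r α := by simp only [hr]; positivity
  have hlow := hs.pohozaev_lower_bound hq hlam hh hp (c := c) hη0 hD0 hδ ⟨hr0, hb3⟩ (by
      intro t ht
      have h1 := hδb t ⟨ht.1, ht.2.le⟩
      have h2 := pohozaev_density_lower_bound (x := u t) (y := v t) hq hlam h1.1 h1.2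
      refine le_trans ?_ h2
      have h3 := hD (u t)
      have h4 : (1 + k - ε) / (q + 1) - (k - 1 + ε) / 2 = 2 * η := by rw [hηdef]; ring
      rw [h4]
      exact mul_le_mul_of_nonneg_left (by linarith) hlam.le) hα0 (by rw [hαhalf]; linarith) (fun t ht =>
      hs.half_le hq hlam hh hC0 hC hb4 ⟨ht.1, (ht.2.trans hb3.le).trans hδ.2.le⟩ ht.2)
  have hpr := weight_lower_bound (p := p) (fun t ht => hp t ⟨ht.1, ht.2.trans hδ.2.le⟩)
    (fun t ht => (hδb t ht).2) (t := r α / 2) ⟨by linarith, by linarith⟩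
  have hmain : c₁ * α ^ σ ≤ r α / 2 * (p (r α / 2) * (lam * (η / 2 * (α / 2) ^ (q + 1)))) := by
    have e : c₁ * α ^ σ = r α / 2 * ((p δ * δ ^ (-κ) * (r α / 2) ^ κ) *
        (lam * (η / 2 * (α / 2) ^ (q + 1)))) := by
      have e1 : r α / 2 = 1 / (4 * b) * α ^ ((1 - q) / 2) := by
        simp only [hr]; field_simp; norm_num
      have e2 : r α / 2 * (r α / 2) ^ κ =
          (1 / (4 * b)) ^ (κ + 1) * α ^ ((1 - q) / 2 * (κ + 1)) := by
        rw [mul_comm, ← Real.rpow_add_one (by positivity), e1,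
          Real.mul_rpow (by positivity) (by positivity), ← Real.rpow_mul hα0.le]
      calc c₁ * α ^ σ = p δ * δ ^ (-κ) * ((1 / (4 * b)) ^ (κ + 1) *
            α ^ ((1 - q) / 2 * (κ + 1))) * (lam * (η / 2 * ((1 / 2) ^ (q + 1) * α ^ (q + 1)))) := by
            rw [hc₁, hσ, Real.rpow_add hα0]; ring
        _ = _ := by rw [← e2, ← hαhalf]; ring
    rw [e]
    gcongr
  refine hs.energy_pos_of_large hq hlam hC0 hC hδ hH hH'0 ?_
  set E := energy lam q (u δ) (v δ) with hE
  have hpot := mul_le_mul_of_nonneg_left (hC (u δ)) hlam.le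
  have hv2 : v δ ^ 2 / 2 ≤ E + lam * C := by
    have : 0 ≤ lam * (u δ ^ 2 / 2) := by positivity
    rw [hE]; unfold energy
    linarith
  have hu2 : u δ ^ 2 / 2 ≤ E / lam + C := by
    have : lam * (u δ ^ 2 / 2) ≤ E + lam * C := by
      rw [hE]; unfold energy
      linarith [sq_nonneg (v δ)]
    have h2 : lam * (E / lam + C) = E + lam * C := by field_simp
    rw [← h2] at this
    exact le_of_mul_le_mul_left this hlam
  have huv : u δ * v δ ≤ E / lam + C + (E + lam * C) := by
    linarith [two_mul_le_add_sq (u δ) (v δ)]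
  have h1 : p δ * (δ * E + c * (u δ * v δ)) ≤
      p δ * ((δ + c / lam + c) * E + c * (C + lam * C)) := by
    have : c * (u δ * v δ) ≤ c * (E / lam + C + (E + lam * C)) := by gcongr
    have e : (δ + c / lam + c) * E + c * (C + lam * C) =
        δ * E + c * (E / lam + C + (E + lam * C)) := by ring
    rw [e]
    gcongr
  by_contra! hcon
  have h2 : p δ * ((δ + c / lam + c) * E + c * (C + lam * C)) ≤
      p δ * ((δ + c / lam + c) * M + c * (C + lam * C)) := by
    have : 0 ≤ δ + c / lam + c := by positivity
    gcongr
  linarith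

theorem eventually_deriv_mul_sub_mul_sub_pos {f : ℝ → ℝ} {c s : ℝ} {S : Set ℝ}
    (hf : HasDerivWithinAt f c S s) (hc : c ≠ 0) :
    ∀ᶠ x in nhdsWithin s (S \ {s}), 0 < c * (f x - f s) * (x - s) := by
  have h1 := (hasDerivWithinAt_iff_tendsto_slope.1 hf).const_mul c
  have h2 : 0 < c * c := mul_self_pos.2 hc
  filter_upwards [h1.eventually_const_lt h2, self_mem_nhdsWithin] with x hx hxs
  have hne : x - s ≠ 0 := sub_ne_zero.2 hxs.2
  rw [slope_def_field] at hx
  have h3 := mul_pos hx (by positivity : 0 < (x - s) ^ 2)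
  have e : c * ((f x - f s) / (x - s)) * (x - s) ^ 2 = c * (f x - f s) * (x - s) := by
    field_simp
  rwa [e] at h3

theorem exists_left_of_hasDerivWithinAt {f : ℝ → ℝ} {c a s : ℝ} {S : Set ℝ}
    (hf : HasDerivWithinAt f c S s) (hc : c ≠ 0) (has : a < s) (hS : Ioo a s ⊆ S)
    {P : ℝ → Prop} (hP : ∀ᶠ x in nhdsWithin s (Ioo a s), P x) :
    ∃ x ∈ Ioo a s, P x ∧ c * (f x - f s) < 0 := by
  have hle : nhdsWithin s (Ioo a s) ≤ nhdsWithin s (S \ {s}) :=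
    nhdsWithin_mono _ fun x hx => ⟨hS hx, hx.2.ne⟩
  have : (nhdsWithin s (Ioo a s)).NeBot := by
    rw [← mem_closure_iff_nhdsWithin_neBot, closure_Ioo has.ne]
    exact ⟨has.le, le_rfl⟩
  obtain ⟨x, hx, hPx, hxm⟩ :=
    (((eventually_deriv_mul_sub_mul_sub_pos hf hc).filter_mono hle).and (hP.and self_mem_nhdsWithin)).exists
  refine ⟨x, hxm, hPx, ?_⟩
  have hx' : 0 < c * (f x - f s) * (x - s) := hx
  exact neg_of_mul_pos_left hx' (by linarith [hxm.2])

theorem exists_right_of_hasDerivWithinAt {f : ℝ → ℝ} {c s b : ℝ} {S : Set ℝ}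
    (hf : HasDerivWithinAt f c S s) (hc : c ≠ 0) (hsb : s < b) (hS : Ioo s b ⊆ S)
    {P : ℝ → Prop} (hP : ∀ᶠ x in nhdsWithin s (Ioo s b), P x) :
    ∃ x ∈ Ioo s b, P x ∧ 0 < c * (f x - f s) := by
  have hle : nhdsWithin s (Ioo s b) ≤ nhdsWithin s (S \ {s}) :=
    nhdsWithin_mono _ fun x hx => ⟨hS hx, hx.1.ne'⟩
  have : (nhdsWithin s (Ioo s b)).NeBot := by
    rw [← mem_closure_iff_nhdsWithin_neBot, closure_Ioo hsb.ne]
    exact ⟨le_rfl, hsb.le⟩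
  obtain ⟨x, hx, hPx, hxm⟩ :=
    (((eventually_deriv_mul_sub_mul_sub_pos hf hc).filter_mono hle).and (hP.and self_mem_nhdsWithin)).exists
  refine ⟨x, hxm, hPx, ?_⟩
  have hx' : 0 < c * (f x - f s) * (x - s) := hx
  exact pos_of_mul_pos_left hx' (by linarith [hxm.1])

/-- The curve `z` on `[0, T]` has a continuous argument running from `0` to `φ`. -/
def HasPhase (T : ℝ) (z : ℝ → ℂ) (φ : ℝ) : Prop :=
  ∃ θ : ℝ → ℝ, ContinuousOn θ (Icc 0 T) ∧ θ 0 = 0 ∧ θ T = φ ∧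
    ∀ t ∈ Icc 0 T, z t = ‖z t‖ * Complex.exp (θ t * Complex.I)

/-- Uniformly close curves have continuous arguments with close endpoints. -/
theorem HasPhase.transfer {T φ ψ : ℝ} {z w : ℝ → ℂ} (hz : HasPhase T z φ) (hT : 0 ≤ T)
    (hzc : ContinuousOn z (Icc 0 T)) (hwc : ContinuousOn w (Icc 0 T))
    (hclose : ∀ t ∈ Icc 0 T, ‖w t - z t‖ < ‖z t‖)
    {α β : ℝ} (hα : 0 < α) (hβ : 0 < β) (hz0 : z 0 = α) (hw0 : w 0 = β)
    (hψ : w T = ‖w T‖ * Complex.exp (ψ * Complex.I)) (hφψ : |φ - ψ| < Real.pi) :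
    HasPhase T w ψ := by
  obtain ⟨θ, hθc, hθ0, hθT, hθ⟩ := hz
  have hzne : ∀ t ∈ Icc 0 T, z t ≠ 0 := fun t ht h0 => by
    have := hclose t ht
    rw [h0, norm_zero] at this
    exact absurd this (not_lt.2 (norm_nonneg _))
  have hwne : ∀ t ∈ Icc 0 T, w t ≠ 0 := fun t ht h0 => by
    have := hclose t ht
    rw [h0, zero_sub, norm_neg] at this
    exact lt_irrefl _ this
  have hre : ∀ t ∈ Icc 0 T, 0 < (w t / z t).re := by
    intro t ht
    have h1 : ‖w t / z t - 1‖ < 1 := by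
      have e : w t / z t - 1 = (w t - z t) / z t := by
        rw [sub_div, div_self (hzne t ht)]
      rw [e, norm_div, div_lt_one (norm_pos_iff.2 (hzne t ht))]
      exact hclose t ht
    have h2 := (abs_le.1 ((Complex.abs_re_le_norm _).trans h1.le)).1
    have h3 := (abs_lt.1 ((Complex.abs_re_le_norm _).trans_lt h1)).1
    simp only [Complex.sub_re, Complex.one_re] at h3
    linarith
  have hrep : ∀ t ∈ Icc 0 T, w t =
      ‖w t‖ * Complex.exp (((θ t + (w t / z t).arg : ℝ) : ℂ) * Complex.I) := by
    intro t ht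
    have h1 := Complex.norm_mul_exp_arg_mul_I (w t / z t)
    have h2 := hθ t ht
    have hzn : (‖z t‖ : ℂ) ≠ 0 := by exact_mod_cast (norm_pos_iff.2 (hzne t ht)).ne'
    have h3 : w t = z t * (w t / z t) := by field_simp [hzne t ht]
    push_cast
    rw [add_mul, Complex.exp_add]
    calc w t = z t * (w t / z t) := h3
      _ = (‖z t‖ * Complex.exp (θ t * Complex.I)) *
          (‖w t / z t‖ * Complex.exp ((w t / z t).arg * Complex.I)) := by rw [← h2, h1]
      _ = _ := by rw [norm_div]; push_cast; field_simp
  have hTm : T ∈ Icc 0 T := ⟨hT, le_rfl⟩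
  refine ⟨fun t => θ t + (w t / z t).arg, ?_, ?_, ?_, hrep⟩
  · refine hθc.add fun t ht => ?_
    have h1 : ContinuousWithinAt (fun t => w t / z t) (Icc 0 T) t :=
      (hwc t ht).div (hzc t ht) (hzne t ht)
    exact ContinuousAt.comp_continuousWithinAt (f := fun t => w t / z t)
      (Complex.continuousAt_arg (Or.inl (hre t ht))) h1
  · simp only [hθ0, hz0, hw0, zero_add]
    rw [← Complex.ofReal_div]
    exact Complex.arg_ofReal_of_nonneg (by positivity)
  · simp only [hθT]
    set δ := (w T / z T).arg
    have hδ : |δ| < Real.pi / 2 := Complex.abs_arg_lt_pi_div_two_iff.2 (Or.inl (hre T hTm))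
    have h1 := (hrep T hTm).symm.trans hψ
    have hwn : (‖w T‖ : ℂ) ≠ 0 := by exact_mod_cast (norm_pos_iff.2 (hwne T hTm)).ne'
    obtain ⟨n, hn⟩ := Complex.exp_eq_exp_iff_exists_int.1 (mul_left_cancel₀ hwn h1)
    have h2 : φ + δ = ψ + n * (2 * Real.pi) := by
      have : ((φ + δ : ℝ) : ℂ) = ((ψ + n * (2 * Real.pi) : ℝ) : ℂ) := by
        apply mul_right_cancel₀ Complex.I_ne_zero
        rw [hθT] at hn
        rw [hn]
        push_cast
        ring
      exact_mod_cast this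
    have hpi := Real.pi_pos
    rw [abs_lt] at hφψ hδ
    have hn1 : (n : ℝ) < 1 := by nlinarith
    have hn2 : (-1 : ℝ) < n := by nlinarith
    have hn0 : n = 0 := by
      have : n < 1 := by exact_mod_cast hn1
      have : -1 < n := by exact_mod_cast hn2
      omega
    rw [h2, hn0]
    simp

/-- A phase curve `(u, u')` whose total rotation ends in the right half plane
has `u` positive throughout. -/
theorem HasPhase.pos {T φ : ℝ} {u v : ℝ → ℝ}
    (hph : HasPhase T (fun t => (u t : ℂ) + v t * Complex.I) φ)
    (hu : ∀ t ∈ Icc 0 T, HasDerivWithinAt u (v t) (Icc 0 T) t)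
    (hne : ∀ t ∈ Icc 0 T, (u t : ℂ) + v t * Complex.I ≠ 0)
    (h1 : -(Real.pi / 2) < φ) : ∀ t ∈ Icc 0 T, 0 < u t := by
  obtain ⟨θ, hθc, hθ0, hθT, hθ⟩ := hph
  have hpi := Real.pi_pos
  have hpos : ∀ t ∈ Icc 0 T, 0 < ‖(u t : ℂ) + v t * Complex.I‖ := fun t ht =>
    norm_pos_iff.2 (hne t ht)
  have hucos : ∀ t ∈ Icc 0 T, u t = ‖(u t : ℂ) + v t * Complex.I‖ * Real.cos (θ t) := by
    intro t ht
    have := congrArg Complex.re (hθ t ht)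
    simpa [Complex.exp_ofReal_mul_I_re] using this
  have hvsin : ∀ t ∈ Icc 0 T, v t = ‖(u t : ℂ) + v t * Complex.I‖ * Real.sin (θ t) := by
    intro t ht
    have := congrArg Complex.im (hθ t ht)
    simpa [Complex.exp_ofReal_mul_I_im] using this
  have hup : ∀ t ∈ Icc 0 T, -(Real.pi / 2) < θ t → θ t < Real.pi / 2 → 0 < u t := by
    intro t ht h2 h3
    rw [hucos t ht]
    exact mul_pos (hpos t ht) (Real.cos_pos_of_mem_Ioo ⟨h2, h3⟩)
  have hupper : ∀ t ∈ Icc 0 T, θ t < Real.pi / 2 := by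
    intro t ht
    by_contra! hcon
    have hsub : Icc 0 t ⊆ Icc 0 T := Icc_subset_Icc le_rfl ht.2
    have hcomp : IsCompact {s ∈ Icc 0 t | θ s ∈ ({Real.pi / 2} : Set ℝ)} :=
      isCompact_Icc.of_isClosed_subset
        ((hθc.mono hsub).preimage_isClosed_of_isClosed isClosed_Icc isClosed_singleton)
        (fun s hs => hs.1)
    obtain ⟨y, hy, hyθ⟩ := intermediate_value_Icc ht.1 (hθc.mono hsub)
      (⟨by rw [hθ0]; linarith, hcon⟩ : Real.pi / 2 ∈ Icc (θ 0) (θ t))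
    obtain ⟨s, ⟨hs, hsθ⟩, hleast⟩ := hcomp.exists_isLeast ⟨y, hy, hyθ⟩
    have hsθ' : θ s = Real.pi / 2 := hsθ
    have hs0 : 0 < s := by
      rcases hs.1.eq_or_lt with h0 | h0
      · rw [← h0, hθ0] at hsθ'; linarith
      · exact h0
    have hbelow : ∀ x ∈ Ioo 0 s, θ x < Real.pi / 2 := by
      intro x hx
      by_contra! hc
      obtain ⟨y, hy, hyθ⟩ := intermediate_value_Icc hx.1.le
        (hθc.mono (Icc_subset_Icc le_rfl (hx.2.le.trans (hsub hs).2)))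
        (⟨by rw [hθ0]; linarith, hc⟩ : Real.pi / 2 ∈ Icc (θ 0) (θ x))
      have := hleast ⟨⟨hy.1, hy.2.trans (hx.2.le.trans hs.2)⟩, hyθ⟩
      linarith [hy.2, hx.2]
    have hsT := hsub hs
    have hsubs : Ioo 0 s ⊆ Icc 0 T := fun x hx => ⟨hx.1.le, hx.2.le.trans hsT.2⟩
    have hus : u s = 0 := by rw [hucos s hsT, hsθ']; simp
    have hvs : 0 < v s := by rw [hvsin s hsT, hsθ']; simpa using hne s hsT
    obtain ⟨x, hx, hP, hlt⟩ := exists_left_of_hasDerivWithinAt (hu s hsT) hvs.ne' hs0 hsubs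
      (((hθc s hsT).mono hsubs).eventually_const_lt (by rw [hsθ']; linarith : (0:ℝ) < θ s))
    have := hup x (hsubs hx) (by linarith) (hbelow x hx)
    rw [hus, sub_zero] at hlt
    nlinarith
  have hlower : ∀ t ∈ Icc 0 T, -(Real.pi / 2) < θ t := by
    intro t ht
    by_contra! hcon
    have hsub : Icc t T ⊆ Icc 0 T := Icc_subset_Icc ht.1 le_rfl
    have hcomp : IsCompact {s ∈ Icc t T | θ s ∈ ({-(Real.pi / 2)} : Set ℝ)} :=
      isCompact_Icc.of_isClosed_subset
        ((hθc.mono hsub).preimage_isClosed_of_isClosed isClosed_Icc isClosed_singleton)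
        (fun s hs => hs.1)
    obtain ⟨y, hy, hyθ⟩ := intermediate_value_Icc ht.2 (hθc.mono hsub)
      (⟨hcon, by rw [hθT]; linarith⟩ : -(Real.pi / 2) ∈ Icc (θ t) (θ T))
    obtain ⟨s, ⟨hs, hsθ⟩, hgreat⟩ := hcomp.exists_isGreatest ⟨y, hy, hyθ⟩
    have hsθ' : θ s = -(Real.pi / 2) := hsθ
    have hs0 : s < T := by
      rcases hs.2.eq_or_lt with h0 | h0
      · rw [h0, hθT] at hsθ'; linarith
      · exact h0
    have habove : ∀ x ∈ Ioo s T, -(Real.pi / 2) < θ x := by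
      intro x hx
      by_contra! hc
      obtain ⟨y, hy, hyθ⟩ := intermediate_value_Icc hx.2.le
        (hθc.mono (Icc_subset_Icc ((hsub hs).1.trans hx.1.le) le_rfl))
        (⟨hc, by rw [hθT]; linarith⟩ : -(Real.pi / 2) ∈ Icc (θ x) (θ T))
      have := hgreat ⟨⟨hs.1.trans (hx.1.le.trans hy.1), hy.2⟩, hyθ⟩
      linarith [hy.1, hx.1]
    have hsT := hsub hs
    have hsubs : Ioo s T ⊆ Icc 0 T := fun x hx => ⟨hsT.1.trans hx.1.le, hx.2.le⟩
    have hus : u s = 0 := by rw [hucos s hsT, hsθ']; simp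
    have hvs : v s < 0 := by
      have := hpos s hsT
      rw [hvsin s hsT, hsθ', Real.sin_neg, Real.sin_pi_div_two]
      linarith
    obtain ⟨x, hx, hP, hlt⟩ := exists_right_of_hasDerivWithinAt (hu s hsT) hvs.ne hs0 hsubs
      (((hθc s hsT).mono hsubs).eventually_lt_const (by rw [hsθ']; linarith : θ s < 0))
    have := hup x (hsubs hx) (habove x hx) (by linarith)
    rw [hus, sub_zero] at hlt
    nlinarith
  exact fun t ht => hup t ht (hlower t ht) (hupper t ht)

namespace IsShot

variable {h p : ℝ → ℝ} {lam q T α : ℝ} {u v : ℝ → ℝ}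

/-- Before a point of positive slope there is a critical point at height at most `1`. -/
theorem exists_critical (hs : IsShot h lam q T α u v) (hq : 1 < q) (hlam : 0 < lam)
    (hh : ∀ t ∈ Ioo 0 T, 0 < h t)
    (hp : ∀ t ∈ Ioc 0 T, 0 < p t ∧ HasDerivAt p (h t * p t) t) (hα : 1 < α) {s : ℝ}
    (hsT : s ∈ Icc 0 T) (hv : 0 < v s) : ∃ τ ∈ Icc 0 T, v τ = 0 ∧ u τ ≤ 1 := by
  obtain ⟨t, ht, hut⟩ := hs.exists_le_one hq hlam hh hp hsT hv
  have hsub : Icc 0 s ⊆ Icc 0 T := Icc_subset_Icc le_rfl hsT.2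
  obtain ⟨τ, hτ, hmin⟩ := isCompact_Icc.exists_isMinOn ⟨t, ht⟩ (hs.continuousOn.mono hsub)
  have huτ : u τ ≤ 1 := (isMinOn_iff.1 hmin t ht).trans hut
  have hτ0 : 0 < τ := by
    rcases hτ.1.eq_or_lt with h0 | h0
    · rw [← h0, hs.init] at huτ; linarith
    · exact h0
  have hτs : τ < s := by
    rcases hτ.2.eq_or_lt with h0 | h0
    · subst h0
      obtain ⟨x, hx, -, hlt⟩ := exists_left_of_hasDerivWithinAt (hs.hasDeriv τ hsT) hv.ne' hτ0
        (fun x hx => ⟨hx.1.le, hx.2.le.trans hsT.2⟩) (P := fun _ => True) (by simp)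
      have := isMinOn_iff.1 hmin x ⟨hx.1.le, hx.2.le⟩
      nlinarith
    · exact h0
  refine ⟨τ, hsub hτ, ?_, huτ⟩
  exact (hmin.isLocalMin (Icc_mem_nhds hτ0 hτs)).hasDerivAt_eq_zero
    (hs.hasDerivAt ⟨hτ0, hτs.trans_le hsT.2⟩)

/-- After a critical point at a height in `(0, 1)` the slope becomes positive. -/
theorem exists_deriv_pos_of_critical (hs : IsShot h lam q T α u v) (hq : 1 < q)
    (hlam : 0 < lam) {τ : ℝ} (hτ : τ ∈ Ioo 0 T) (hv : v τ = 0) (h0 : 0 < u τ) (h1 : u τ < 1) :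
    ∃ s ∈ Icc 0 T, 0 < v s := by
  have hc : 0 < -(h τ * v τ) - lam * (oddPow q (u τ) - u τ) := by
    have := mul_pos hlam (sub_pos.2 (oddPow_lt_self hq h0 h1))
    rw [hv]
    linarith
  obtain ⟨x, hx, -, hlt⟩ := exists_right_of_hasDerivWithinAt
    (hs.ode τ (Ioo_subset_Ioc_self hτ)) hc.ne' hτ.2
    (fun x hx => ⟨hτ.1.trans hx.1, hx.2.le⟩) (P := fun _ => True) (by simp)
  refine ⟨x, ⟨(hτ.1.trans hx.1).le, hx.2.le⟩, ?_⟩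
  have e : v x - v τ = v x := by rw [hv, sub_zero]
  rw [e] at hlt
  exact pos_of_mul_pos_right hlt hc.le

/-- Before a critical endpoint at height above `1` the slope is positive somewhere. -/
theorem exists_deriv_pos_of_end (hs : IsShot h lam q T α u v) (hq : 1 < q)
    (hlam : 0 < lam) (hT : 0 < T) (hv : v T = 0) (h1 : 1 < u T) :
    ∃ s ∈ Icc 0 T, 0 < v s := by
  have hc : -(h T * v T) - lam * (oddPow q (u T) - u T) < 0 := by
    have := mul_pos hlam (sub_pos.2 (lt_oddPow_self hq h1))
    rw [hv]
    linarith
  obtain ⟨x, hx, -, hlt⟩ := exists_left_of_hasDerivWithinAt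
    (hs.ode T ⟨hT, le_rfl⟩) hc.ne hT
    (fun x hx => ⟨hx.1, hx.2.le⟩) (P := fun _ => True) (by simp)
  refine ⟨x, ⟨hx.1.le, hx.2.le⟩, ?_⟩
  have e : v x - v T = v x := by rw [hv, sub_zero]
  rw [e] at hlt
  by_contra! hcon
  nlinarith

theorem energy_end_neg (hs : IsShot h lam q T α u v) (hq : 1 < q) (hlam : 0 < lam)
    (hh : ∀ t ∈ Ioo 0 T, 0 < h t) {τ : ℝ} (hτ : τ ∈ Icc 0 T) (hv : v τ = 0) (h0 : 0 < u τ)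
    (h1 : u τ ≤ 1) : energy lam q (u T) (v T) < 0 := by
  have h2 := hs.antitoneOn_energy hq hh hτ ⟨hτ.1.trans hτ.2, le_rfl⟩ hτ.2
  refine h2.trans_lt ?_
  have := mul_neg_of_pos_of_neg hlam (potential_neg hq h0 h1)
  simp only [energy, hv]
  linarith

theorem phase_ne_zero (hs : IsShot h lam q T α u v) (hq : 1 < q) (hlam : 0 < lam)
    (hc : ContinuousOn h (Ioc 0 T)) (hα : α ≠ 0) {t : ℝ} (ht : t ∈ Icc 0 T) :
    (u t : ℂ) + v t * Complex.I ≠ 0 := by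
  intro h0
  have hu : u t = 0 := by simpa using congrArg Complex.re h0
  have hv : v t = 0 := by simpa using congrArg Complex.im h0
  rcases ht.1.eq_or_lt with h1 | h1
  · rw [← h1, hs.init] at hu
    exact hα hu
  · exact hα (hs.height_eq_of_rest hq hlam hc (oddPow_zero q) ⟨h1, ht.2⟩ hu hv)

end IsShot

section Family

variable {h : ℝ → ℝ} {lam q T : ℝ} {U V : ℝ → ℝ → ℝ}

theorem exists_continuousOn_family (hq : 1 < q) (hlam : 0 < lam) (hh : ∀ t ∈ Ioo 0 T, 0 < h t)
    (hs : ∀ α, IsShot h lam q T α (U α) (V α)) (a b : ℝ) :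
    ContinuousOn (fun x : ℝ × ℝ => U x.1 x.2) (Icc a b ×ˢ Icc 0 T) ∧
      ContinuousOn (fun x : ℝ × ℝ => V x.1 x.2) (Icc a b ×ˢ Icc 0 T) := by
  obtain ⟨K, hK0, hK⟩ := IsShot.exists_lipschitz h hq hlam hh (max |a| |b|)
  have habs : ∀ x ∈ Icc a b, |x| ≤ max |a| |b| := fun x hx => abs_le_max_abs_abs hx.1 hx.2
  constructor
  · refine continuousOn_prod_of_continuousOn_lipschitzOnWith _ K.toNNReal
      (fun x _ => (hs x).continuousOn) fun t ht => LipschitzOnWith.of_dist_le_mul ?_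
    intro x hx y hy
    rw [Real.coe_toNNReal _ hK0.le, Real.dist_eq, Real.dist_eq]
    exact (hK x y _ _ _ _ (habs x hx) (habs y hy) (hs x) (hs y) t ht).1
  · refine continuousOn_prod_of_continuousOn_lipschitzOnWith _ K.toNNReal
      (fun x _ => (hs x).cont) fun t ht => LipschitzOnWith.of_dist_le_mul ?_
    intro x hx y hy
    rw [Real.coe_toNNReal _ hK0.le, Real.dist_eq, Real.dist_eq]
    exact (hK x y _ _ _ _ (habs x hx) (habs y hy) (hs x) (hs y) t ht).2

/-- The continuous angle at the endpoint is the total rotation of the phase curve. -/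
theorem hasPhase_family (hq : 1 < q) (hlam : 0 < lam) (hT : 0 < T)
    (hh : ∀ t ∈ Ioo 0 T, 0 < h t) (hc : ContinuousOn h (Ioc 0 T))
    (hs : ∀ α, IsShot h lam q T α (U α) (V α))
    (hone : ∀ t ∈ Icc 0 T, U 1 t = 1 ∧ V 1 t = 0) {a : ℝ → ℝ}
    (ha : ContinuousOn a (Ioi 0)) (ha1 : a 1 = 0)
    (hang : ∀ α, 0 < α → (U α T : ℂ) + V α T * Complex.I =
      ‖(U α T : ℂ) + V α T * Complex.I‖ * Complex.exp (a α * Complex.I))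
    {α : ℝ} (hα : 1 ≤ α) :
    HasPhase T (fun t => (U α t : ℂ) + V α t * Complex.I) (a α) := by
  set Z : ℝ → ℝ → ℂ := fun α t => (U α t : ℂ) + V α t * Complex.I with hZ
  have hZc : ∀ α, ContinuousOn (Z α) (Icc 0 T) := fun α =>
    (Complex.continuous_ofReal.comp_continuousOn (hs α).continuousOn).add
      ((Complex.continuous_ofReal.comp_continuousOn (hs α).cont).mul continuousOn_const)
  have hZ0 : ∀ α, Z α 0 = α := fun α => by simp [hZ, (hs α).init, (hs α).init_deriv]
  have hTm : T ∈ Icc 0 T := ⟨hT.le, le_rfl⟩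
  have hbase : HasPhase T (Z 1) (a 1) := by
    refine ⟨fun _ => 0, continuousOn_const, rfl, ha1.symm, fun t ht => ?_⟩
    simp [hZ, (hone t ht).1, (hone t ht).2]
  refine (isPreconnected_Ici.induction₂ (s := Ici (1 : ℝ))
    (fun x y => HasPhase T (Z x) (a x) ↔ HasPhase T (Z y) (a y)) ?_
    (fun _ _ _ _ _ _ h1 h2 => h1.trans h2) (fun _ _ _ _ h1 => h1.symm)
    (mem_Ici.2 le_rfl) (mem_Ici.2 hα)).1 hbase
  intro x hx
  have hx1 : 1 ≤ x := hx
  have hx0 : 0 < x := by linarith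
  obtain ⟨t₁, ht₁, hmin⟩ := isCompact_Icc.exists_isMinOn ⟨T, hTm⟩ (hZc x).norm
  set ρ := ‖Z x t₁‖ with hρ
  have hρ0 : 0 < ρ := norm_pos_iff.2 ((hs x).phase_ne_zero hq hlam hc hx0.ne' ht₁)
  obtain ⟨K, hK0, hK⟩ := IsShot.exists_lipschitz h hq hlam hh (x + 1)
  have hcont : ContinuousWithinAt a (Ici 1) x :=
    (ha x hx0).mono fun y (hy : 1 ≤ y) => mem_Ioi.2 (by linarith)
  have hev1 : ∀ᶠ y in nhdsWithin x (Ici 1), |a x - a y| < Real.pi := by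
    have := (Metric.tendsto_nhds.1 hcont.tendsto) Real.pi Real.pi_pos
    filter_upwards [this] with y hy
    rwa [Real.dist_eq, abs_sub_comm] at hy
  have hev2 : ∀ᶠ y in nhdsWithin x (Ici 1), |x - y| < min 1 (ρ / (4 * K)) := by
    have : 0 < min 1 (ρ / (4 * K)) := lt_min one_pos (by positivity)
    filter_upwards [nhdsWithin_le_nhds (Metric.ball_mem_nhds x this)] with y hy
    rwa [Metric.mem_ball, Real.dist_eq, abs_sub_comm] at hy
  filter_upwards [hev1, hev2, self_mem_nhdsWithin] with y hy1 hy2 hy3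
  have hy3' : 1 ≤ y := hy3
  have hy0 : 0 < y := by linarith
  have hxy1 := hy2.trans_le (min_le_left _ _)
  have hxy2 := hy2.trans_le (min_le_right _ _)
  have hdist : ∀ t ∈ Icc 0 T, ‖Z x t - Z y t‖ < ρ / 2 := by
    intro t ht
    obtain ⟨b1, b2⟩ := hK x y _ _ _ _ (by rw [abs_of_pos hx0]; linarith)
      (by rw [abs_of_pos hy0]; linarith [(abs_lt.1 hxy1).1]) (hs x) (hs y) t ht
    have e : Z x t - Z y t = ((U x t - U y t : ℝ) : ℂ) + ((V x t - V y t : ℝ) : ℂ) * Complex.I := by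
      simp only [hZ]; push_cast; ring
    calc ‖Z x t - Z y t‖ ≤ |U x t - U y t| + |V x t - V y t| := by
          rw [e]
          refine (norm_add_le _ _).trans ?_
          rw [norm_mul, Complex.norm_I, mul_one, Complex.norm_real, Complex.norm_real,
            Real.norm_eq_abs, Real.norm_eq_abs]
      _ ≤ 2 * K * |x - y| := by linarith
      _ < 2 * K * (ρ / (4 * K)) := by gcongr
      _ = ρ / 2 := by field_simp; norm_num
  have hlow : ∀ t ∈ Icc 0 T, ρ ≤ ‖Z x t‖ := fun t ht => isMinOn_iff.1 hmin t ht
  constructor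
  · intro hp
    refine hp.transfer hT.le (hZc x) (hZc y) (fun t ht => ?_) hx0 hy0 (hZ0 x) (hZ0 y)
      (hang y hy0) hy1
    rw [norm_sub_rev]
    linarith [hdist t ht, hlow t ht]
  · intro hp
    refine hp.transfer hT.le (hZc y) (hZc x) (fun t ht => ?_) hy0 hx0 (hZ0 y) (hZ0 x)
      (hang x hx0) (by rwa [abs_sub_comm])
    have := norm_sub_norm_le (Z x t) (Z y t)
    linarith [hdist t ht, hlow t ht]

/-- At the largest zero of the endpoint angle the endpoint value is at most `1`. -/
theorem endpoint_le_one {p : ℝ → ℝ} (hq : 1 < q) (hlam : 0 < lam) (hT : 0 < T)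
    (hh : ∀ t ∈ Ioo 0 T, 0 < h t) (hc : ContinuousOn h (Ioc 0 T))
    (hp : ∀ t ∈ Ioc 0 T, 0 < p t ∧ HasDerivAt p (h t * p t) t)
    (hs : ∀ α, IsShot h lam q T α (U α) (V α))
    (hone : ∀ t ∈ Icc 0 T, U 1 t = 1 ∧ V 1 t = 0)
    (htall : ∃ A : ℝ, ∀ α, A ≤ α → 0 < energy lam q (U α T) (V α T)) {a : ℝ → ℝ}
    (ha : ContinuousOn a (Ioi 0)) (ha1 : a 1 = 0)
    (hang : ∀ α, 0 < α → (U α T : ℂ) + V α T * Complex.I =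
      ‖(U α T : ℂ) + V α T * Complex.I‖ * Complex.exp (a α * Complex.I))
    {e : ℝ} (he1 : 1 < e) (hae : a e = 0) (hmax : ∀ α, e < α → a α ≠ 0) : U e T ≤ 1 := by
  by_contra! hgt
  have hpi := Real.pi_pos
  have hTm : T ∈ Icc 0 T := ⟨hT.le, le_rfl⟩
  have hU : ∀ α, 0 < α → U α T = ‖(U α T : ℂ) + V α T * Complex.I‖ * Real.cos (a α) := by
    intro α hα
    have := congrArg Complex.re (hang α hα)
    simpa [Complex.exp_ofReal_mul_I_re] using this
  have hV : ∀ α, 0 < α → V α T = ‖(U α T : ℂ) + V α T * Complex.I‖ * Real.sin (a α) := by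
    intro α hα
    have := congrArg Complex.im (hang α hα)
    simpa [Complex.exp_ofReal_mul_I_im] using this
  have hposU : ∀ α, 1 < α → -(Real.pi / 2) < a α → ∀ t ∈ Icc 0 T, 0 < U α t := by
    intro α hα h1
    exact (hasPhase_family hq hlam hT hh hc hs hone ha ha1 hang hα.le).pos (hs α).hasDeriv
      (fun t ht => (hs α).phase_ne_zero hq hlam hc (by linarith) ht) h1
  have hVe : V e T = 0 := by rw [hV e (by linarith), hae]; simp
  have hslope := (hs e).exists_deriv_pos_of_end hq hlam hT hVe hgt
  have hcrit : ∀ α, 1 < α → (∃ s ∈ Icc 0 T, 0 < V α s) →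
      ∃ τ ∈ Icc 0 T, V α τ = 0 ∧ U α τ ≤ 1 := fun α hα ⟨s, hsT, hv⟩ =>
    (hs α).exists_critical hq hlam hh hp hα hsT hv
  have hEe : energy lam q (U e T) (V e T) < 0 := by
    obtain ⟨τ, hτ, h1, h2⟩ := hcrit e he1 hslope
    exact (hs e).energy_end_neg hq hlam hh hτ h1
      (hposU e he1 (by rw [hae]; linarith) τ hτ) h2
  obtain ⟨A, hA⟩ := htall
  set B := max A e with hB
  have hEcont : ContinuousOn (fun α => energy lam q (U α T) (V α T)) (Icc e B) := by
    obtain ⟨c1, c2⟩ := exists_continuousOn_family hq hlam hh hs e B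
    have hmap : ContinuousOn (fun α : ℝ => (α, T)) (Icc e B) := by fun_prop
    have d1 := c1.comp hmap fun α hα => ⟨hα, hTm⟩
    have d2 := c2.comp hmap fun α hα => ⟨hα, hTm⟩
    have hpot : Continuous (potential q) :=
      continuous_iff_continuousAt.2 fun x => (hasDerivAt_potential hq x).continuousAt
    exact ((d2.pow 2).div_const 2).add ((hpot.comp_continuousOn d1).const_smul lam)
  have hcompE : IsCompact {α ∈ Icc e B | energy lam q (U α T) (V α T) ∈ Ici 0} :=
    isCompact_Icc.of_isClosed_subset
      (hEcont.preimage_isClosed_of_isClosed isClosed_Icc isClosed_Ici) (fun s hs => hs.1)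
  obtain ⟨b, ⟨hbm, hbE⟩, hbleast⟩ := hcompE.exists_isLeast
    ⟨B, ⟨le_max_right _ _, le_rfl⟩, (hA B (le_max_left _ _)).le⟩
  have hbE' : 0 ≤ energy lam q (U b T) (V b T) := hbE
  have hE : ∀ α ∈ Icc e b, energy lam q (U α T) (V α T) ≤ 0 := by
    intro α hα
    by_contra! hcon
    obtain ⟨y, hy, hyE⟩ := intermediate_value_Icc hα.1
      (hEcont.mono (Icc_subset_Icc le_rfl (hα.2.trans hbm.2))) ⟨hEe.le, hcon.le⟩
    have h1 := hbleast ⟨⟨hy.1, hy.2.trans (hα.2.trans hbm.2)⟩, hyE.ge⟩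
    have h2 : y = α := le_antisymm hy.2 (hα.2.trans h1)
    rw [h2] at hyE
    exact hcon.ne' hyE
  have hUne : ∀ α ∈ Icc e b, U α T ≠ 0 := by
    intro α hα h0
    have h1 := hE α hα
    have h2 : V α T = 0 := by
      simp only [energy, potential, h0, abs_zero] at h1
      rw [Real.zero_rpow (by linarith)] at h1
      have h3 : lam * (0 / (q + 1) - 0 ^ 2 / 2) = 0 := by simp
      have : V α T ^ 2 = 0 := le_antisymm (by linarith) (sq_nonneg _)
      exact pow_eq_zero_iff two_ne_zero |>.1 this
    have := (hs α).height_eq_of_rest hq hlam hc (oddPow_zero q) ⟨hT, le_rfl⟩ h0 h2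
    linarith [hα.1]
  have hcosne : ∀ α ∈ Icc e b, Real.cos (a α) ≠ 0 := fun α hα h0 => hUne α hα (by
    rw [hU α (by linarith [hα.1]), h0, mul_zero])
  have hac : ∀ {α}, α ∈ Icc e b → ContinuousOn a (Icc e α) := fun {α} _ =>
    ha.mono fun x hx => mem_Ioi.2 (by linarith [hx.1])
  have halow : ∀ α ∈ Icc e b, -(Real.pi / 2) < a α := by
    intro α hα
    by_contra! hcon
    obtain ⟨y, hy, hya⟩ := intermediate_value_Icc' hα.1 (hac hα)
      (⟨hcon, by rw [hae]; linarith⟩ : -(Real.pi / 2) ∈ Icc (a α) (a e))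
    exact hcosne y ⟨hy.1, hy.2.trans hα.2⟩ (by rw [hya]; simp)
  have haup : ∀ α ∈ Icc e b, a α < Real.pi / 2 := by
    intro α hα
    by_contra! hcon
    obtain ⟨y, hy, hya⟩ := intermediate_value_Icc hα.1 (hac hα)
      (⟨by rw [hae]; linarith, hcon⟩ : Real.pi / 2 ∈ Icc (a e) (a α))
    exact hcosne y ⟨hy.1, hy.2.trans hα.2⟩ (by rw [hya]; simp)
  have hpos : ∀ α ∈ Icc e b, ∀ t ∈ Icc 0 T, 0 < U α t := fun α hα =>
    hposU α (by linarith [hα.1]) (halow α hα)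
  have hVne : ∀ α ∈ Icc e b, e < α → V α T ≠ 0 := by
    intro α hα hlt h0
    have hα0 : 0 < α := by linarith
    rw [hV α hα0] at h0
    have hn : ‖(U α T : ℂ) + V α T * Complex.I‖ ≠ 0 :=
      norm_ne_zero_iff.2 ((hs α).phase_ne_zero hq hlam hc hα0.ne' hTm)
    have h1 := (mul_eq_zero.1 h0).resolve_left hn
    exact hmax α hlt ((Real.sin_eq_zero_iff_of_lt_of_lt (by linarith [halow α hα])
      (by linarith [haup α hα])).1 h1)
  have hiff : ∀ α ∈ Icc e b, (∃ s ∈ Icc 0 T, 0 < V α s) ↔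
      ∃ τ ∈ Icc 0 T, V α τ = 0 ∧ U α τ ≤ 1 := by
    intro α hα
    have hα1 : 1 < α := by linarith [hα.1]
    refine ⟨hcrit α hα1, fun ⟨τ, hτ, hv, hu⟩ => ?_⟩
    rcases hα.1.eq_or_lt with h0 | hlt
    · rwa [← h0]
    · have hτ0 : 0 < τ := by
        rcases hτ.1.eq_or_lt with h0 | h0
        · rw [← h0, (hs α).init] at hu; linarith
        · exact h0
      have hτT : τ < T := by
        rcases hτ.2.eq_or_lt with h0 | h0
        · rw [h0] at hv; exact absurd hv (hVne α hα hlt)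
        · exact h0
      refine (hs α).exists_deriv_pos_of_critical hq hlam ⟨hτ0, hτT⟩ hv (hpos α hα τ hτ)
        (lt_of_le_of_ne hu fun h1 => ?_)
      have := (hs α).height_eq_of_rest hq hlam hc (oddPow_one q) ⟨hτ0, hτ.2⟩ h1 hv
      linarith
  obtain ⟨c1, c2⟩ := exists_continuousOn_family hq hlam hh hs e b
  have hclosed : IsClosed (Prod.fst '' {x ∈ Icc e b ×ˢ Icc 0 T |
      (V x.1 x.2, U x.1 x.2) ∈ ({0} : Set ℝ) ×ˢ Iic (1 : ℝ)}) := by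
    have hcl := (c2.prodMk c1).preimage_isClosed_of_isClosed
      (isClosed_Icc.prod isClosed_Icc) ((isClosed_singleton (x := (0:ℝ))).prod
        (isClosed_Iic (a := (1:ℝ))))
    exact (((isCompact_Icc.prod isCompact_Icc).of_isClosed_subset hcl
      (fun x hx => hx.1)).image continuous_fst).isClosed
  have hconn := (isPreconnected_Icc (a := e) (b := b)).induction₂
    (fun x y => (∃ τ ∈ Icc 0 T, V x τ = 0 ∧ U x τ ≤ 1) ↔
      (∃ τ ∈ Icc 0 T, V y τ = 0 ∧ U y τ ≤ 1)) (fun x hx => by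
      by_cases hY : ∃ τ ∈ Icc 0 T, V x τ = 0 ∧ U x τ ≤ 1
      · obtain ⟨s, hsT, hv⟩ := (hiff x hx).2 hY
        have hmap : ContinuousOn (fun α : ℝ => (α, s)) (Icc e b) := by fun_prop
        have d2 := c2.comp hmap fun α hα => ⟨hα, hsT⟩
        filter_upwards [(d2 x hx).eventually_const_lt hv, self_mem_nhdsWithin] with y hy hym
        exact ⟨fun _ => (hiff y hym).1 ⟨s, hsT, hy⟩, fun _ => hY⟩
      · have hxn : x ∉ Prod.fst '' {x ∈ Icc e b ×ˢ Icc 0 T |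
            (V x.1 x.2, U x.1 x.2) ∈ ({0} : Set ℝ) ×ˢ Iic (1 : ℝ)} := by
          rintro ⟨⟨x', τ⟩, ⟨hm, hv, hu⟩, rfl⟩
          exact hY ⟨τ, hm.2, hv, hu⟩
        filter_upwards [nhdsWithin_le_nhds (hclosed.isOpen_compl.mem_nhds hxn),
          self_mem_nhdsWithin] with y hy hym
        refine ⟨fun h1 => absurd h1 hY, fun ⟨τ, hτ, hv, hu⟩ => absurd ?_ hy⟩
        exact ⟨(y, τ), ⟨⟨hym, hτ⟩, hv, hu⟩, rfl⟩)
    (fun _ _ _ _ _ _ h1 h2 => h1.trans h2) (fun _ _ _ _ h1 => h1.symm)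
    (⟨le_rfl, hbm.1⟩ : e ∈ Icc e b) (⟨hbm.1, le_rfl⟩ : b ∈ Icc e b)
  obtain ⟨τ, hτ, hv, hu⟩ := hconn.1 (hcrit e he1 hslope)
  have := (hs b).energy_end_neg hq hlam hh hτ hv (hpos b ⟨hbm.1, le_rfl⟩ τ hτ) hu
  linarith

end Family

theorem SolOn.isShot {h : ℝ → ℝ} {lam q T α : ℝ} {u u' u'' : ℝ → ℝ}
    (hu : SolOn h lam q (Icc 0 T) (Ioc 0 T) u u' u'') (h0 : u 0 = α) (h1 : u' 0 = 0) :
    IsShot h lam q T α u u' := by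
  obtain ⟨ha, hb, hc, -, he⟩ := hu
  refine ⟨ha, hb, fun t ht => (hc t ht).congr_deriv ?_, h0, h1⟩
  have := he t ht
  unfold oddPow
  linarith

theorem solOn_one (h : ℝ → ℝ) (lam q : ℝ) (S Sint : Set ℝ) :
    SolOn h lam q S Sint (fun _ => 1) (fun _ => 0) (fun _ => 0) :=
  ⟨fun t _ => hasDerivWithinAt_const t S 1, continuousOn_const,
    fun t _ => hasDerivWithinAt_const t Sint 0, continuousOn_const, fun t _ => by simp⟩

theorem enorm2_eq_norm (x y : ℝ) : enorm2 (x, y) = ‖(x : ℂ) + y * Complex.I‖ := by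
  rw [Complex.norm_add_mul_I, enorm2]

theorem subcritical_of_min {n m₁ m₂ : ℤ} {q : ℝ} (hm₁n : m₁ ≤ n - 2) (hq : 1 < q)
    (hqsub : min m₁ m₂ < n - 2 →
      q < ((n : ℝ) - (min m₁ m₂ : ℝ) + 2) / ((n : ℝ) - (min m₁ m₂ : ℝ) - 2)) :
    ((n : ℝ) - m₁ - 1 - 1) * q < (n : ℝ) - m₁ - 1 + 3 := by
  rcases hm₁n.eq_or_lt with h1 | h1
  · rw [h1]
    push_cast
    linarith
  · have hlt : min m₁ m₂ < n - 2 := (min_le_left _ _).trans_lt h1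
    have h2 := hqsub hlt
    have h3 : ((min m₁ m₂ : ℤ) : ℝ) < n - 2 := by exact_mod_cast hlt
    rw [Int.cast_min] at h3
    rw [lt_div_iff₀ (by linarith)] at h2
    have h4 : min (m₁ : ℝ) m₂ ≤ m₁ := min_le_left _ _
    nlinarith

theorem stmt_19
    (d lam : ℝ) (hd : 0 < d) (hlam : 0 < lam)
    (n m₁ m₂ : ℤ) (hn : 3 ≤ n)
    (hm₁0 : 0 ≤ m₁) (hm₁n : m₁ ≤ n - 2) (hm₂0 : 0 ≤ m₂) (hm₂n : m₂ ≤ n - 2)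
    (h : ℝ → ℝ) (hC1 : ContDiffOn ℝ 1 h (Set.Ioo 0 d))
    (hder : ∀ t ∈ Set.Ioo 0 d, deriv h t < 0)
    (hlim0 : Filter.Tendsto (fun t => t * h t) (nhdsWithin 0 (Set.Ioi 0))
      (nhds ((n : ℝ) - (m₁ : ℝ) - 1)))
    (hlimd : Filter.Tendsto (fun t => (t - d) * h t) (nhdsWithin d (Set.Iio d))
      (nhds ((n : ℝ) - (m₂ : ℝ) - 1)))
    (q : ℝ) (hq1 : 1 < q)
    (hqsub : min m₁ m₂ < n - 2 →
      q < ((n : ℝ) - (min m₁ m₂ : ℝ) + 2) / ((n : ℝ) - (min m₁ m₂ : ℝ) - 2))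
    (t₀ : ℝ) (ht₀ : t₀ ∈ Set.Ioo 0 d)
    (hpos : ∀ t ∈ Set.Ioo 0 t₀, 0 < h t) (hneg : ∀ t ∈ Set.Ioo t₀ d, h t < 0)
    (U U' U'' : ℝ → ℝ → ℝ)
    (hU : ∀ α : ℝ, SolOn h lam q (Set.Icc 0 t₀) (Set.Ioc 0 t₀) (U α) (U' α) (U'' α) ∧
      U α 0 = α ∧ U' α 0 = 0)
    (hUuniq : ∀ α : ℝ, ∀ u u' u'' : ℝ → ℝ,
      SolOn h lam q (Set.Icc 0 t₀) (Set.Ioc 0 t₀) u u' u'' → u 0 = α → u' 0 = 0 →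
      ∀ t ∈ Set.Icc 0 t₀, u t = U α t ∧ u' t = U' α t)
    (a : ℝ → ℝ) (haCont : ContinuousOn a (Set.Ioi 0)) (ha1 : a 1 = 0)
    (haAngle : ∀ α : ℝ, 0 < α →
      U α t₀ = enorm2 (U α t₀, U' α t₀) * Real.cos (a α) ∧
      U' α t₀ = enorm2 (U α t₀, U' α t₀) * Real.sin (a α))
    (e₀ : ℝ) (he₀ : IsGreatest {α : ℝ | 0 < α ∧ a α = 0} e₀) :
    U' e₀ t₀ = 0 ∧ 0 < U e₀ t₀ ∧ U e₀ t₀ ≤ 1 := by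
  have hT := ht₀.1
  have hTm : t₀ ∈ Icc 0 t₀ := ⟨hT.le, le_rfl⟩
  have hc : ContinuousOn h (Ioo 0 d) := hC1.continuousOn
  have hsub : Ioc 0 t₀ ⊆ Ioo 0 d := fun t ht => ⟨ht.1, ht.2.trans_lt ht₀.2⟩
  have hs : ∀ α, IsShot h lam q t₀ α (U α) (U' α) := fun α =>
    (hU α).1.isShot (hU α).2.1 (hU α).2.2
  have hone : ∀ t ∈ Icc 0 t₀, U 1 t = 1 ∧ U' 1 t = 0 := fun t ht => by
    obtain ⟨h1, h2⟩ := hUuniq 1 _ _ _ (solOn_one h lam q _ _) rfl rfl t ht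
    exact ⟨h1.symm, h2.symm⟩
  have hang : ∀ α, 0 < α → (U α t₀ : ℂ) + U' α t₀ * Complex.I =
      ‖(U α t₀ : ℂ) + U' α t₀ * Complex.I‖ * Complex.exp (a α * Complex.I) := by
    intro α hα
    obtain ⟨h1, h2⟩ := haAngle α hα
    rw [← enorm2_eq_norm, Complex.exp_mul_I]
    set ρ := enorm2 (U α t₀, U' α t₀)
    rw [h1, h2]
    push_cast
    ring
  obtain ⟨⟨he0, hae⟩, hmax⟩ := he₀
  obtain ⟨h1, h2⟩ := haAngle e₀ he0
  rw [hae, Real.cos_zero, mul_one, enorm2_eq_norm] at h1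
  rw [hae, Real.sin_zero, mul_zero] at h2
  refine ⟨h2, ?_, ?_⟩
  · rw [h1]
    exact norm_pos_iff.2 ((hs e₀).phase_ne_zero hq1 hlam (hc.mono hsub) he0.ne' hTm)
  · have he1 : 1 ≤ e₀ := hmax ⟨one_pos, ha1⟩
    rcases he1.eq_or_lt with h3 | h3
    · rw [← h3]
      exact (hone t₀ hTm).1.le
    · have hk : (1 : ℝ) ≤ n - m₁ - 1 := by
        have : (m₁ : ℝ) ≤ n - 2 := by exact_mod_cast hm₁n
        linarith
      obtain ⟨p, hp⟩ := exists_weight hc ht₀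
      obtain ⟨A, hA⟩ := exists_energy_pos hq1 hlam hc ht₀ hpos hk
        (subcritical_of_min hm₁n hq1 hqsub) hlim0
      exact endpoint_le_one hq1 hlam hT hpos (hc.mono hsub) (fun t ht => hp t (hsub ht)) hs hone
        ⟨A, fun α hα => hA α _ _ hα (hs α)⟩ haCont ha1 hang h3 hae
        fun α hα h4 => (hmax ⟨he0.trans hα, h4⟩).not_gt hα
end
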